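/- arXiv:2507.21689 — 3 statements merged into one kernel-verified Lean document; each statement's English description precedes it below -/
import Mathlib

section
/- Let $\alpha > 1$ be a real number. There exists a constant $N_0$ such that for every $n \ge N_0$, every triangle-free ($K_3$-free) graph $G$ on $n$ vertices satisfies $\lambda_{\alpha,C_5}(G) \le \max\{\lambda_{\alpha,C_5}(H) : H$ is a $C_5$-colorable graph on $n$ vertices$\}$, with equality only if $G$ is $C_5$-colorable. -/
open scoped Classical
open Finset Filter Real

/-- An `r`-uniform hypergraph on vertex set `Fin n`. -/
structure RGraph (r n : ℕ) where
  edges : Finset (Finset (Fin n))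
  card_eq : ∀ e ∈ edges, e.card = r

/-- The set (as a `Finset`) of injective homomorphisms from `Q` to `H`. -/
noncomputable def Inj {r a b : ℕ} (Q : RGraph r a) (H : RGraph r b) :
    Finset (Fin a → Fin b) :=
  Finset.univ.filter fun φ => Function.Injective φ ∧ ∀ e ∈ Q.edges, e.image φ ∈ H.edges

/-- The Lagrangian `Q`-polynomial of `H`. -/
noncomputable def lagPoly {r a n : ℕ} (Q : RGraph r a) (H : RGraph r n)
    (x : Fin n → ℝ) : ℝ :=
  ∑ φ ∈ Inj Q H, ∏ i ∈ Finset.univ.image φ, x i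

/-- The domain `Δ_α^{n-1} = {x : |x_1|^α + ⋯ + |x_n|^α = 1}`. -/
def simplex (α : ℝ) (n : ℕ) : Set (Fin n → ℝ) :=
  {x | ∑ i, |x i| ^ α = 1}

/-- The `(α,Q)`-spectral radius of `H`. -/
noncomputable def specRad (α : ℝ) {r a n : ℕ} (Q : RGraph r a) (H : RGraph r n) : ℝ :=
  sSup (lagPoly Q H '' simplex α n)

/-- The set of optimal vectors. -/
noncomputable def OPT (α : ℝ) {r a n : ℕ} (Q : RGraph r a) (H : RGraph r n) :
    Set (Fin n → ℝ) :=
  {x ∈ simplex α n | lagPoly Q H x = specRad α Q H}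
/-- The 5-cycle `C₅` as a 2-graph on 5 vertices. -/
def C5 : RGraph 2 5 where
  edges := {{0, 1}, {1, 2}, {2, 3}, {3, 4}, {4, 0}}
  card_eq := by decide

/-- The triangle `K₃` as a 2-graph on 3 vertices. -/
def K3 : RGraph 2 3 where
  edges := {{0, 1}, {1, 2}, {0, 2}}
  card_eq := by decide

/-- A graph is `C₅`-colorable if it admits a homomorphism to `C₅`. -/
def C5Colorable {n : ℕ} (G : RGraph 2 n) : Prop :=
  ∃ φ : Fin n → Fin 5, ∀ e ∈ G.edges, e.image φ ∈ C5.edges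


/-- Boolean to integer indicator. -/
def bz (b : Bool) : ℤ := cond b 1 0

/-- indicator of a labelled five-cycle -/
def cy (a b c d e : Bool) : ℤ := cond (a && b && c && d && e) 1 0

/-- linear functionals on attachments, empty type -/
def fA : Bool → Bool → Bool → ℤ
  | false, false, false => 2
  | true, false, false => -1
  | false, true, false => -1
  | false, false, true => -1
  | true, true, true => -3
  | _, _, _ => 0

def fB : Bool → Bool → Bool → ℤ
  | true, false, false => 1
  | false, true, false => 1
  | false, false, true => 1
  | true, true, false => -1
  | true, false, true => -1
  | false, true, true => -1
  | _, _, _ => 0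

def gA : Bool → Bool → Bool → ℤ
  | true, false, false => 1
  | false, true, true => -1
  | _, _, _ => 0

def h0 (p q r p' q' r' : Bool) : ℤ :=
  3600 * (fA p q r * fA p' q' r') - 15610 * (fA p q r * fB p' q' r' + fB p q r * fA p' q' r')
    + 68440 * (fB p q r * fB p' q' r')
    + 26250 * ((gA p q r - gA q p r) * (gA p' q' r' - gA q' p' r')
      + (gA q p r - gA r p q) * (gA q' p' r' - gA r' p' q')
      + (gA p q r - gA r p q) * (gA p' q' r' - gA r' p' q'))

/-- functionals for the type with the single edge `ab` -/
def s1 : Bool → Bool → Bool → ℤ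
  | false, false, false => -2
  | true, false, false => 1
  | false, true, false => 1
  | _, _, _ => 0

def s2 : Bool → Bool → Bool → ℤ
  | true, false, false => 1
  | false, true, false => 1
  | true, false, true => -1
  | false, true, true => -1
  | _, _, _ => 0

def s3 : Bool → Bool → Bool → ℤ
  | false, false, true => 1
  | _, _, _ => 0

def t1 : Bool → Bool → Bool → ℤ
  | true, false, false => 1
  | false, true, false => -1
  | _, _, _ => 0

def t2 : Bool → Bool → Bool → ℤ
  | true, false, true => 1
  | false, true, true => -1
  | _, _, _ => 0

def h1 (p q r p' q' r' : Bool) : ℤ :=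
  30135 * (s1 p q r * s1 p' q' r') + 8960 * (s1 p q r * s2 p' q' r' + s2 p q r * s1 p' q' r')
    + 51250 * (s1 p q r * s3 p' q' r' + s3 p q r * s1 p' q' r')
    + 32800 * (s2 p q r * s2 p' q' r')
    - 22500 * (s2 p q r * s3 p' q' r' + s3 p q r * s2 p' q' r')
    + 187500 * (s3 p q r * s3 p' q' r')
    + 30625 * (t1 p q r * t1 p' q' r') - 3125 * (t1 p q r * t2 p' q' r' + t2 p q r * t1 p' q' r')
    + 435000 * (t2 p q r * t2 p' q' r')

/-- functionals for the path type, with centre `b` -/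
def u1 : Bool → Bool → Bool → ℤ
  | false, false, false => 2
  | false, true, false => 1
  | true, false, true => -2
  | _, _, _ => 0

def u2 : Bool → Bool → Bool → ℤ
  | false, false, false => 4
  | true, false, true => -2
  | true, false, false => 1
  | false, false, true => 1
  | _, _, _ => 0

def v1 : Bool → Bool → Bool → ℤ
  | true, false, false => 1
  | false, false, true => -1
  | _, _, _ => 0

def h2 (p q r p' q' r' : Bool) : ℤ :=
  39400 * (u1 p q r * u1 p' q' r') - 41200 * (u1 p q r * u2 p' q' r' + u2 p q r * u1 p' q' r')
    + 51250 * (u2 p q r * u2 p' q' r') + 400000 * (v1 p q r * v1 p' q' r')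

/-- the full sum-of-squares kernel, arguments `ab ac bc`, `ad bd cd`, `ae be ce` -/
def hs (ab ac bc p q r p' q' r' : Bool) : ℤ :=
  match ab, ac, bc with
  | false, false, false => h0 p q r p' q' r'
  | true, false, false => h1 p q r p' q' r'
  | false, true, false => h1 p r q p' r' q'
  | false, false, true => h1 q r p q' r' p'
  | true, true, false => h2 q p r q' p' r'
  | true, false, true => h2 p q r p' q' r'
  | false, true, true => h2 p r q p' r' q'
  | true, true, true => 0

set_option maxRecDepth 100000 in
theorem pointwise_cert : ∀ e01 e02 e03 e04 e12 e13 e14 e23 e24 e34 : Bool,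
    (!(e01 && e02 && e12) && !(e01 && e03 && e13) && !(e01 && e04 && e14) && !(e02 && e03 && e23) && !(e02 && e04 && e24) && !(e03 && e04 && e34) && !(e12 && e13 && e23) && !(e12 && e14 && e24) && !(e13 && e14 && e34) && !(e23 && e24 && e34)) = true →
    0 ≤ 144000 + 1500 * (bz e01 + bz e02 + bz e03 + bz e04 + bz e12 + bz e13 + bz e14 + bz e23 + bz e24 + bz e34)
      - 3906250 * (cy e01 e12 e23 e34 e04 + cy e01 e12 e24 e34 e03 + cy e01 e13 e23 e24 e04 + cy e01 e13 e34 e24 e02 + cy e01 e14 e24 e23 e03 + cy e01 e14 e34 e23 e02 + cy e02 e12 e13 e34 e04 + cy e02 e12 e14 e34 e03 + cy e02 e23 e13 e14 e04 + cy e02 e24 e14 e13 e03 + cy e03 e13 e12 e24 e04 + cy e03 e23 e12 e14 e04)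
      - (hs e23 e24 e34 e02 e03 e04 e12 e13 e14
        + hs e13 e14 e34 e01 e03 e04 e12 e23 e24
        + hs e12 e14 e24 e01 e02 e04 e13 e23 e34
        + hs e12 e13 e23 e01 e02 e03 e14 e24 e34
        + hs e03 e04 e34 e01 e13 e14 e02 e23 e24
        + hs e02 e04 e24 e01 e12 e14 e03 e23 e34
        + hs e02 e03 e23 e01 e12 e13 e04 e24 e34
        + hs e01 e04 e14 e02 e12 e24 e03 e13 e34
        + hs e01 e03 e13 e02 e12 e23 e04 e14 e34
        + hs e01 e02 e12 e03 e13 e23 e04 e14 e24) := by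
  decide +kernel


section flag
set_option linter.unusedSectionVars false
variable {V : Type*} [Fintype V]

/-- Five-fold weighted sum. -/
def S5 (w : V → ℝ) (f : V → V → V → V → V → ℝ) : ℝ :=
  ∑ a, ∑ b, ∑ c, ∑ d, ∑ e, w a * w b * w c * w d * w e * f a b c d e

theorem S5_fun (w : V → ℝ) (f : V → V → V → V → V → ℝ) :
    S5 w f = ∑ t : Fin 5 → V, (∏ i, w (t i)) * f (t 0) (t 1) (t 2) (t 3) (t 4) := by
  have key : ∀ (k : ℕ) (g : (Fin (k+1) → V) → ℝ),
      ∑ t, g t = ∑ a, ∑ t : Fin k → V, g (Fin.cons a t) := by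
    intro k g
    rw [← Fintype.sum_prod_type']
    exact (Fintype.sum_equiv (Fin.consEquiv (fun _ => V)) _ _ (fun x => rfl)).symm
  unfold S5
  simp only [key, Fintype.sum_unique]
  refine Finset.sum_congr rfl fun a _ => Finset.sum_congr rfl fun b _ => Finset.sum_congr rfl
    fun c _ => Finset.sum_congr rfl fun d _ => Finset.sum_congr rfl fun e _ => ?_
  rw [Fin.prod_univ_five]
  rfl

theorem S5_perm (w : V → ℝ) (f : V → V → V → V → V → ℝ) (σ : Fin 5 → Fin 5)
    (hσ : Function.Bijective σ) :
    S5 w (fun a b c d e => f (![a, b, c, d, e] (σ 0)) (![a, b, c, d, e] (σ 1))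
      (![a, b, c, d, e] (σ 2)) (![a, b, c, d, e] (σ 3)) (![a, b, c, d, e] (σ 4))) = S5 w f := by
  rw [S5_fun, S5_fun]
  have ht : ∀ t : Fin 5 → V, ![t 0, t 1, t 2, t 3, t 4] = t := by
    intro t; funext i; fin_cases i <;> rfl
  simp only [ht]
  let pe : Equiv.Perm (Fin 5) := Equiv.ofBijective σ hσ
  refine Fintype.sum_equiv (Equiv.arrowCongr pe.symm (Equiv.refl V)) _ _ fun t => ?_
  have h1 : ∀ i, (Equiv.arrowCongr pe.symm (Equiv.refl V)) t i = t (σ i) := by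
    intro i; rfl
  simp only [h1]
  congr 1
  exact (Equiv.prod_comp pe (fun i => w (t i))).symm

theorem S5_add (w : V → ℝ) (f g : V → V → V → V → V → ℝ) :
    S5 w (fun a b c d e => f a b c d e + g a b c d e) = S5 w f + S5 w g := by
  simp only [S5, mul_add, Finset.sum_add_distrib]

theorem S5_sub (w : V → ℝ) (f g : V → V → V → V → V → ℝ) :
    S5 w (fun a b c d e => f a b c d e - g a b c d e) = S5 w f - S5 w g := by
  simp only [S5, mul_sub, Finset.sum_sub_distrib]

theorem S5_smul (w : V → ℝ) (k : ℝ) (f : V → V → V → V → V → ℝ) :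
    S5 w (fun a b c d e => k * f a b c d e) = k * S5 w f := by
  simp only [S5, Finset.mul_sum]
  refine Finset.sum_congr rfl fun a _ => Finset.sum_congr rfl fun b _ => Finset.sum_congr rfl
    fun c _ => Finset.sum_congr rfl fun d _ => Finset.sum_congr rfl fun e _ => ?_
  ring

theorem S5_const (w : V → ℝ) (k : ℝ) :
    S5 w (fun _ _ _ _ _ => k) = k * (∑ a, w a) ^ 5 := by
  simp only [S5, pow_succ, pow_zero, one_mul, Finset.sum_mul, Finset.mul_sum]
  refine Finset.sum_congr rfl fun a _ => Finset.sum_congr rfl fun b _ => Finset.sum_congr rfl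
    fun c _ => Finset.sum_congr rfl fun d _ => Finset.sum_congr rfl fun e _ => ?_
  ring

theorem S5_nonneg (w : V → ℝ) (hw : ∀ v, 0 ≤ w v) (f : V → V → V → V → V → ℝ)
    (hf : ∀ a b c d e, 0 ≤ f a b c d e) : 0 ≤ S5 w f := by
  refine Finset.sum_nonneg fun a _ => Finset.sum_nonneg fun b _ => Finset.sum_nonneg
    fun c _ => Finset.sum_nonneg fun d _ => Finset.sum_nonneg fun e _ => ?_
  have := hw a; have := hw b; have := hw c; have := hw d; have := hw e
  have := hf a b c d e
  positivity

/-- labelled five-cycle indicator -/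
def cyF (A : V → V → Bool) (a b c d e : V) : ℤ :=
  cy (A a b) (A b c) (A c d) (A d e) (A e a)

def hsF (A : V → V → Bool) (a b c d e : V) : ℤ :=
  hs (A a b) (A a c) (A b c) (A a d) (A b d) (A c d) (A a e) (A b e) (A c e)

theorem pointwise_A (A : V → V → Bool) (hA : ∀ a b, A a b = A b a)
    (htri : ∀ a b c, (A a b && A a c && A b c) = false) (a b c d e : V) :
    0 ≤ 144000 + 1500 * (bz (A a b) + bz (A a c) + bz (A a d) + bz (A a e) + bz (A b c) + bz (A b d) + bz (A b e) + bz (A c d) + bz (A c e) + bz (A d e))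
      - 3906250 * (cyF A a b c d e
        + cyF A a b c e d
        + cyF A a b d c e
        + cyF A a b d e c
        + cyF A a b e c d
        + cyF A a b e d c
        + cyF A a c b d e
        + cyF A a c b e d
        + cyF A a c d b e
        + cyF A a c e b d
        + cyF A a d b c e
        + cyF A a d c b e)
      - (hsF A c d e a b
        + hsF A b d e a c
        + hsF A b c e a d
        + hsF A b c d a e
        + hsF A a d e b c
        + hsF A a c e b d
        + hsF A a c d b e
        + hsF A a b e c d
        + hsF A a b d c e
        + hsF A a b c d e) := by
  have h := pointwise_cert (A a b) (A a c) (A a d) (A a e) (A b c) (A b d) (A b e) (A c d) (A c e) (A d e)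
    (by simp only [htri]; rfl)
  simp only [cyF, hsF, hA b a, hA c a, hA d a, hA e a, hA c b, hA d b, hA e b, hA d c, hA e c, hA e d]
  exact h

theorem bil_sum (w f g : V → ℝ) :
    ∑ d, ∑ e, w d * w e * (f d * g e) = (∑ d, w d * f d) * (∑ e, w e * g e) := by
  rw [Finset.sum_mul_sum]
  refine Finset.sum_congr rfl fun a _ => Finset.sum_congr rfl fun b _ => ?_
  ring

theorem h0_psd (w : V → ℝ) (p q r : V → Bool) :
    0 ≤ ∑ d, ∑ e, w d * w e * ((h0 (p d) (q d) (r d) (p e) (q e) (r e) : ℤ) : ℝ) := by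
  set X := ∑ d, w d * ((fA (p d) (q d) (r d) : ℤ) : ℝ) with hX
  set Y := ∑ d, w d * ((fB (p d) (q d) (r d) : ℤ) : ℝ) with hY
  set P := ∑ d, w d * ((gA (p d) (q d) (r d) - gA (q d) (p d) (r d) : ℤ) : ℝ) with hP
  set Q := ∑ d, w d * ((gA (q d) (p d) (r d) - gA (r d) (p d) (q d) : ℤ) : ℝ) with hQ
  set R := ∑ d, w d * ((gA (p d) (q d) (r d) - gA (r d) (p d) (q d) : ℤ) : ℝ) with hR
  have : ∑ d, ∑ e, w d * w e * ((h0 (p d) (q d) (r d) (p e) (q e) (r e) : ℤ) : ℝ)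
      = 3600 * (X * X) - 15610 * (X * Y + Y * X) + 68440 * (Y * Y)
        + 26250 * (P * P + Q * Q + R * R) := by
    simp only [hX, hY, hP, hQ, hR, ← bil_sum]
    simp only [Finset.mul_sum, ← Finset.sum_add_distrib, ← Finset.sum_sub_distrib]
    refine Finset.sum_congr rfl fun a _ => Finset.sum_congr rfl fun b _ => ?_
    simp only [h0]
    push_cast
    ring
  rw [this]
  nlinarith [sq_nonneg (X - 1561/360 * Y), sq_nonneg Y, sq_nonneg P, sq_nonneg Q, sq_nonneg R]

theorem h1_psd (w : V → ℝ) (p q r : V → Bool) :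
    0 ≤ ∑ d, ∑ e, w d * w e * ((h1 (p d) (q d) (r d) (p e) (q e) (r e) : ℤ) : ℝ) := by
  set X := ∑ d, w d * ((s1 (p d) (q d) (r d) : ℤ) : ℝ) with hX
  set Y := ∑ d, w d * ((s2 (p d) (q d) (r d) : ℤ) : ℝ) with hY
  set Z := ∑ d, w d * ((s3 (p d) (q d) (r d) : ℤ) : ℝ) with hZ
  set P := ∑ d, w d * ((t1 (p d) (q d) (r d) : ℤ) : ℝ) with hP
  set Q := ∑ d, w d * ((t2 (p d) (q d) (r d) : ℤ) : ℝ) with hQ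
  have : ∑ d, ∑ e, w d * w e * ((h1 (p d) (q d) (r d) (p e) (q e) (r e) : ℤ) : ℝ)
      = 30135 * (X * X) + 8960 * (X * Y + Y * X) + 51250 * (X * Z + Z * X)
        + 32800 * (Y * Y) - 22500 * (Y * Z + Z * Y) + 187500 * (Z * Z)
        + 30625 * (P * P) - 3125 * (P * Q + Q * P) + 435000 * (Q * Q) := by
    simp only [hX, hY, hZ, hP, hQ, ← bil_sum]
    simp only [Finset.mul_sum, ← Finset.sum_add_distrib, ← Finset.sum_sub_distrib]
    refine Finset.sum_congr rfl fun a _ => Finset.sum_congr rfl fun b _ => ?_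
    simp only [h1]
    push_cast
    ring
  rw [this]
  nlinarith [sq_nonneg (X + 256/861 * Y + 250/147 * Z), sq_nonneg (Y - 1624625/1297352 * Z),
    sq_nonneg Z, sq_nonneg (P - 5/49 * Q), sq_nonneg Q]

theorem h2_psd (w : V → ℝ) (p q r : V → Bool) :
    0 ≤ ∑ d, ∑ e, w d * w e * ((h2 (p d) (q d) (r d) (p e) (q e) (r e) : ℤ) : ℝ) := by
  set X := ∑ d, w d * ((u1 (p d) (q d) (r d) : ℤ) : ℝ) with hX
  set Y := ∑ d, w d * ((u2 (p d) (q d) (r d) : ℤ) : ℝ) with hY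
  set P := ∑ d, w d * ((v1 (p d) (q d) (r d) : ℤ) : ℝ) with hP
  have : ∑ d, ∑ e, w d * w e * ((h2 (p d) (q d) (r d) (p e) (q e) (r e) : ℤ) : ℝ)
      = 39400 * (X * X) - 41200 * (X * Y + Y * X) + 51250 * (Y * Y) + 400000 * (P * P) := by
    simp only [hX, hY, hP, ← bil_sum]
    simp only [Finset.mul_sum, ← Finset.sum_add_distrib, ← Finset.sum_sub_distrib]
    refine Finset.sum_congr rfl fun a _ => Finset.sum_congr rfl fun b _ => ?_
    simp only [h2]
    push_cast
    ring
  rw [this]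
  nlinarith [sq_nonneg (X - 206/197 * Y), sq_nonneg Y, sq_nonneg P]

theorem hsF_psd (w : V → ℝ) (hw : ∀ v, 0 ≤ w v) (A : V → V → Bool) :
    0 ≤ S5 w (fun a b c d e => ((hsF A a b c d e : ℤ) : ℝ)) := by
  refine Finset.sum_nonneg fun a _ => Finset.sum_nonneg fun b _ => Finset.sum_nonneg fun c _ => ?_
  have hfac : ∑ d, ∑ e, w a * w b * w c * w d * w e * ((hsF A a b c d e : ℤ) : ℝ)
      = w a * w b * w c * ∑ d, ∑ e, w d * w e * ((hsF A a b c d e : ℤ) : ℝ) := by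
    simp only [Finset.mul_sum]
    refine Finset.sum_congr rfl fun a _ => Finset.sum_congr rfl fun b _ => ?_
    ring
  rw [hfac]
  have := hw a; have := hw b; have := hw c
  refine mul_nonneg (by positivity) ?_
  simp only [hsF]
  rcases A a b <;> rcases A a c <;> rcases A b c <;> simp only [hs]
  · exact h0_psd w _ _ _
  · exact h1_psd w _ _ _
  · exact h1_psd w _ _ _
  · exact h2_psd w _ _ _
  · exact h1_psd w _ _ _
  · exact h2_psd w _ _ _
  · exact h2_psd w _ _ _
  · simp

/-- weighted pentagon density -/
def TT (A : V → V → Bool) (w : V → ℝ) : ℝ := S5 w (fun a b c d e => ((cyF A a b c d e : ℤ) : ℝ))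

/-- weighted edge density -/
def EE (A : V → V → Bool) (w : V → ℝ) : ℝ := ∑ a, ∑ b, w a * w b * ((bz (A a b) : ℤ) : ℝ)

theorem S5_edge (A : V → V → Bool) (w : V → ℝ) :
    S5 w (fun a b _ _ _ => ((bz (A a b) : ℤ) : ℝ)) = EE A w * (∑ a, w a) ^ 3 := by
  have h3 : (∑ a, w a) ^ 3 = ∑ c, ∑ d, ∑ e, w c * (w d * w e) := by
    rw [pow_three, Finset.sum_mul_sum, Finset.sum_mul_sum]
    refine Finset.sum_congr rfl fun c _ => ?_
    simp only [Finset.mul_sum]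
  rw [h3]
  simp only [S5, EE, Finset.sum_mul]
  refine Finset.sum_congr rfl fun a _ => Finset.sum_congr rfl fun b _ => ?_
  simp only [Finset.mul_sum]
  refine Finset.sum_congr rfl fun c _ => Finset.sum_congr rfl fun d _ =>
    Finset.sum_congr rfl fun e _ => ?_
  ring

theorem flag_ineq (A : V → V → Bool) (hA : ∀ a b, A a b = A b a)
    (htri : ∀ a b c, (A a b && A a c && A b c) = false) (w : V → ℝ) (hw : ∀ v, 0 ≤ w v) :
    46875 * TT A w ≤ 144 * (∑ a, w a) ^ 5 + 15 * (EE A w * (∑ a, w a) ^ 3) := by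
  have h := S5_nonneg w hw (fun a b c d e => 144000 + 1500 * (((bz (A a b) : ℤ) : ℝ) + ((bz (A a c) : ℤ) : ℝ) + ((bz (A a d) : ℤ) : ℝ) + ((bz (A a e) : ℤ) : ℝ) + ((bz (A b c) : ℤ) : ℝ) + ((bz (A b d) : ℤ) : ℝ) + ((bz (A b e) : ℤ) : ℝ) + ((bz (A c d) : ℤ) : ℝ) + ((bz (A c e) : ℤ) : ℝ) + ((bz (A d e) : ℤ) : ℝ))
      - 3906250 * (((cyF A a b c d e : ℤ) : ℝ)
        + ((cyF A a b c e d : ℤ) : ℝ)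
        + ((cyF A a b d c e : ℤ) : ℝ)
        + ((cyF A a b d e c : ℤ) : ℝ)
        + ((cyF A a b e c d : ℤ) : ℝ)
        + ((cyF A a b e d c : ℤ) : ℝ)
        + ((cyF A a c b d e : ℤ) : ℝ)
        + ((cyF A a c b e d : ℤ) : ℝ)
        + ((cyF A a c d b e : ℤ) : ℝ)
        + ((cyF A a c e b d : ℤ) : ℝ)
        + ((cyF A a d b c e : ℤ) : ℝ)
        + ((cyF A a d c b e : ℤ) : ℝ))
      - (((hsF A c d e a b : ℤ) : ℝ)
        + ((hsF A b d e a c : ℤ) : ℝ)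
        + ((hsF A b c e a d : ℤ) : ℝ)
        + ((hsF A b c d a e : ℤ) : ℝ)
        + ((hsF A a d e b c : ℤ) : ℝ)
        + ((hsF A a c e b d : ℤ) : ℝ)
        + ((hsF A a c d b e : ℤ) : ℝ)
        + ((hsF A a b e c d : ℤ) : ℝ)
        + ((hsF A a b d c e : ℤ) : ℝ)
        + ((hsF A a b c d e : ℤ) : ℝ))) (fun a b c d e => by
    have := pointwise_A A hA htri a b c d e
    exact_mod_cast this)
  simp only [S5_sub, S5_add, S5_smul] at h
  rw [S5_const w 144000] at h
  have hc : ∀ σ : Fin 5 → Fin 5, Function.Bijective σ → S5 w (fun a b c d e =>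
      ((cyF A (![a, b, c, d, e] (σ 0)) (![a, b, c, d, e] (σ 1))
      (![a, b, c, d, e] (σ 2)) (![a, b, c, d, e] (σ 3)) (![a, b, c, d, e] (σ 4)) : ℤ) : ℝ))
      = TT A w :=
    fun σ hσ => S5_perm w (fun a b c d e => ((cyF A a b c d e : ℤ) : ℝ)) σ hσ
  have hh : ∀ σ : Fin 5 → Fin 5, Function.Bijective σ → 0 ≤ S5 w (fun a b c d e =>
      ((hsF A (![a, b, c, d, e] (σ 0)) (![a, b, c, d, e] (σ 1))
      (![a, b, c, d, e] (σ 2)) (![a, b, c, d, e] (σ 3)) (![a, b, c, d, e] (σ 4)) : ℤ) : ℝ)) := by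
    intro σ hσ
    rw [S5_perm w (fun a b c d e => ((hsF A a b c d e : ℤ) : ℝ)) σ hσ]
    exact hsF_psd w hw A
  have he : ∀ σ : Fin 5 → Fin 5, Function.Bijective σ → S5 w (fun a b c d e =>
      ((bz (A (![a, b, c, d, e] (σ 0)) (![a, b, c, d, e] (σ 1))) : ℤ) : ℝ))
      = EE A w * (∑ a, w a) ^ 3 := by
    intro σ hσ
    rw [← S5_edge]
    exact S5_perm w (fun a b _ _ _ => ((bz (A a b) : ℤ) : ℝ)) σ hσ
  have c0 : S5 w (fun a b c d e => ((cyF A a b c d e : ℤ) : ℝ)) = TT A w :=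
    hc ![0, 1, 2, 3, 4] (by decide)
  have c1 : S5 w (fun a b c d e => ((cyF A a b c e d : ℤ) : ℝ)) = TT A w :=
    hc ![0, 1, 2, 4, 3] (by decide)
  have c2 : S5 w (fun a b c d e => ((cyF A a b d c e : ℤ) : ℝ)) = TT A w :=
    hc ![0, 1, 3, 2, 4] (by decide)
  have c3 : S5 w (fun a b c d e => ((cyF A a b d e c : ℤ) : ℝ)) = TT A w :=
    hc ![0, 1, 3, 4, 2] (by decide)
  have c4 : S5 w (fun a b c d e => ((cyF A a b e c d : ℤ) : ℝ)) = TT A w :=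
    hc ![0, 1, 4, 2, 3] (by decide)
  have c5 : S5 w (fun a b c d e => ((cyF A a b e d c : ℤ) : ℝ)) = TT A w :=
    hc ![0, 1, 4, 3, 2] (by decide)
  have c6 : S5 w (fun a b c d e => ((cyF A a c b d e : ℤ) : ℝ)) = TT A w :=
    hc ![0, 2, 1, 3, 4] (by decide)
  have c7 : S5 w (fun a b c d e => ((cyF A a c b e d : ℤ) : ℝ)) = TT A w :=
    hc ![0, 2, 1, 4, 3] (by decide)
  have c8 : S5 w (fun a b c d e => ((cyF A a c d b e : ℤ) : ℝ)) = TT A w :=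
    hc ![0, 2, 3, 1, 4] (by decide)
  have c9 : S5 w (fun a b c d e => ((cyF A a c e b d : ℤ) : ℝ)) = TT A w :=
    hc ![0, 2, 4, 1, 3] (by decide)
  have c10 : S5 w (fun a b c d e => ((cyF A a d b c e : ℤ) : ℝ)) = TT A w :=
    hc ![0, 3, 1, 2, 4] (by decide)
  have c11 : S5 w (fun a b c d e => ((cyF A a d c b e : ℤ) : ℝ)) = TT A w :=
    hc ![0, 3, 2, 1, 4] (by decide)
  have e0 : S5 w (fun a b c d e => ((bz (A a b) : ℤ) : ℝ)) = EE A w * (∑ a, w a) ^ 3 :=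
    he ![0, 1, 2, 3, 4] (by decide)
  have e1 : S5 w (fun a b c d e => ((bz (A a c) : ℤ) : ℝ)) = EE A w * (∑ a, w a) ^ 3 :=
    he ![0, 2, 1, 3, 4] (by decide)
  have e2 : S5 w (fun a b c d e => ((bz (A a d) : ℤ) : ℝ)) = EE A w * (∑ a, w a) ^ 3 :=
    he ![0, 3, 1, 2, 4] (by decide)
  have e3 : S5 w (fun a b c d e => ((bz (A a e) : ℤ) : ℝ)) = EE A w * (∑ a, w a) ^ 3 :=
    he ![0, 4, 1, 2, 3] (by decide)
  have e4 : S5 w (fun a b c d e => ((bz (A b c) : ℤ) : ℝ)) = EE A w * (∑ a, w a) ^ 3 :=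
    he ![1, 2, 0, 3, 4] (by decide)
  have e5 : S5 w (fun a b c d e => ((bz (A b d) : ℤ) : ℝ)) = EE A w * (∑ a, w a) ^ 3 :=
    he ![1, 3, 0, 2, 4] (by decide)
  have e6 : S5 w (fun a b c d e => ((bz (A b e) : ℤ) : ℝ)) = EE A w * (∑ a, w a) ^ 3 :=
    he ![1, 4, 0, 2, 3] (by decide)
  have e7 : S5 w (fun a b c d e => ((bz (A c d) : ℤ) : ℝ)) = EE A w * (∑ a, w a) ^ 3 :=
    he ![2, 3, 0, 1, 4] (by decide)
  have e8 : S5 w (fun a b c d e => ((bz (A c e) : ℤ) : ℝ)) = EE A w * (∑ a, w a) ^ 3 :=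
    he ![2, 4, 0, 1, 3] (by decide)
  have e9 : S5 w (fun a b c d e => ((bz (A d e) : ℤ) : ℝ)) = EE A w * (∑ a, w a) ^ 3 :=
    he ![3, 4, 0, 1, 2] (by decide)
  have p0 : 0 ≤ S5 w (fun a b c d e => ((hsF A c d e a b : ℤ) : ℝ)) := hh ![2, 3, 4, 0, 1] (by decide)
  have p1 : 0 ≤ S5 w (fun a b c d e => ((hsF A b d e a c : ℤ) : ℝ)) := hh ![1, 3, 4, 0, 2] (by decide)
  have p2 : 0 ≤ S5 w (fun a b c d e => ((hsF A b c e a d : ℤ) : ℝ)) := hh ![1, 2, 4, 0, 3] (by decide)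
  have p3 : 0 ≤ S5 w (fun a b c d e => ((hsF A b c d a e : ℤ) : ℝ)) := hh ![1, 2, 3, 0, 4] (by decide)
  have p4 : 0 ≤ S5 w (fun a b c d e => ((hsF A a d e b c : ℤ) : ℝ)) := hh ![0, 3, 4, 1, 2] (by decide)
  have p5 : 0 ≤ S5 w (fun a b c d e => ((hsF A a c e b d : ℤ) : ℝ)) := hh ![0, 2, 4, 1, 3] (by decide)
  have p6 : 0 ≤ S5 w (fun a b c d e => ((hsF A a c d b e : ℤ) : ℝ)) := hh ![0, 2, 3, 1, 4] (by decide)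
  have p7 : 0 ≤ S5 w (fun a b c d e => ((hsF A a b e c d : ℤ) : ℝ)) := hh ![0, 1, 4, 2, 3] (by decide)
  have p8 : 0 ≤ S5 w (fun a b c d e => ((hsF A a b d c e : ℤ) : ℝ)) := hh ![0, 1, 3, 2, 4] (by decide)
  have p9 : 0 ≤ S5 w (fun a b c d e => ((hsF A a b c d e : ℤ) : ℝ)) := hh ![0, 1, 2, 3, 4] (by decide)
  rw [c0, c1, c2, c3, c4, c5, c6, c7, c8, c9, c10, c11, e0, e1, e2, e3, e4, e5, e6, e7, e8, e9] at h
  linarith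

end flag

def h0Z (p q r p' q' r' : Bool) : ℤ :=
  12 * (fA p q r * fA p' q' r') - 50 * (fA p q r * fB p' q' r' + fB p q r * fA p' q' r')
    + 216 * (fB p q r * fB p' q' r')
    + 96 * ((gA p q r - gA q p r) * (gA p' q' r' - gA q' p' r')
      + (gA q p r - gA r p q) * (gA q' p' r' - gA r' p' q')
      + (gA p q r - gA r p q) * (gA p' q' r' - gA r' p' q'))

def h1Z (p q r p' q' r' : Bool) : ℤ :=
  98 * (s1 p q r * s1 p' q' r') + 27 * (s1 p q r * s2 p' q' r' + s2 p q r * s1 p' q' r')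
    + 168 * (s1 p q r * s3 p' q' r' + s3 p q r * s1 p' q' r')
    + 100 * (s2 p q r * s2 p' q' r')
    - 64 * (s2 p q r * s3 p' q' r' + s3 p q r * s2 p' q' r')
    + 600 * (s3 p q r * s3 p' q' r')
    + 92 * (t1 p q r * t1 p' q' r') - 12 * (t1 p q r * t2 p' q' r' + t2 p q r * t1 p' q' r')
    + 1384 * (t2 p q r * t2 p' q' r')

def h2Z (p q r p' q' r' : Bool) : ℤ :=
  128 * (u1 p q r * u1 p' q' r') - 129 * (u1 p q r * u2 p' q' r' + u2 p q r * u1 p' q' r')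
    + 160 * (u2 p q r * u2 p' q' r') + 1280 * (v1 p q r * v1 p' q' r')

def hsZ (ab ac bc p q r p' q' r' : Bool) : ℤ :=
  match ab, ac, bc with
  | false, false, false => h0Z p q r p' q' r'
  | true, false, false => h1Z p q r p' q' r'
  | false, true, false => h1Z p r q p' r' q'
  | false, false, true => h1Z q r p q' r' p'
  | true, true, false => h2Z q p r q' p' r'
  | true, false, true => h2Z p q r p' q' r'
  | false, true, true => h2Z p r q p' r' q'
  | true, true, true => 0

set_option maxRecDepth 100000 in
theorem pointwise_certZ : ∀ e01 e02 e03 e04 e12 e13 e14 e23 e24 e34 : Bool,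
    (!(e01 && e02 && e12) && !(e01 && e03 && e13) && !(e01 && e04 && e14) && !(e02 && e03 && e23) && !(e02 && e04 && e24) && !(e03 && e04 && e34) && !(e12 && e13 && e23) && !(e12 && e14 && e24) && !(e13 && e14 && e34) && !(e23 && e24 && e34)) = true →
    0 ≤ 480 + 0 * (bz e01 + bz e02 + bz e03 + bz e04 + bz e12 + bz e13 + bz e14 + bz e23 + bz e24 + bz e34)
      - 12500 * (cy e01 e12 e23 e34 e04 + cy e01 e12 e24 e34 e03 + cy e01 e13 e23 e24 e04 + cy e01 e13 e34 e24 e02 + cy e01 e14 e24 e23 e03 + cy e01 e14 e34 e23 e02 + cy e02 e12 e13 e34 e04 + cy e02 e12 e14 e34 e03 + cy e02 e23 e13 e14 e04 + cy e02 e24 e14 e13 e03 + cy e03 e13 e12 e24 e04 + cy e03 e23 e12 e14 e04)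
      - (hsZ e23 e24 e34 e02 e03 e04 e12 e13 e14
        + hsZ e13 e14 e34 e01 e03 e04 e12 e23 e24
        + hsZ e12 e14 e24 e01 e02 e04 e13 e23 e34
        + hsZ e12 e13 e23 e01 e02 e03 e14 e24 e34
        + hsZ e03 e04 e34 e01 e13 e14 e02 e23 e24
        + hsZ e02 e04 e24 e01 e12 e14 e03 e23 e34
        + hsZ e02 e03 e23 e01 e12 e13 e04 e24 e34
        + hsZ e01 e04 e14 e02 e12 e24 e03 e13 e34
        + hsZ e01 e03 e13 e02 e12 e23 e04 e14 e34
        + hsZ e01 e02 e12 e03 e13 e23 e04 e14 e24) := by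
  decide +kernel
section flagZ
set_option linter.unusedSectionVars false
variable {V : Type*} [Fintype V]

def hsFZ (A : V → V → Bool) (a b c d e : V) : ℤ :=
  hsZ (A a b) (A a c) (A b c) (A a d) (A b d) (A c d) (A a e) (A b e) (A c e)

theorem pointwise_AZ (A : V → V → Bool) (hA : ∀ a b, A a b = A b a)
    (htri : ∀ a b c, (A a b && A a c && A b c) = false) (a b c d e : V) :
    0 ≤ 480 + 0 * (bz (A a b) + bz (A a c) + bz (A a d) + bz (A a e) + bz (A b c) + bz (A b d) + bz (A b e) + bz (A c d) + bz (A c e) + bz (A d e))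
      - 12500 * (cyF A a b c d e
        + cyF A a b c e d
        + cyF A a b d c e
        + cyF A a b d e c
        + cyF A a b e c d
        + cyF A a b e d c
        + cyF A a c b d e
        + cyF A a c b e d
        + cyF A a c d b e
        + cyF A a c e b d
        + cyF A a d b c e
        + cyF A a d c b e)
      - (hsFZ A c d e a b
        + hsFZ A b d e a c
        + hsFZ A b c e a d
        + hsFZ A b c d a e
        + hsFZ A a d e b c
        + hsFZ A a c e b d
        + hsFZ A a c d b e
        + hsFZ A a b e c d
        + hsFZ A a b d c e
        + hsFZ A a b c d e) := by
  have h := pointwise_certZ (A a b) (A a c) (A a d) (A a e) (A b c) (A b d) (A b e) (A c d) (A c e) (A d e)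
    (by simp only [htri]; rfl)
  simp only [cyF, hsFZ, hA b a, hA c a, hA d a, hA e a, hA c b, hA d b, hA e b, hA d c, hA e c, hA e d]
  exact h

theorem h0_psdZ (w : V → ℝ) (p q r : V → Bool) :
    0 ≤ ∑ d, ∑ e, w d * w e * ((h0Z (p d) (q d) (r d) (p e) (q e) (r e) : ℤ) : ℝ) := by
  set X := ∑ d, w d * ((fA (p d) (q d) (r d) : ℤ) : ℝ) with hX
  set Y := ∑ d, w d * ((fB (p d) (q d) (r d) : ℤ) : ℝ) with hY
  set P := ∑ d, w d * ((gA (p d) (q d) (r d) - gA (q d) (p d) (r d) : ℤ) : ℝ) with hP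
  set Q := ∑ d, w d * ((gA (q d) (p d) (r d) - gA (r d) (p d) (q d) : ℤ) : ℝ) with hQ
  set R := ∑ d, w d * ((gA (p d) (q d) (r d) - gA (r d) (p d) (q d) : ℤ) : ℝ) with hR
  have : ∑ d, ∑ e, w d * w e * ((h0Z (p d) (q d) (r d) (p e) (q e) (r e) : ℤ) : ℝ)
      = 12 * (X * X) - 50 * (X * Y + Y * X) + 216 * (Y * Y)
        + 96 * (P * P + Q * Q + R * R) := by
    simp only [hX, hY, hP, hQ, hR, ← bil_sum]
    simp only [Finset.mul_sum, ← Finset.sum_add_distrib, ← Finset.sum_sub_distrib]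
    refine Finset.sum_congr rfl fun a _ => Finset.sum_congr rfl fun b _ => ?_
    simp only [h0Z]
    push_cast
    ring
  rw [this]
  nlinarith [sq_nonneg (X - 25/6 * Y), sq_nonneg Y, sq_nonneg P, sq_nonneg Q, sq_nonneg R]

theorem h1_psdZ (w : V → ℝ) (p q r : V → Bool) :
    0 ≤ ∑ d, ∑ e, w d * w e * ((h1Z (p d) (q d) (r d) (p e) (q e) (r e) : ℤ) : ℝ) := by
  set X := ∑ d, w d * ((s1 (p d) (q d) (r d) : ℤ) : ℝ) with hX
  set Y := ∑ d, w d * ((s2 (p d) (q d) (r d) : ℤ) : ℝ) with hY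
  set Z := ∑ d, w d * ((s3 (p d) (q d) (r d) : ℤ) : ℝ) with hZ
  set P := ∑ d, w d * ((t1 (p d) (q d) (r d) : ℤ) : ℝ) with hP
  set Q := ∑ d, w d * ((t2 (p d) (q d) (r d) : ℤ) : ℝ) with hQ
  have : ∑ d, ∑ e, w d * w e * ((h1Z (p d) (q d) (r d) (p e) (q e) (r e) : ℤ) : ℝ)
      = 98 * (X * X) + 27 * (X * Y + Y * X) + 168 * (X * Z + Z * X)
        + 100 * (Y * Y) - 64 * (Y * Z + Z * Y) + 600 * (Z * Z)
        + 92 * (P * P) - 12 * (P * Q + Q * P) + 1384 * (Q * Q) := by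
    simp only [hX, hY, hZ, hP, hQ, ← bil_sum]
    simp only [Finset.mul_sum, ← Finset.sum_add_distrib, ← Finset.sum_sub_distrib]
    refine Finset.sum_congr rfl fun a _ => Finset.sum_congr rfl fun b _ => ?_
    simp only [h1Z]
    push_cast
    ring
  rw [this]
  nlinarith [sq_nonneg (X + 27/98 * Y + 12/7 * Z), sq_nonneg (Y + (-56/47) * Z),
    sq_nonneg Z, sq_nonneg (P - 12/92 * Q), sq_nonneg Q]

theorem h2_psdZ (w : V → ℝ) (p q r : V → Bool) :
    0 ≤ ∑ d, ∑ e, w d * w e * ((h2Z (p d) (q d) (r d) (p e) (q e) (r e) : ℤ) : ℝ) := by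
  set X := ∑ d, w d * ((u1 (p d) (q d) (r d) : ℤ) : ℝ) with hX
  set Y := ∑ d, w d * ((u2 (p d) (q d) (r d) : ℤ) : ℝ) with hY
  set P := ∑ d, w d * ((v1 (p d) (q d) (r d) : ℤ) : ℝ) with hP
  have : ∑ d, ∑ e, w d * w e * ((h2Z (p d) (q d) (r d) (p e) (q e) (r e) : ℤ) : ℝ)
      = 128 * (X * X) - 129 * (X * Y + Y * X) + 160 * (Y * Y) + 1280 * (P * P) := by
    simp only [hX, hY, hP, ← bil_sum]
    simp only [Finset.mul_sum, ← Finset.sum_add_distrib, ← Finset.sum_sub_distrib]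
    refine Finset.sum_congr rfl fun a _ => Finset.sum_congr rfl fun b _ => ?_
    simp only [h2Z]
    push_cast
    ring
  rw [this]
  nlinarith [sq_nonneg (X - 129/128 * Y), sq_nonneg Y, sq_nonneg P]

theorem hsF_psdZ (w : V → ℝ) (hw : ∀ v, 0 ≤ w v) (A : V → V → Bool) :
    0 ≤ S5 w (fun a b c d e => ((hsFZ A a b c d e : ℤ) : ℝ)) := by
  refine Finset.sum_nonneg fun a _ => Finset.sum_nonneg fun b _ => Finset.sum_nonneg fun c _ => ?_
  have hfac : ∑ d, ∑ e, w a * w b * w c * w d * w e * ((hsFZ A a b c d e : ℤ) : ℝ)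
      = w a * w b * w c * ∑ d, ∑ e, w d * w e * ((hsFZ A a b c d e : ℤ) : ℝ) := by
    simp only [Finset.mul_sum]
    refine Finset.sum_congr rfl fun a _ => Finset.sum_congr rfl fun b _ => ?_
    ring
  rw [hfac]
  have := hw a; have := hw b; have := hw c
  refine mul_nonneg (by positivity) ?_
  simp only [hsFZ]
  rcases A a b <;> rcases A a c <;> rcases A b c <;> simp only [hsZ]
  · exact h0_psdZ w _ _ _
  · exact h1_psdZ w _ _ _
  · exact h1_psdZ w _ _ _
  · exact h2_psdZ w _ _ _
  · exact h1_psdZ w _ _ _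
  · exact h2_psdZ w _ _ _
  · exact h2_psdZ w _ _ _
  · simp

theorem flag_ineqZ (A : V → V → Bool) (hA : ∀ a b, A a b = A b a)
    (htri : ∀ a b c, (A a b && A a c && A b c) = false) (w : V → ℝ) (hw : ∀ v, 0 ≤ w v) :
    625 * TT A w ≤ 2 * (∑ a, w a) ^ 5 := by
  have h := S5_nonneg w hw (fun a b c d e => 480 + 0 * (((bz (A a b) : ℤ) : ℝ) + ((bz (A a c) : ℤ) : ℝ) + ((bz (A a d) : ℤ) : ℝ) + ((bz (A a e) : ℤ) : ℝ) + ((bz (A b c) : ℤ) : ℝ) + ((bz (A b d) : ℤ) : ℝ) + ((bz (A b e) : ℤ) : ℝ) + ((bz (A c d) : ℤ) : ℝ) + ((bz (A c e) : ℤ) : ℝ) + ((bz (A d e) : ℤ) : ℝ))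
      - 12500 * (((cyF A a b c d e : ℤ) : ℝ)
        + ((cyF A a b c e d : ℤ) : ℝ)
        + ((cyF A a b d c e : ℤ) : ℝ)
        + ((cyF A a b d e c : ℤ) : ℝ)
        + ((cyF A a b e c d : ℤ) : ℝ)
        + ((cyF A a b e d c : ℤ) : ℝ)
        + ((cyF A a c b d e : ℤ) : ℝ)
        + ((cyF A a c b e d : ℤ) : ℝ)
        + ((cyF A a c d b e : ℤ) : ℝ)
        + ((cyF A a c e b d : ℤ) : ℝ)
        + ((cyF A a d b c e : ℤ) : ℝ)
        + ((cyF A a d c b e : ℤ) : ℝ))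
      - (((hsFZ A c d e a b : ℤ) : ℝ)
        + ((hsFZ A b d e a c : ℤ) : ℝ)
        + ((hsFZ A b c e a d : ℤ) : ℝ)
        + ((hsFZ A b c d a e : ℤ) : ℝ)
        + ((hsFZ A a d e b c : ℤ) : ℝ)
        + ((hsFZ A a c e b d : ℤ) : ℝ)
        + ((hsFZ A a c d b e : ℤ) : ℝ)
        + ((hsFZ A a b e c d : ℤ) : ℝ)
        + ((hsFZ A a b d c e : ℤ) : ℝ)
        + ((hsFZ A a b c d e : ℤ) : ℝ))) (fun a b c d e => by
    have := pointwise_AZ A hA htri a b c d e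
    exact_mod_cast this)
  simp only [S5_sub, S5_add, S5_smul] at h
  rw [S5_const w 480] at h
  have hc : ∀ σ : Fin 5 → Fin 5, Function.Bijective σ → S5 w (fun a b c d e =>
      ((cyF A (![a, b, c, d, e] (σ 0)) (![a, b, c, d, e] (σ 1))
      (![a, b, c, d, e] (σ 2)) (![a, b, c, d, e] (σ 3)) (![a, b, c, d, e] (σ 4)) : ℤ) : ℝ))
      = TT A w :=
    fun σ hσ => S5_perm w (fun a b c d e => ((cyF A a b c d e : ℤ) : ℝ)) σ hσ
  have hh : ∀ σ : Fin 5 → Fin 5, Function.Bijective σ → 0 ≤ S5 w (fun a b c d e =>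
      ((hsFZ A (![a, b, c, d, e] (σ 0)) (![a, b, c, d, e] (σ 1))
      (![a, b, c, d, e] (σ 2)) (![a, b, c, d, e] (σ 3)) (![a, b, c, d, e] (σ 4)) : ℤ) : ℝ)) := by
    intro σ hσ
    rw [S5_perm w (fun a b c d e => ((hsFZ A a b c d e : ℤ) : ℝ)) σ hσ]
    exact hsF_psdZ w hw A
  have he : ∀ σ : Fin 5 → Fin 5, Function.Bijective σ → S5 w (fun a b c d e =>
      ((bz (A (![a, b, c, d, e] (σ 0)) (![a, b, c, d, e] (σ 1))) : ℤ) : ℝ))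
      = EE A w * (∑ a, w a) ^ 3 := by
    intro σ hσ
    rw [← S5_edge]
    exact S5_perm w (fun a b _ _ _ => ((bz (A a b) : ℤ) : ℝ)) σ hσ
  have c0 : S5 w (fun a b c d e => ((cyF A a b c d e : ℤ) : ℝ)) = TT A w :=
    hc ![0, 1, 2, 3, 4] (by decide)
  have c1 : S5 w (fun a b c d e => ((cyF A a b c e d : ℤ) : ℝ)) = TT A w :=
    hc ![0, 1, 2, 4, 3] (by decide)
  have c2 : S5 w (fun a b c d e => ((cyF A a b d c e : ℤ) : ℝ)) = TT A w :=
    hc ![0, 1, 3, 2, 4] (by decide)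
  have c3 : S5 w (fun a b c d e => ((cyF A a b d e c : ℤ) : ℝ)) = TT A w :=
    hc ![0, 1, 3, 4, 2] (by decide)
  have c4 : S5 w (fun a b c d e => ((cyF A a b e c d : ℤ) : ℝ)) = TT A w :=
    hc ![0, 1, 4, 2, 3] (by decide)
  have c5 : S5 w (fun a b c d e => ((cyF A a b e d c : ℤ) : ℝ)) = TT A w :=
    hc ![0, 1, 4, 3, 2] (by decide)
  have c6 : S5 w (fun a b c d e => ((cyF A a c b d e : ℤ) : ℝ)) = TT A w :=
    hc ![0, 2, 1, 3, 4] (by decide)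
  have c7 : S5 w (fun a b c d e => ((cyF A a c b e d : ℤ) : ℝ)) = TT A w :=
    hc ![0, 2, 1, 4, 3] (by decide)
  have c8 : S5 w (fun a b c d e => ((cyF A a c d b e : ℤ) : ℝ)) = TT A w :=
    hc ![0, 2, 3, 1, 4] (by decide)
  have c9 : S5 w (fun a b c d e => ((cyF A a c e b d : ℤ) : ℝ)) = TT A w :=
    hc ![0, 2, 4, 1, 3] (by decide)
  have c10 : S5 w (fun a b c d e => ((cyF A a d b c e : ℤ) : ℝ)) = TT A w :=
    hc ![0, 3, 1, 2, 4] (by decide)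
  have c11 : S5 w (fun a b c d e => ((cyF A a d c b e : ℤ) : ℝ)) = TT A w :=
    hc ![0, 3, 2, 1, 4] (by decide)
  have e0 : S5 w (fun a b c d e => ((bz (A a b) : ℤ) : ℝ)) = EE A w * (∑ a, w a) ^ 3 :=
    he ![0, 1, 2, 3, 4] (by decide)
  have e1 : S5 w (fun a b c d e => ((bz (A a c) : ℤ) : ℝ)) = EE A w * (∑ a, w a) ^ 3 :=
    he ![0, 2, 1, 3, 4] (by decide)
  have e2 : S5 w (fun a b c d e => ((bz (A a d) : ℤ) : ℝ)) = EE A w * (∑ a, w a) ^ 3 :=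
    he ![0, 3, 1, 2, 4] (by decide)
  have e3 : S5 w (fun a b c d e => ((bz (A a e) : ℤ) : ℝ)) = EE A w * (∑ a, w a) ^ 3 :=
    he ![0, 4, 1, 2, 3] (by decide)
  have e4 : S5 w (fun a b c d e => ((bz (A b c) : ℤ) : ℝ)) = EE A w * (∑ a, w a) ^ 3 :=
    he ![1, 2, 0, 3, 4] (by decide)
  have e5 : S5 w (fun a b c d e => ((bz (A b d) : ℤ) : ℝ)) = EE A w * (∑ a, w a) ^ 3 :=
    he ![1, 3, 0, 2, 4] (by decide)
  have e6 : S5 w (fun a b c d e => ((bz (A b e) : ℤ) : ℝ)) = EE A w * (∑ a, w a) ^ 3 :=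
    he ![1, 4, 0, 2, 3] (by decide)
  have e7 : S5 w (fun a b c d e => ((bz (A c d) : ℤ) : ℝ)) = EE A w * (∑ a, w a) ^ 3 :=
    he ![2, 3, 0, 1, 4] (by decide)
  have e8 : S5 w (fun a b c d e => ((bz (A c e) : ℤ) : ℝ)) = EE A w * (∑ a, w a) ^ 3 :=
    he ![2, 4, 0, 1, 3] (by decide)
  have e9 : S5 w (fun a b c d e => ((bz (A d e) : ℤ) : ℝ)) = EE A w * (∑ a, w a) ^ 3 :=
    he ![3, 4, 0, 1, 2] (by decide)
  have p0 : 0 ≤ S5 w (fun a b c d e => ((hsFZ A c d e a b : ℤ) : ℝ)) := hh ![2, 3, 4, 0, 1] (by decide)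
  have p1 : 0 ≤ S5 w (fun a b c d e => ((hsFZ A b d e a c : ℤ) : ℝ)) := hh ![1, 3, 4, 0, 2] (by decide)
  have p2 : 0 ≤ S5 w (fun a b c d e => ((hsFZ A b c e a d : ℤ) : ℝ)) := hh ![1, 2, 4, 0, 3] (by decide)
  have p3 : 0 ≤ S5 w (fun a b c d e => ((hsFZ A b c d a e : ℤ) : ℝ)) := hh ![1, 2, 3, 0, 4] (by decide)
  have p4 : 0 ≤ S5 w (fun a b c d e => ((hsFZ A a d e b c : ℤ) : ℝ)) := hh ![0, 3, 4, 1, 2] (by decide)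
  have p5 : 0 ≤ S5 w (fun a b c d e => ((hsFZ A a c e b d : ℤ) : ℝ)) := hh ![0, 2, 4, 1, 3] (by decide)
  have p6 : 0 ≤ S5 w (fun a b c d e => ((hsFZ A a c d b e : ℤ) : ℝ)) := hh ![0, 2, 3, 1, 4] (by decide)
  have p7 : 0 ≤ S5 w (fun a b c d e => ((hsFZ A a b e c d : ℤ) : ℝ)) := hh ![0, 1, 4, 2, 3] (by decide)
  have p8 : 0 ≤ S5 w (fun a b c d e => ((hsFZ A a b d c e : ℤ) : ℝ)) := hh ![0, 1, 3, 2, 4] (by decide)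
  have p9 : 0 ≤ S5 w (fun a b c d e => ((hsFZ A a b c d e : ℤ) : ℝ)) := hh ![0, 1, 2, 3, 4] (by decide)
  rw [c0, c1, c2, c3, c4, c5, c6, c7, c8, c9, c10, c11, e0, e1, e2, e3, e4, e5, e6, e7, e8, e9] at h
  linarith

end flagZ


section stab
set_option linter.unusedSectionVars false
variable {V : Type*} [Fintype V]

/-- real adjacency indicator -/
def iA (A : V → V → Bool) (a b : V) : ℝ := ((bz (A a b) : ℤ) : ℝ)

theorem iA_eq (A : V → V → Bool) (a b : V) : iA A a b = if A a b = true then 1 else 0 := by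
  unfold iA bz
  cases A a b <;> simp

theorem iA_nonneg (A : V → V → Bool) (a b : V) : 0 ≤ iA A a b := by
  rw [iA_eq]; split_ifs <;> norm_num

theorem cyF_eq (A : V → V → Bool) (a b c d e : V) : ((cyF A a b c d e : ℤ) : ℝ) =
    if (A a b = true ∧ A b c = true ∧ A c d = true ∧ A d e = true ∧ A e a = true)
      then 1 else 0 := by
  unfold cyF cy
  cases A a b <;> cases A b c <;> cases A c d <;> cases A d e <;> cases A e a <;> simp

theorem cyF_nonneg (A : V → V → Bool) (a b c d e : V) : (0:ℝ) ≤ ((cyF A a b c d e : ℤ) : ℝ) := by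
  rw [cyF_eq]; split_ifs <;> norm_num

/-- rooted pentagon density -/
def tau (A : V → V → Bool) (w : V → ℝ) (v : V) : ℝ :=
  ∑ b, ∑ c, ∑ d, ∑ e, w b * w c * w d * w e * ((cyF A v b c d e : ℤ) : ℝ)

/-- weighted degree -/
def deg (A : V → V → Bool) (w : V → ℝ) (v : V) : ℝ := ∑ u, w u * iA A v u

theorem S5_root (A : V → V → Bool) (w g : V → ℝ) :
    S5 w (fun a b c d e => ((cyF A a b c d e : ℤ) : ℝ) * g a) = ∑ a, w a * g a * tau A w a := by
  simp only [S5, tau, Finset.mul_sum]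
  refine Finset.sum_congr rfl fun a _ => Finset.sum_congr rfl fun b _ => Finset.sum_congr rfl
    fun c _ => Finset.sum_congr rfl fun d _ => Finset.sum_congr rfl fun e _ => ?_
  ring

theorem TT_root (A : V → V → Bool) (w : V → ℝ) : TT A w = ∑ a, w a * tau A w a := by
  have := S5_root A w (fun _ => 1)
  simpa [TT] using this

theorem EE_deg (A : V → V → Bool) (w : V → ℝ) : EE A w = ∑ a, w a * deg A w a := by
  simp only [EE, deg, iA, Finset.mul_sum]
  refine Finset.sum_congr rfl fun a _ => Finset.sum_congr rfl fun b _ => ?_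
  ring

theorem cyF_rot (A : V → V → Bool) (a b c d e : V) : cyF A a b c d e = cyF A b c d e a := by
  unfold cyF cy
  cases A a b <;> cases A b c <;> cases A c d <;> cases A d e <;> cases A e a <;> rfl

theorem exists_good_cycle (A : V → V → Bool) (hA : ∀ a b, A a b = A b a)
    (htri : ∀ a b c, (A a b && A a c && A b c) = false) (w : V → ℝ) (hw : ∀ v, 0 ≤ w v)
    (hw1 : ∑ v, w v = 1) (ht : ∀ v, 2/625 - 1/10^12 ≤ tau A w v) :
    ∃ a b c d e, (A a b = true ∧ A b c = true ∧ A c d = true ∧ A d e = true ∧ A e a = true) ∧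
      2 - 1/10^7 ≤ deg A w a + deg A w b + deg A w c + deg A w d + deg A w e := by
  by_contra hcon
  push Not at hcon
  have h := S5_nonneg w hw (fun a b c d e => ((cyF A a b c d e : ℤ) : ℝ) * ((2 - 1/10^7) -
    (deg A w a + deg A w b + deg A w c + deg A w d + deg A w e))) (fun a b c d e => by
      rw [cyF_eq]
      split_ifs with hc
      · have := hcon a b c d e hc
        linarith
      · simp)
  have e0 : S5 w (fun a b c d e => ((cyF A a b c d e : ℤ) : ℝ) * deg A w a)
      = ∑ a, w a * deg A w a * tau A w a := S5_root A w _
  have e1 : S5 w (fun a b c d e => ((cyF A a b c d e : ℤ) : ℝ) * deg A w b)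
      = ∑ a, w a * deg A w a * tau A w a := by
    rw [← e0, ← S5_perm w (fun a b c d e => ((cyF A a b c d e : ℤ) : ℝ) * deg A w a)
      ![1, 2, 3, 4, 0] (by decide)]
    congr 1; funext a b c d e
    rw [cyF_rot]; rfl
  have e2 : S5 w (fun a b c d e => ((cyF A a b c d e : ℤ) : ℝ) * deg A w c)
      = ∑ a, w a * deg A w a * tau A w a := by
    rw [← e0, ← S5_perm w (fun a b c d e => ((cyF A a b c d e : ℤ) : ℝ) * deg A w a)
      ![2, 3, 4, 0, 1] (by decide)]
    congr 1; funext a b c d e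
    rw [cyF_rot, cyF_rot]; rfl
  have e3 : S5 w (fun a b c d e => ((cyF A a b c d e : ℤ) : ℝ) * deg A w d)
      = ∑ a, w a * deg A w a * tau A w a := by
    rw [← e0, ← S5_perm w (fun a b c d e => ((cyF A a b c d e : ℤ) : ℝ) * deg A w a)
      ![3, 4, 0, 1, 2] (by decide)]
    congr 1; funext a b c d e
    rw [cyF_rot, cyF_rot, cyF_rot]; rfl
  have e4 : S5 w (fun a b c d e => ((cyF A a b c d e : ℤ) : ℝ) * deg A w e)
      = ∑ a, w a * deg A w a * tau A w a := by
    rw [← e0, ← S5_perm w (fun a b c d e => ((cyF A a b c d e : ℤ) : ℝ) * deg A w a)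
      ![4, 0, 1, 2, 3] (by decide)]
    congr 1; funext a b c d e
    rw [cyF_rot, cyF_rot, cyF_rot, cyF_rot]; rfl
  have hsplit : S5 w (fun a b c d e => ((cyF A a b c d e : ℤ) : ℝ) * ((2 - 1/10^7) -
    (deg A w a + deg A w b + deg A w c + deg A w d + deg A w e))) =
      (2 - 1/10^7) * TT A w - 5 * ∑ a, w a * deg A w a * tau A w a := by
    have : (fun a b c d e => ((cyF A a b c d e : ℤ) : ℝ) * ((2 - 1/10^7) -
      (deg A w a + deg A w b + deg A w c + deg A w d + deg A w e))) =
      (fun a b c d e => (2 - 1/10^7) * ((cyF A a b c d e : ℤ) : ℝ)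
        - (((cyF A a b c d e : ℤ) : ℝ) * deg A w a + ((cyF A a b c d e : ℤ) : ℝ) * deg A w b
        + ((cyF A a b c d e : ℤ) : ℝ) * deg A w c + ((cyF A a b c d e : ℤ) : ℝ) * deg A w d
        + ((cyF A a b c d e : ℤ) : ℝ) * deg A w e)) := by
      funext a b c d e; ring
    rw [this]
    simp only [S5_sub, S5_add, S5_smul]
    rw [e0, e1, e2, e3, e4]
    unfold TT
    ring
  rw [hsplit] at h
  have hlow : (2/625 - 1/10^12) * EE A w ≤ ∑ a, w a * deg A w a * tau A w a := by
    rw [EE_deg, Finset.mul_sum]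
    refine Finset.sum_le_sum fun a _ => ?_
    have hd : 0 ≤ deg A w a := Finset.sum_nonneg fun u _ => mul_nonneg (hw u) (iA_nonneg A a u)
    rw [mul_comm]
    exact mul_le_mul_of_nonneg_left (ht a) (mul_nonneg (hw a) hd)
  have hT : 2/625 - 1/10^12 ≤ TT A w := by
    rw [TT_root]
    calc (2/625 - 1/10^12 : ℝ) = ∑ a, w a * (2/625 - 1/10^12) := by
          rw [← Finset.sum_mul, hw1, one_mul]
      _ ≤ _ := Finset.sum_le_sum fun a _ => mul_le_mul_of_nonneg_left (ht a) (hw a)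
  have hF := flag_ineq A hA htri w hw
  rw [hw1] at hF
  norm_num at hF h hlow hT
  linarith




/-- vertices attached like class `j` to the five-cycle `v` -/
def inC (A : V → V → Bool) (v : Fin 5 → V) (j : Fin 5) (u : V) : Prop :=
  A (v (j + 1)) u = true ∧ A (v (j + 4)) u = true

noncomputable def fC (A : V → V → Bool) (v : Fin 5 → V) (j : Fin 5) (u : V) : ℝ :=
  if inC A v j u then 1 else 0

theorem fC_nonneg (A : V → V → Bool) (v : Fin 5 → V) (j : Fin 5) (u : V) : 0 ≤ fC A v j u := by
  unfold fC; split_ifs <;> norm_num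

theorem bool5 : ∀ b0 b1 b2 b3 b4 : Bool, (b0 && b1) = false → (b1 && b2) = false →
    (b2 && b3) = false → (b3 && b4) = false → (b4 && b0) = false →
    bz b0 + bz b1 + bz b2 + bz b3 + bz b4 ≤
      1 + (bz (b1 && b4) + bz (b2 && b0) + bz (b3 && b1) + bz (b4 && b2) + bz (b0 && b3)) ∧
    (bz (b1 && b4) + bz (b2 && b0) + bz (b3 && b1) + bz (b4 && b2) + bz (b0 && b3)) ≤ 1 := by
  decide

theorem fC_bz (A : V → V → Bool) (v : Fin 5 → V) (j : Fin 5) (u : V) :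
    fC A v j u = ((bz (A (v (j+1)) u && A (v (j+4)) u) : ℤ) : ℝ) := by
  unfold fC inC bz
  cases A (v (j+1)) u <;> cases A (v (j+4)) u <;> simp

theorem fC_facts (A : V → V → Bool) (hA : ∀ a b, A a b = A b a)
    (htri : ∀ a b c, (A a b && A a c && A b c) = false) (v : Fin 5 → V)
    (hv : ∀ j, A (v j) (v (j + 1)) = true) (u : V) :
    ∑ j, iA A (v j) u ≤ 1 + ∑ j, fC A v j u ∧ ∑ j, fC A v j u ≤ 1 := by
  have hc : ∀ j, (A (v j) u && A (v (j+1)) u) = false := by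
    intro j
    have := htri (v j) (v (j+1)) u
    rw [hv j] at this
    simpa using this
  have h := bool5 (A (v 0) u) (A (v 1) u) (A (v 2) u) (A (v 3) u) (A (v 4) u)
    (hc 0) (hc 1) (hc 2) (hc 3) (hc 4)
  simp only [fC_bz, iA, Fin.sum_univ_five]
  exact ⟨by exact_mod_cast h.1, by exact_mod_cast h.2⟩

theorem inC_adj (A : V → V → Bool) (hA : ∀ a b, A a b = A b a)
    (htri : ∀ a b c, (A a b && A a c && A b c) = false) (v : Fin 5 → V)
    {j k : Fin 5} {u u' : V} (hu : inC A v j u) (hu' : inC A v k u') (h : A u u' = true) :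
    k - j = 1 ∨ k - j = 4 := by
  have key : ∀ z, A z u = true → A z u' = true → False := by
    intro z h1 h2
    have := htri z u u'
    rw [h1, h2, h] at this
    simp at this
  obtain ⟨a1, a2⟩ := hu
  obtain ⟨b1, b2⟩ := hu'
  obtain ⟨s, rfl⟩ : ∃ s, k = j + s := ⟨k - j, by abel⟩
  rw [add_sub_cancel_left]
  fin_cases s
  · exact (key _ a1 (by simpa using b1)).elim
  · left; rfl
  · refine (key _ a1 ?_).elim
    have : j + 2 + 4 = j + 1 := by rw [add_assoc]; rfl
    rw [← this]; exact b2
  · refine (key _ a2 ?_).elim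
    have : j + 3 + 1 = j + 4 := by rw [add_assoc]; rfl
    rw [← this]; exact b1
  · right; rfl

/-- class sizes -/
noncomputable def xC (A : V → V → Bool) (w : V → ℝ) (v : Fin 5 → V) (j : Fin 5) : ℝ :=
  ∑ u, w u * fC A v j u

/-- degree into classes -/
noncomputable def dC (A : V → V → Bool) (w : V → ℝ) (v : Fin 5 → V) (z : V) (j : Fin 5) : ℝ :=
  ∑ u, w u * (fC A v j u * iA A z u)

noncomputable def walkW (d x : Fin 5 → ℝ) : ℝ :=
  ∑ j, ∑ s ∈ ({1, 4} : Finset (Fin 5)), ∑ s' ∈ ({1, 4} : Finset (Fin 5)),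
    ∑ s'' ∈ ({1, 4} : Finset (Fin 5)), d j * x (j + s) * x (j + s + s') * d (j + s + s' + s'')

noncomputable def rC (A : V → V → Bool) (v : Fin 5 → V) (u : V) : ℝ := 1 - ∑ j, fC A v j u

theorem pointwise_walk (A : V → V → Bool) (hA : ∀ a b, A a b = A b a)
    (htri : ∀ a b c, (A a b && A a c && A b c) = false) (v : Fin 5 → V)
    (hv : ∀ j, A (v j) (v (j + 1)) = true) (z b c d e : V) :
    ((cyF A z b c d e : ℤ) : ℝ) ≤ rC A v b + rC A v c + rC A v d + rC A v e +
      ∑ j, ∑ s ∈ ({1, 4} : Finset (Fin 5)), ∑ s' ∈ ({1, 4} : Finset (Fin 5)),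
        ∑ s'' ∈ ({1, 4} : Finset (Fin 5)), (fC A v j b * iA A z b) * fC A v (j + s) c *
          fC A v (j + s + s') d * (fC A v (j + s + s' + s'') e * iA A z e) := by
  have hr : ∀ u, 0 ≤ rC A v u := fun u => by
    have := (fC_facts A hA htri v hv u).2
    unfold rC; linarith
  have hterm : ∀ j s s' s'', 0 ≤ (fC A v j b * iA A z b) * fC A v (j + s) c *
          fC A v (j + s + s') d * (fC A v (j + s + s' + s'') e * iA A z e) := by
    intro j s s' s''
    have := fC_nonneg A v j b
    have := fC_nonneg A v (j + s) c
    have := fC_nonneg A v (j + s + s') d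
    have := fC_nonneg A v (j + s + s' + s'') e
    have := iA_nonneg A z b
    have := iA_nonneg A z e
    positivity
  have hsum : 0 ≤ ∑ j, ∑ s ∈ ({1, 4} : Finset (Fin 5)), ∑ s' ∈ ({1, 4} : Finset (Fin 5)),
        ∑ s'' ∈ ({1, 4} : Finset (Fin 5)), (fC A v j b * iA A z b) * fC A v (j + s) c *
          fC A v (j + s + s') d * (fC A v (j + s + s' + s'') e * iA A z e) :=
    Finset.sum_nonneg fun j _ => Finset.sum_nonneg fun s _ => Finset.sum_nonneg fun s' _ =>
      Finset.sum_nonneg fun s'' _ => hterm j s s' s''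
  have hb := hr b; have hc := hr c; have hd := hr d; have he := hr e
  have hcls : ∀ u, (∃ j, inC A v j u) ∨ rC A v u = 1 := by
    intro u
    by_cases h : ∃ j, inC A v j u
    · exact Or.inl h
    · right
      push Not at h
      simp [rC, fC, h]
  rw [cyF_eq]
  split_ifs with hcy
  swap
  · linarith
  obtain ⟨h1, h2, h3, h4, h5⟩ := hcy
  rcases hcls b with ⟨jb, hjb⟩ | h
  swap
  · linarith
  rcases hcls c with ⟨jc, hjc⟩ | h
  swap
  · linarith
  rcases hcls d with ⟨jd, hjd⟩ | h
  swap
  · linarith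
  rcases hcls e with ⟨je, hje⟩ | h
  swap
  · linarith
  have m : ∀ {j k : Fin 5}, (k - j = 1 ∨ k - j = 4) → k - j ∈ ({1, 4} : Finset (Fin 5)) := by
    intro j k h; simpa using h
  have q1 := m (inC_adj A hA htri v hjb hjc h2)
  have q2 := m (inC_adj A hA htri v hjc hjd h3)
  have q3 := m (inC_adj A hA htri v hjd hje h4)
  have h1le : (1:ℝ) ≤ ∑ j, ∑ s ∈ ({1, 4} : Finset (Fin 5)), ∑ s' ∈ ({1, 4} : Finset (Fin 5)),
        ∑ s'' ∈ ({1, 4} : Finset (Fin 5)), (fC A v j b * iA A z b) * fC A v (j + s) c *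
          fC A v (j + s + s') d * (fC A v (j + s + s' + s'') e * iA A z e) := by
    refine le_trans ?_ (Finset.single_le_sum (fun j _ => Finset.sum_nonneg fun s _ =>
      Finset.sum_nonneg fun s' _ => Finset.sum_nonneg fun s'' _ => hterm j s s' s'')
      (Finset.mem_univ jb))
    refine le_trans ?_ (Finset.single_le_sum (fun s _ =>
      Finset.sum_nonneg fun s' _ => Finset.sum_nonneg fun s'' _ => hterm jb s s' s'') q1)
    refine le_trans ?_ (Finset.single_le_sum (fun s' _ =>
      Finset.sum_nonneg fun s'' _ => hterm jb _ s' s'') q2)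
    refine le_trans ?_ (Finset.single_le_sum (fun s'' _ => hterm jb _ _ s'') q3)
    have r1 : jb + (jc - jb) = jc := by abel
    have r2 : jc + (jd - jc) = jd := by abel
    have r3 : jd + (je - jd) = je := by abel
    rw [r1, r2, r3]
    rw [hA e z] at h5
    simp [fC, hjb, hjc, hjd, hje, iA_eq, h1, h5]
  linarith

theorem prod4_sum (w f1 f2 f3 f4 : V → ℝ) : ∑ b, ∑ c, ∑ d, ∑ e, w b * w c * w d * w e *
      (f1 b * f2 c * f3 d * f4 e) = (∑ b, w b * f1 b) * (∑ b, w b * f2 b) * (∑ b, w b * f3 b)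
        * (∑ b, w b * f4 b) := by
  rw [Finset.sum_mul_sum, Finset.sum_mul, Finset.sum_mul]
  refine Finset.sum_congr rfl fun b _ => ?_
  rw [Finset.sum_mul, Finset.sum_mul]
  refine Finset.sum_congr rfl fun c _ => ?_
  rw [mul_assoc, Finset.sum_mul_sum, Finset.mul_sum]
  refine Finset.sum_congr rfl fun d _ => ?_
  rw [Finset.mul_sum]
  refine Finset.sum_congr rfl fun e _ => ?_
  ring

theorem sum4_comm {ι : Type*} (s : Finset ι) (f : V → V → V → V → ι → ℝ) :
    ∑ b, ∑ c, ∑ d, ∑ e, ∑ i ∈ s, f b c d e i = ∑ i ∈ s, ∑ b, ∑ c, ∑ d, ∑ e, f b c d e i := by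
  have h1 : ∀ b c d, ∑ e, ∑ i ∈ s, f b c d e i = ∑ i ∈ s, ∑ e, f b c d e i :=
    fun b c d => Finset.sum_comm
  have h2 : ∀ b c, ∑ d, ∑ i ∈ s, ∑ e, f b c d e i = ∑ i ∈ s, ∑ d, ∑ e, f b c d e i :=
    fun b c => Finset.sum_comm
  have h3 : ∀ b, ∑ c, ∑ i ∈ s, ∑ d, ∑ e, f b c d e i = ∑ i ∈ s, ∑ c, ∑ d, ∑ e, f b c d e i :=
    fun b => Finset.sum_comm
  simp only [h1, h2, h3]
  exact Finset.sum_comm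

theorem tau_le_walk (A : V → V → Bool) (hA : ∀ a b, A a b = A b a)
    (htri : ∀ a b c, (A a b && A a c && A b c) = false) (w : V → ℝ) (hw : ∀ v, 0 ≤ w v)
    (hw1 : ∑ v, w v = 1) (v : Fin 5 → V)
    (hv : ∀ j, A (v j) (v (j + 1)) = true) (z : V) :
    tau A w z ≤ 4 * (1 - ∑ j, xC A w v j) + walkW (dC A w v z) (xC A w v) := by
  have hR : ∑ u, w u * rC A v u = 1 - ∑ j, xC A w v j := by
    simp only [rC, xC, mul_sub, mul_one, Finset.sum_sub_distrib, hw1, Finset.mul_sum]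
    rw [Finset.sum_comm]
  calc tau A w z ≤ ∑ b, ∑ c, ∑ d, ∑ e, w b * w c * w d * w e *
        (rC A v b + rC A v c + rC A v d + rC A v e +
      ∑ j, ∑ s ∈ ({1, 4} : Finset (Fin 5)), ∑ s' ∈ ({1, 4} : Finset (Fin 5)),
        ∑ s'' ∈ ({1, 4} : Finset (Fin 5)), (fC A v j b * iA A z b) * fC A v (j + s) c *
          fC A v (j + s + s') d * (fC A v (j + s + s' + s'') e * iA A z e)) := by
        unfold tau
        refine Finset.sum_le_sum fun b _ => Finset.sum_le_sum fun c _ => Finset.sum_le_sum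
          fun d _ => Finset.sum_le_sum fun e _ => ?_
        have := hw b; have := hw c; have := hw d; have := hw e
        exact mul_le_mul_of_nonneg_left (pointwise_walk A hA htri v hv z b c d e) (by positivity)
    _ = _ := by
        have e1 := prod4_sum w (rC A v) (fun _ => 1) (fun _ => 1) (fun _ => 1)
        have e2 := prod4_sum w (fun _ => 1) (rC A v) (fun _ => 1) (fun _ => 1)
        have e3 := prod4_sum w (fun _ => 1) (fun _ => 1) (rC A v) (fun _ => 1)
        have e4 := prod4_sum w (fun _ => 1) (fun _ => 1) (fun _ => 1) (rC A v)
        simp only [mul_one, one_mul, hw1, hR] at e1 e2 e3 e4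
        simp only [mul_add, Finset.sum_add_distrib, e1, e2, e3, e4, Finset.mul_sum, sum4_comm]
        have e5 : ∀ j s s' s'', ∑ b, ∑ c, ∑ d, ∑ e, w b * w c * w d * w e *
          (fC A v j b * iA A z b * fC A v (j + s) c *
          fC A v (j + s + s') d * (fC A v (j + s + s' + s'') e * iA A z e)) =
          dC A w v z j * xC A w v (j + s) * xC A w v (j + s + s') *
            dC A w v z (j + s + s' + s'') := fun j s s' s'' =>
          prod4_sum w (fun b => fC A v j b * iA A z b) (fC A v (j + s)) (fC A v (j + s + s'))
            (fun e => fC A v (j + s + s' + s'') e * iA A z e)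
        simp only [e5, walkW]
        ring


theorem dC_nonneg (A : V → V → Bool) (w : V → ℝ) (hw : ∀ v, 0 ≤ w v) (v : Fin 5 → V) (z : V)
    (j : Fin 5) : 0 ≤ dC A w v z j :=
  Finset.sum_nonneg fun u _ => mul_nonneg (hw u) (mul_nonneg (fC_nonneg _ _ _ _) (iA_nonneg _ _ _))

theorem xC_nonneg (A : V → V → Bool) (w : V → ℝ) (hw : ∀ v, 0 ≤ w v) (v : Fin 5 → V)
    (j : Fin 5) : 0 ≤ xC A w v j :=
  Finset.sum_nonneg fun u _ => mul_nonneg (hw u) (fC_nonneg _ _ _ _)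

theorem dC_adj (A : V → V → Bool)
    (htri : ∀ a b c, (A a b && A a c && A b c) = false) (w : V → ℝ) (hw : ∀ v, 0 ≤ w v)
    (v : Fin 5 → V) {u u' : V} (h : A u u' = true) (k : Fin 5) :
    dC A w v u k + dC A w v u' k ≤ xC A w v k := by
  unfold dC xC
  rw [← Finset.sum_add_distrib]
  refine Finset.sum_le_sum fun t _ => ?_
  rw [← mul_add, ← mul_add]
  refine mul_le_mul_of_nonneg_left ?_ (hw t)
  have h2 : iA A u t + iA A u' t ≤ 1 := by
    have := htri u u' t
    rw [h] at this
    rw [iA_eq, iA_eq]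
    cases h1 : A u t <;> cases h2 : A u' t <;> simp_all
  nlinarith [fC_nonneg A v k t]

theorem dC_le (A : V → V → Bool) (w : V → ℝ) (hw : ∀ v, 0 ≤ w v)
    (v : Fin 5 → V) (u : V) (k : Fin 5) : dC A w v u k ≤ xC A w v k := by
  unfold dC xC
  refine Finset.sum_le_sum fun t _ => ?_
  refine mul_le_mul_of_nonneg_left ?_ (hw t)
  have h2 : iA A u t ≤ 1 := by
    rw [iA_eq]; split_ifs <;> norm_num
  nlinarith [fC_nonneg A v k t]

theorem dC_exists (A : V → V → Bool) (w : V → ℝ) 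
    (v : Fin 5 → V) (u : V) (k : Fin 5) (h : dC A w v u k ≠ 0) :
    ∃ z, inC A v k z ∧ A u z = true := by
  unfold dC at h
  obtain ⟨z, _, hz⟩ := Finset.exists_ne_zero_of_sum_ne_zero h
  refine ⟨z, ?_, ?_⟩
  · by_contra hc
    apply hz
    simp [fC, hc]
  · by_contra hc
    apply hz
    simp [iA_eq, hc]

theorem dC_zero (A : V → V → Bool) (hA : ∀ a b, A a b = A b a)
    (htri : ∀ a b c, (A a b && A a c && A b c) = false) (w : V → ℝ) 
    (v : Fin 5 → V) {z : V} {j : Fin 5} (hz : inC A v j z) (k : Fin 5)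
    (h1 : k - j ≠ 1) (h4 : k - j ≠ 4) : dC A w v z k = 0 := by
  by_contra hc
  obtain ⟨y, hy, ha⟩ := dC_exists A w v z k hc
  rcases inC_adj A hA htri v hz hy ha with h | h
  · exact h1 h
  · exact h4 h

theorem walkW_class (d x : Fin 5 → ℝ) (j : Fin 5)
    (h : ∀ k, k - j ≠ 1 → k - j ≠ 4 → d k = 0) :
    walkW d x = 2 * (d (j + 1) * d (j + 4) * x (j + 2) * x (j + 3)) := by
  have h0 := h j (by simp) (by simp)
  have h2 := h (j + 2) (by simp [add_sub_cancel_left]) (by simp [add_sub_cancel_left])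
  have h3 := h (j + 3) (by simp [add_sub_cancel_left]) (by simp [add_sub_cancel_left])
  have p : ∀ f : Fin 5 → ℝ, ∑ s ∈ ({1, 4} : Finset (Fin 5)), f s = f 1 + f 4 := fun f =>
    Finset.sum_pair (by decide)
  simp only [walkW, p, Fin.sum_univ_five]
  fin_cases j <;> simp only [Fin.reduceAdd, Fin.reduceFinMk, Fin.mk_zero, Fin.mk_one, Fin.isValue, zero_add] at h0 h2 h3 ⊢ <;>
    simp only [h0, h2, h3] <;> ring

theorem walkW_le (d x : Fin 5 → ℝ) (M : ℝ) (hd : ∀ k, 0 ≤ d k) (hx : ∀ k, 0 ≤ x k)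
    (hxM : ∀ k, x k ≤ M) : walkW d x ≤ M ^ 2 * (2 * ∑ k, d k * d (k + 2) + 6 * ∑ k, d k * d (k + 1)) := by
  have h1 : walkW d x ≤ walkW d (fun _ => M) := by
    unfold walkW
    refine Finset.sum_le_sum fun j _ => Finset.sum_le_sum fun s _ => Finset.sum_le_sum
      fun s' _ => Finset.sum_le_sum fun s'' _ => ?_
    have := hd j; have := hd (j + s + s' + s''); have := hx (j + s); have := hx (j + s + s')
    have := hxM (j + s); have := hxM (j + s + s')
    have hM : 0 ≤ M := (hx j).trans (hxM j)
    change _ ≤ d j * M * M * d (j + s + s' + s'')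
    gcongr
  refine h1.trans (le_of_eq ?_)
  have p : ∀ f : Fin 5 → ℝ, ∑ s ∈ ({1, 4} : Finset (Fin 5)), f s = f 1 + f 4 := fun f =>
    Finset.sum_pair (by decide)
  simp only [walkW, p, Fin.sum_univ_five, Fin.reduceAdd, Fin.isValue, zero_add]
  ring

theorem indep_choice : ∀ p : Fin 5 → Bool, (∀ k, p k = true → p (k + 1) = false) →
    ∃ j, ∀ k, p k = true → k = j + 1 ∨ k = j + 4 := by decide

theorem amgm4 (a b c d S : ℝ) (ha : 0 ≤ a) (hb : 0 ≤ b) (hc : 0 ≤ c) (hd : 0 ≤ d)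
    (h : a + b + c + d ≤ S) : a * b * c * d ≤ (S / 4) ^ 4 := by
  have h1 : a * b ≤ ((a + b) / 2) ^ 2 := by nlinarith [sq_nonneg (a - b)]
  have h2 : c * d ≤ ((c + d) / 2) ^ 2 := by nlinarith [sq_nonneg (c - d)]
  have h3 : ((a + b) / 2) * ((c + d) / 2) ≤ (S / 4) ^ 2 := by
    nlinarith [sq_nonneg (a + b - c - d)]
  calc a * b * c * d = (a * b) * (c * d) := by ring
    _ ≤ ((a + b) / 2) ^ 2 * ((c + d) / 2) ^ 2 := by
      apply mul_le_mul h1 h2 (by positivity) (by positivity)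
    _ = (((a + b) / 2) * ((c + d) / 2)) ^ 2 := by ring
    _ ≤ ((S / 4) ^ 2) ^ 2 := by
      apply pow_le_pow_left₀ (by positivity) h3
    _ = _ := by ring


theorem stability (A : V → V → Bool) (hA : ∀ a b, A a b = A b a)
    (htri : ∀ a b c, (A a b && A a c && A b c) = false) (w : V → ℝ) (hw : ∀ v, 0 ≤ w v)
    (hw1 : ∑ v, w v = 1) (ht : ∀ v, 2/625 - 1/10^12 ≤ tau A w v) :
    ∃ col : V → Fin 5, ∀ u u', A u u' = true → col u' - col u = 1 ∨ col u' - col u = 4 := by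
  obtain ⟨a, b, c, d, e, ⟨hab, hbc, hcd, hde, hea⟩, hdeg⟩ :=
    exists_good_cycle A hA htri w hw hw1 ht
  obtain ⟨v, hv, hvd⟩ : ∃ v : Fin 5 → V, (∀ j, A (v j) (v (j + 1)) = true) ∧
      2 - 1/10^7 ≤ ∑ j, deg A w (v j) := by
    refine ⟨![a, b, c, d, e], ?_, ?_⟩
    · intro j; fin_cases j
      · exact hab
      · exact hbc
      · exact hcd
      · exact hde
      · exact hea
    · rw [Fin.sum_univ_five]; exact hdeg
  clear hab hbc hcd hde hea hdeg
  set x := xC A w v with hx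
  have hxs : ∑ j, x j = ∑ u, w u * ∑ j, fC A v j u := by
    simp only [hx, xC, Finset.mul_sum]
    exact Finset.sum_comm
  have hx1 : ∑ j, x j ≤ 1 := by
    rw [hxs, ← hw1]
    refine Finset.sum_le_sum fun u _ => ?_
    have := (fC_facts A hA htri v hv u).2
    nlinarith [hw u]
  have hx2 : 1 - 1/10^7 ≤ ∑ j, x j := by
    have : ∑ j, deg A w (v j) ≤ 1 + ∑ j, x j := by
      have e1 : ∑ j, deg A w (v j) = ∑ u, w u * ∑ j, iA A (v j) u := by
        simp only [deg, Finset.mul_sum]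
        exact Finset.sum_comm
      rw [e1, hxs]
      rw [← hw1]
      rw [← Finset.sum_add_distrib]
      refine Finset.sum_le_sum fun u _ => ?_
      have := (fC_facts A hA htri v hv u).1
      nlinarith [hw u]
    linarith
  have hx0 : ∀ j, 0 ≤ x j := fun j => xC_nonneg A w hw v j
  have htw : ∀ z, 2/625 - 1/10^12 - 4/10^7 ≤ walkW (dC A w v z) x := by
    intro z
    have h1 := tau_le_walk A hA htri w hw hw1 v hv z
    have h2 := ht z
    rw [← hx] at h1
    linarith
  have hd0 : ∀ z k, 0 ≤ dC A w v z k := fun z k => dC_nonneg A w hw v z k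
  have hdx : ∀ z k, dC A w v z k ≤ x k := fun z k => dC_le A w hw v z k
  have hcls : ∀ z j, inC A v j z →
      0.0015997 ≤ dC A w v z (j + 1) * dC A w v z (j + 4) * x (j + 2) * x (j + 3) := by
    intro z j hz
    have h1 := htw z
    rw [walkW_class _ x j (fun k => dC_zero A hA htri w v hz k)] at h1
    norm_num at h1 ⊢
    linarith
  have hvj : ∀ j, inC A v j (v j) := by
    intro j
    refine ⟨by rw [hA]; exact hv j, ?_⟩
    have := hv (j + 4)
    rwa [show j + 4 + 1 = j by rw [add_assoc]; simp] at this
  have hsum : ∀ j, x j + (x (j + 1) + x (j + 4) + x (j + 2) + x (j + 3)) = ∑ k, x k := by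
    intro j
    rw [Fin.sum_univ_five]
    fin_cases j <;> simp only [Fin.reduceAdd, Fin.reduceFinMk, Fin.mk_zero, Fin.mk_one,
      Fin.isValue, zero_add] <;> ring
  have hM : ∀ j, x j ≤ 0.2001 := by
    intro j
    by_contra hc
    push Not at hc
    have h1 := hcls _ j (hvj j)
    have h2 := amgm4 (x (j + 1)) (x (j + 4)) (x (j + 2)) (x (j + 3)) 0.7999 (hx0 _) (hx0 _)
      (hx0 _) (hx0 _) (by linarith [hsum j])
    have h3 : dC A w v (v j) (j + 1) * dC A w v (v j) (j + 4) * x (j + 2) * x (j + 3) ≤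
        x (j + 1) * x (j + 4) * x (j + 2) * x (j + 3) := by
      have := hx0 (j + 1); have := hx0 (j + 4); have := hx0 (j + 2); have := hx0 (j + 3)
      have := hd0 (v j) (j + 1); have := hd0 (v j) (j + 4)
      have := hdx (v j) (j + 1); have := hdx (v j) (j + 4)
      gcongr
    norm_num at h1 h2
    linarith
  have aux : ∀ p q r s : ℝ, 0 ≤ p → 0 ≤ q → 0 ≤ r → 0 ≤ s → q ≤ 0.2001 → r ≤ 0.2001 →
      s ≤ 0.2001 → 0.0015997 ≤ p * q * r * s → 0.1991 ≤ p := by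
    intro p q r s hp hq hr hs hq' hr' hs' h
    by_contra hc
    push Not at hc
    have : p * q * r * s ≤ 0.1991 * 0.2001 * 0.2001 * 0.2001 := by gcongr
    norm_num at this h
    linarith
  have hdM : ∀ z k, dC A w v z k ≤ 0.2001 := fun z k => (hdx z k).trans (hM k)
  have hclose : ∀ z j, inC A v j z → x (j + 1) - dC A w v z (j + 1) ≤ 0.001 ∧
      x (j + 4) - dC A w v z (j + 4) ≤ 0.001 := by
    intro z j hz
    have h1 := hcls z j hz
    have h2 := aux _ _ _ _ (hd0 z (j + 1)) (hd0 z (j + 4)) (hx0 (j + 2)) (hx0 (j + 3))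
      (hdM _ _) (hM _) (hM _) h1
    have h3 := aux _ _ _ _ (hd0 z (j + 4)) (hd0 z (j + 1)) (hx0 (j + 2)) (hx0 (j + 3))
      (hdM _ _) (hM _) (hM _) (by rw [mul_comm (dC A w v z (j + 4))]; exact h1)
    have h4 := hM (j + 1)
    have h5 := hM (j + 4)
    norm_num at h2 h3 h4 h5 ⊢
    constructor <;> linarith
  have hsmall : ∀ u j, 0.001 < dC A w v u j →
      dC A w v u (j + 1) ≤ 0.001 := by
    intro u j h
    obtain ⟨z, hz, hz'⟩ := dC_exists A w v u j (by norm_num at h; intro h0; rw [h0] at h; linarith)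
    have h1 := dC_adj A htri w hw v hz' (j + 1)
    have h2 := (hclose z j hz).1
    rw [← hx] at h1
    linarith
  have hcol : ∀ u, ∃ j, x (j + 1) < 2 * dC A w v u (j + 1) ∧ x (j + 4) < 2 * dC A w v u (j + 4) := by
    intro u
    obtain ⟨j, hj⟩ := indep_choice (fun k => decide (0.001 < dC A w v u k)) (by
      intro k hk
      have hk' : 0.001 < dC A w v u k := by simpa using hk
      have := hsmall u k hk'
      simpa using this)
    have hj' : ∀ k, ¬ (k = j + 1 ∨ k = j + 4) → dC A w v u k ≤ 0.001 := by
      intro k hk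
      by_contra hc
      push Not at hc
      exact hk (hj k (by simpa using hc))
    have e0 := hj' j (by simp)
    have e2 := hj' (j + 2) (by simp)
    have e3 := hj' (j + 3) (by simp)
    have hW := walkW_le (dC A w v u) x 0.2001 (hd0 u) hx0 hM
    have hW' := htw u
    have s2 : ∑ k, dC A w v u k * dC A w v u (k + 2) =
        dC A w v u (j + 1) * dC A w v u (j + 4) + dC A w v u (j + 3) * dC A w v u (j + 1)
        + dC A w v u (j + 2) * dC A w v u (j + 4) + dC A w v u j * dC A w v u (j + 2)
        + dC A w v u j * dC A w v u (j + 3) := by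
      rw [Fin.sum_univ_five]
      clear * -
      fin_cases j <;> simp only [Fin.reduceAdd, Fin.reduceFinMk, Fin.mk_zero, Fin.mk_one,
        Fin.isValue, zero_add] <;> ring
    have s1 : ∑ k, dC A w v u k * dC A w v u (k + 1) =
        dC A w v u j * dC A w v u (j + 1) + dC A w v u (j + 2) * dC A w v u (j + 1)
        + dC A w v u (j + 2) * dC A w v u (j + 3) + dC A w v u (j + 3) * dC A w v u (j + 4)
        + dC A w v u j * dC A w v u (j + 4) := by
      rw [Fin.sum_univ_five]
      clear * -
      fin_cases j <;> simp only [Fin.reduceAdd, Fin.reduceFinMk, Fin.mk_zero, Fin.mk_one,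
        Fin.isValue, zero_add] <;> ring
    rw [s1, s2] at hW
    have key : ∀ k l, dC A w v u k ≤ 0.001 → dC A w v u k * dC A w v u l ≤ 0.001 * 0.2001 := by
      intro k l h
      have := hd0 u k; have := hd0 u l; have := hdM u l
      gcongr
    have k1 := key _ (j + 1) e3
    have k2 := key _ (j + 4) e2
    have k3 := key _ (j + 2) e0
    have k4 := key _ (j + 3) e0
    have k5 := key _ (j + 1) e0
    have k6 := key _ (j + 1) e2
    have k7 := key _ (j + 3) e2
    have k8 := key _ (j + 4) e3
    have k9 := key _ (j + 4) e0
    have hab : 0.03 ≤ dC A w v u (j + 1) * dC A w v u (j + 4) := by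
      norm_num at *
      linarith
    have p1 := hM (j + 1)
    have p4 := hM (j + 4)
    have q1 := hdM u (j + 1)
    have q4 := hdM u (j + 4)
    have r1 := hd0 u (j + 1)
    have r4 := hd0 u (j + 4)
    refine ⟨j, ?_, ?_⟩
    · by_contra hc
      push Not at hc
      have : dC A w v u (j + 1) * dC A w v u (j + 4) ≤ 0.10005 * 0.2001 := by
        gcongr
        norm_num at hc p1 ⊢
        linarith
      norm_num at this hab
      linarith
    · by_contra hc
      push Not at hc
      have : dC A w v u (j + 1) * dC A w v u (j + 4) ≤ 0.2001 * 0.10005 := by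
        gcongr
        norm_num at hc p4 ⊢
        linarith
      norm_num at this hab
      linarith
  choose col hc1 hc4 using hcol
  refine ⟨col, fun u u' h => ?_⟩
  have hadj : ∀ k, x k < 2 * dC A w v u k → x k < 2 * dC A w v u' k → False := by
    intro k h1 h2
    have := dC_adj A htri w hw v h k
    rw [← hx] at this
    linarith
  have a1 := hc1 u
  have a4 := hc4 u
  have b1 := hc1 u'
  have b4 := hc4 u'
  obtain ⟨s, hs⟩ : ∃ s, col u' = col u + s := ⟨col u' - col u, by abel⟩
  rw [hs] at b1 b4 ⊢
  rw [add_sub_cancel_left]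
  fin_cases s
  · exact (hadj _ a1 (by simpa using b1)).elim
  · left; rfl
  · refine (hadj _ a1 ?_).elim
    have : col u + 2 + 4 = col u + 1 := by rw [add_assoc]; rfl
    rw [← this]; exact b4
  · refine (hadj _ a4 ?_).elim
    have : col u + 3 + 1 = col u + 4 := by rw [add_assoc]; rfl
    rw [← this]; exact b1
  · right; rfl

end stab


section spec
set_option linter.unusedSectionVars false
variable {V : Type*} [Fintype V]

/-- the vector `x` with coordinate `i` scaled by `s` -/
noncomputable def scl (x : V → ℝ) (i : V) (s : ℝ) (v : V) : ℝ := if v = i then s * x v else x v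

theorem cy_distinct (A : V → V → Bool) (hA : ∀ a b, A a b = A b a) (hirr : ∀ a, A a a = false)
    (htri : ∀ a b c, (A a b && A a c && A b c) = false) {a b c d e : V}
    (h : A a b = true ∧ A b c = true ∧ A c d = true ∧ A d e = true ∧ A e a = true) :
    (a ≠ b ∧ a ≠ c ∧ a ≠ d ∧ a ≠ e) ∧ (b ≠ c ∧ b ≠ d ∧ b ≠ e) ∧ (c ≠ d ∧ c ≠ e) ∧ d ≠ e := by
  obtain ⟨h1, h2, h3, h4, h5⟩ := h
  have n : ∀ {u v}, A u v = true → u ≠ v := by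
    rintro u v huv rfl
    rw [hirr] at huv; cases huv
  have t : ∀ {u v w}, A u v = true → A v w = true → A w u = true → False := by
    intro u v w q1 q2 q3
    have := htri u v w
    rw [q1, q2, hA u w, q3] at this
    cases this
  refine ⟨⟨n h1, ?_, ?_, (n h5).symm⟩, ⟨n h2, ?_, ?_⟩, ⟨n h3, ?_⟩, n h4⟩
  · rintro rfl; exact t h3 h4 h5
  · rintro rfl; exact t h1 h2 h3
  · rintro rfl; exact t h4 h5 h1
  · rintro rfl; exact t h2 h3 h4
  · rintro rfl; exact t h1 h2 h5

theorem TT_scl (A : V → V → Bool) (hA : ∀ a b, A a b = A b a) (hirr : ∀ a, A a a = false)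
    (htri : ∀ a b c, (A a b && A a c && A b c) = false) (x : V → ℝ) (i : V) (s : ℝ) :
    TT A (scl x i s) = TT A x + (s - 1) * (5 * (x i * tau A x i)) := by
  set δ : V → ℝ := fun v => if v = i then 1 else 0 with hδ
  set F : V → V → V → V → V → ℝ := fun a b c d e => ((cyF A a b c d e : ℤ) : ℝ) * δ a with hF
  have e0 : S5 x F = x i * tau A x i := by
    rw [hF, S5_root]
    simp [hδ]
  have r : ∀ a b c d e, cyF A b c d e a = cyF A a b c d e := fun a b c d e =>
    (cyF_rot A a b c d e).symm
  have e1 : S5 x (fun a b c d e => ((cyF A a b c d e : ℤ) : ℝ) * δ b) = S5 x F := by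
    rw [← S5_perm x F ![1, 2, 3, 4, 0] (by decide)]
    congr 1; funext a b c d e
    change _ = ((cyF A b c d e a : ℤ) : ℝ) * δ b
    rw [r a]
  have e2 : S5 x (fun a b c d e => ((cyF A a b c d e : ℤ) : ℝ) * δ c) = S5 x F := by
    rw [← S5_perm x F ![2, 3, 4, 0, 1] (by decide)]
    congr 1; funext a b c d e
    change _ = ((cyF A c d e a b : ℤ) : ℝ) * δ c
    rw [r b, r a]
  have e3 : S5 x (fun a b c d e => ((cyF A a b c d e : ℤ) : ℝ) * δ d) = S5 x F := by
    rw [← S5_perm x F ![3, 4, 0, 1, 2] (by decide)]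
    congr 1; funext a b c d e
    change _ = ((cyF A d e a b c : ℤ) : ℝ) * δ d
    rw [r c, r b, r a]
  have e4 : S5 x (fun a b c d e => ((cyF A a b c d e : ℤ) : ℝ) * δ e) = S5 x F := by
    rw [← S5_perm x F ![4, 0, 1, 2, 3] (by decide)]
    congr 1; funext a b c d e
    change _ = ((cyF A e a b c d : ℤ) : ℝ) * δ e
    rw [r d, r c, r b, r a]
  have key : TT A (scl x i s) = S5 x (fun a b c d e => ((cyF A a b c d e : ℤ) : ℝ) + (s - 1) *
      (((cyF A a b c d e : ℤ) : ℝ) * δ a + ((cyF A a b c d e : ℤ) : ℝ) * δ b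
      + ((cyF A a b c d e : ℤ) : ℝ) * δ c + ((cyF A a b c d e : ℤ) : ℝ) * δ d
      + ((cyF A a b c d e : ℤ) : ℝ) * δ e)) := by
    unfold TT S5
    refine Finset.sum_congr rfl fun a _ => Finset.sum_congr rfl fun b _ => Finset.sum_congr rfl
      fun c _ => Finset.sum_congr rfl fun d _ => Finset.sum_congr rfl fun e _ => ?_
    beta_reduce
    rw [cyF_eq]
    split_ifs with hcy
    swap
    · simp
    obtain ⟨⟨q1, q2, q3, q4⟩, ⟨q5, q6, q7⟩, ⟨q8, q9⟩, q10⟩ := cy_distinct A hA hirr htri hcy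
    simp only [scl, hδ]
    by_cases ha : a = i
    · subst ha
      simp only [q1.symm, q2.symm, q3.symm, q4.symm, if_true, if_false]; ring
    by_cases hb : b = i
    · subst hb
      simp only [q1, q5.symm, q6.symm, q7.symm, if_true, if_false]; ring
    by_cases hc : c = i
    · subst hc
      simp only [q2, q5, q8.symm, q9.symm, if_true, if_false]; ring
    by_cases hd : d = i
    · subst hd
      simp only [q3, q6, q8, q10.symm, if_true, if_false]; ring
    by_cases he : e = i
    · subst he
      simp only [q4, q7, q9, q10, if_true, if_false]; ring
    simp only [ha, hb, hc, hd, he, if_false]; ring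
  rw [key]
  simp only [S5_add, S5_smul]
  rw [e1, e2, e3, e4]
  change _ + (s - 1) * (S5 x F + _ + _ + _ + _) = _
  rw [e0]
  unfold TT
  ring

theorem TT_smul (A : V → V → Bool) (x : V → ℝ) (k : ℝ) :
    TT A (fun v => k * x v) = k ^ 5 * TT A x := by
  unfold TT S5
  simp only [Finset.mul_sum]
  refine Finset.sum_congr rfl fun a _ => Finset.sum_congr rfl fun b _ => Finset.sum_congr rfl
      fun c _ => Finset.sum_congr rfl fun d _ => Finset.sum_congr rfl fun e _ => ?_
  ring

theorem tau_smul (A : V → V → Bool) (x : V → ℝ) (k : ℝ) (i : V) :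
    tau A (fun v => k * x v) i = k ^ 4 * tau A x i := by
  unfold tau
  simp only [Finset.mul_sum]
  refine Finset.sum_congr rfl 
      fun c _ => Finset.sum_congr rfl fun d _ => Finset.sum_congr rfl fun e _ => 
        Finset.sum_congr rfl fun e _ => ?_
  ring

theorem TT_nonneg (A : V → V → Bool) (x : V → ℝ) (hx : ∀ v, 0 ≤ x v) : 0 ≤ TT A x :=
  S5_nonneg x hx _ fun a b c d e => cyF_nonneg A a b c d e

theorem holder_sum (s : Finset V) (x : V → ℝ) (hx : ∀ v, 0 ≤ x v) (α : ℝ) (hα : 1 < α) :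
    ∑ v ∈ s, x v ≤ (s.card : ℝ) ^ (1 - 1 / α) * (∑ v ∈ s, x v ^ α) ^ (1 / α) := by
  have h := Real.rpow_sum_le_const_mul_sum_rpow_of_nonneg s hα.le (fun i _ => hx i)
  have hS : 0 ≤ ∑ v ∈ s, x v := Finset.sum_nonneg fun v _ => hx v
  have hP : 0 ≤ ∑ v ∈ s, x v ^ α := Finset.sum_nonneg fun v _ => Real.rpow_nonneg (hx v) _
  have h2 := Real.rpow_le_rpow (Real.rpow_nonneg hS _) h (by positivity : 0 ≤ 1 / α)
  rw [← Real.rpow_mul hS, mul_one_div_cancel (by linarith), Real.rpow_one,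
    Real.mul_rpow (by positivity) hP, ← Real.rpow_mul (by positivity)] at h2
  rwa [show (α - 1) * (1 / α) = 1 - 1 / α by field_simp] at h2


/-- first order condition from maximality -/
theorem first_order (T t P γ α : ℝ) (hα : 0 < α) (hγ : γ * α = 5)
    (h : ∀ s : ℝ, 0 ≤ s → T + (s - 1) * P ≤ T * (1 + (s ^ α - 1) * t) ^ γ) : P = 5 * T * t := by
  set g : ℝ → ℝ := fun s => T * (1 + (s ^ α - 1) * t) ^ γ - (T + (s - 1) * P) with hg
  have hd1 : HasDerivAt (fun s : ℝ => 1 + (s ^ α - 1) * t) (α * t) 1 := by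
    have h1 := Real.hasDerivAt_rpow_const (x := 1) (p := α) (Or.inl one_ne_zero)
    simp only [Real.one_rpow, mul_one] at h1
    exact ((h1.sub_const 1).mul_const t).const_add 1
  have hd2 : HasDerivAt (fun s : ℝ => (1 + (s ^ α - 1) * t) ^ γ) (α * t * γ) 1 := by
    have := hd1.rpow_const (p := γ) (Or.inl (by simp))
    simpa using this
  have hd3 : HasDerivAt g (T * (α * t * γ) - 1 * P) 1 := by
    refine (hd2.const_mul T).sub ?_
    exact (((hasDerivAt_id (1 : ℝ)).sub_const 1).mul_const P).const_add T
  have hmin : IsLocalMin g 1 := by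
    have : ∀ᶠ s in nhds (1 : ℝ), 0 ≤ s := by
      filter_upwards [lt_mem_nhds (show (0:ℝ) < 1 by norm_num)] with s hs using hs.le
    filter_upwards [this] with s hs
    have := h s hs
    simp only [hg, Real.one_rpow]
    simp
    linarith
  have := hmin.hasDerivAt_eq_zero hd3
  have e : T * (α * t * γ) = 5 * T * t := by rw [← hγ]; ring
  linarith

/-- numerical core: lower bound on `t` -/
theorem t_lower (t θ C : ℝ) (n : ℝ) (hn : 1 ≤ n) (hθ : 0 < θ) (hθ1 : θ < 1) (hC : 0 ≤ C)
    (ht : 0 ≤ t) (ht1 : t ≤ 1) (hnC : C / n ^ 2 ≤ 1)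
    (h : (1 - 5 * t) * (1 - C / n ^ 2) ≤ (1 - 1 / n) ^ (5 * θ) * (1 - t) ^ (5 * (1 - θ))) :
    1 / n - (C + 10) / (5 * θ) / n ^ 2 ≤ t := by
  have hn0 : 0 < n := by linarith
  by_cases htn : 1 / n ≤ t
  · have : 0 ≤ (C + 10) / (5 * θ) / n ^ 2 := by positivity
    linarith
  push Not at htn
  have hn1 : 1 / n ≤ 1 := by rw [div_le_one hn0]; exact hn
  set u := θ * (1 / n) + (1 - θ) * t with hu
  have hu0 : 0 ≤ u := by
    have : 0 ≤ 1 / n := by positivity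
    have : 0 ≤ 1 - θ := by linarith
    positivity
  have hun : u ≤ 1 / n := by rw [hu]; nlinarith
  have hag : (1 - 1 / n) ^ θ * (1 - t) ^ (1 - θ) ≤ 1 - u := by
    have := Real.geom_mean_le_arith_mean2_weighted (w₁ := θ) (w₂ := 1 - θ) (p₁ := 1 - 1 / n)
      (p₂ := 1 - t) hθ.le (by linarith) (by linarith) (by linarith) (by ring)
    refine this.trans (le_of_eq ?_)
    rw [hu]; ring
  have hpow : (1 - 1 / n) ^ (5 * θ) * (1 - t) ^ (5 * (1 - θ)) ≤ (1 - u) ^ 5 := by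
    have e : (1 - 1 / n) ^ (5 * θ) * (1 - t) ^ (5 * (1 - θ)) =
        ((1 - 1 / n) ^ θ * (1 - t) ^ (1 - θ)) ^ 5 := by
      rw [mul_pow, ← Real.rpow_natCast, ← Real.rpow_natCast, ← Real.rpow_mul (by linarith),
        ← Real.rpow_mul (by linarith)]
      norm_num [mul_comm]
    rw [e]
    have p1 : 0 ≤ (1 - 1 / n) ^ θ := Real.rpow_nonneg (by linarith) _
    have p2 : 0 ≤ (1 - t) ^ (1 - θ) := Real.rpow_nonneg (by linarith) _
    gcongr
  have hq : (1 - u) ^ 5 ≤ 1 - 5 * u + 10 * u ^ 2 := by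
    have h1 : u ≤ 1 := hun.trans hn1
    have : 0 ≤ u ^ 3 * (10 - 5 * u + u ^ 2) := by
      apply mul_nonneg (by positivity); nlinarith
    nlinarith
  have hu2 : u ^ 2 ≤ 1 / n ^ 2 := by
    rw [← one_div_pow]; gcongr
  have hC' : 0 ≤ C / n ^ 2 := by positivity
  have h5 : 1 - 5 * t - C / n ^ 2 ≤ (1 - 5 * t) * (1 - C / n ^ 2) := by nlinarith
  have h6 : 5 * θ * (1 / n) - (C + 10) / n ^ 2 ≤ 5 * θ * t := by
    have e : (C + 10) / n ^ 2 = C / n ^ 2 + 10 * (1 / n ^ 2) := by ring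
    rw [e]
    nlinarith
  have e2 : (C + 10) / (5 * θ) / n ^ 2 = ((C + 10) / n ^ 2) / (5 * θ) := by ring
  rw [e2, sub_le_iff_le_add, ← sub_le_iff_le_add', le_div_iff₀ (by positivity)]
  nlinarith


theorem homog_max (A : V → V → Bool) (hA : ∀ a b, A a b = A b a)
    (htri : ∀ a b c, (A a b && A a c && A b c) = false) (α : ℝ) (hα : 1 < α) (T : ℝ)
    (hmax : ∀ y : V → ℝ, (∀ v, 0 ≤ y v) → ∑ v, y v ^ α = 1 → TT A y ≤ T)
    (y : V → ℝ) (hy : ∀ v, 0 ≤ y v) : TT A y ≤ T * (∑ v, y v ^ α) ^ (5 / α) := by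
  have hα0 : 0 < α := by linarith
  have hP : 0 ≤ ∑ v, y v ^ α := Finset.sum_nonneg fun v _ => Real.rpow_nonneg (hy v) _
  rcases hP.eq_or_lt with h0 | h0
  · have hz : ∀ v, y v = 0 := by
      intro v
      have := (Finset.sum_eq_zero_iff_of_nonneg (fun v _ => Real.rpow_nonneg (hy v) α)).1 h0.symm v
        (Finset.mem_univ v)
      exact (Real.rpow_eq_zero (hy v) hα0.ne').1 this
    have h1 := flag_ineqZ A hA htri y hy
    rw [← h0, Real.zero_rpow (by positivity)]
    simp only [hz, Finset.sum_const_zero] at h1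
    linarith
  · set P := ∑ v, y v ^ α with hPdef
    set k := P ^ (-(1 / α)) with hk
    have hk0 : 0 < k := Real.rpow_pos_of_pos h0 _
    have hka : k ^ α * P = 1 := by
      rw [hk, ← Real.rpow_mul h0.le, show -(1 / α) * α = -1 by field_simp, Real.rpow_neg_one]
      exact inv_mul_cancel₀ h0.ne'
    have h1 := hmax (fun v => k * y v) (fun v => mul_nonneg hk0.le (hy v)) (by
      rw [← hka, hPdef, Finset.mul_sum]
      exact Finset.sum_congr rfl fun v _ => Real.mul_rpow hk0.le (hy v))
    rw [TT_smul] at h1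
    have hk5 : k ^ 5 * P ^ (5 / α) = 1 := by
      rw [hk, ← Real.rpow_natCast, ← Real.rpow_mul h0.le, ← Real.rpow_add h0,
        show -(1 / α) * ((5 : ℕ) : ℝ) + 5 / α = 0 by push_cast; ring, Real.rpow_zero]
    have hPp : 0 ≤ P ^ (5 / α) := Real.rpow_nonneg h0.le _
    calc TT A y = (k ^ 5 * P ^ (5 / α)) * TT A y := by rw [hk5, one_mul]
      _ = (k ^ 5 * TT A y) * P ^ (5 / α) := by ring
      _ ≤ T * P ^ (5 / α) := by gcongr

theorem scl_sum (x : V → ℝ) (hx : ∀ v, 0 ≤ x v) (i : V) (s α : ℝ) (hs : 0 ≤ s) :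
    ∑ v, scl x i s v ^ α = ∑ v, x v ^ α + (s ^ α - 1) * x i ^ α := by
  have : ∀ v, scl x i s v ^ α = x v ^ α + if v = i then (s ^ α - 1) * x i ^ α else 0 := by
    intro v
    unfold scl
    split_ifs with h
    · subst h
      rw [Real.mul_rpow hs (hx v)]; ring
    · ring
  simp only [this, Finset.sum_add_distrib, Finset.sum_ite_eq', Finset.mem_univ, if_true]

theorem tau_lower (A : V → V → Bool) (hA : ∀ a b, A a b = A b a) (hirr : ∀ a, A a a = false)
    (htri : ∀ a b c, (A a b && A a c && A b c) = false) (α : ℝ) (hα : 1 < α)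
    (x : V → ℝ) (hx : ∀ v, 0 ≤ x v) (hx1 : ∑ v, x v ^ α = 1)
    (hmax : ∀ y : V → ℝ, (∀ v, 0 ≤ y v) → ∑ v, y v ^ α = 1 → TT A y ≤ TT A x)
    (n : ℝ) (hn : n = (Fintype.card V : ℝ)) (hn1 : 1 ≤ n) (C : ℝ) (hC : 0 ≤ C)
    (hT : 2 / 625 * (n ^ (1 - 1 / α)) ^ 5 * (1 - C / n ^ 2) ≤ TT A x)
    (hb : C / n ^ 2 ≤ 1 / 10 ^ 11) (hb' : (C + 10) / (5 * (1 - 1 / α)) / n ≤ 1 / 10 ^ 11) (i : V) :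
    (2 / 625 - 1 / 10 ^ 12) * (n ^ (1 - 1 / α)) ^ 4 ≤ tau A x i := by
  have hα0 : 0 < α := by linarith
  set θ := 1 - 1 / α with hθ
  have hθ0 : 0 < θ := by
    have : 1 / α < 1 := by rw [div_lt_one hα0]; exact hα
    linarith
  have hθ1 : θ < 1 := by
    have : 0 < 1 / α := by positivity
    linarith
  have hn0 : 0 < n := by linarith
  set N := n ^ θ with hN
  have hN0 : 0 < N := Real.rpow_pos_of_pos hn0 _
  set T := TT A x with hTdef
  have hTn : 0 ≤ T := TT_nonneg A x hx
  set t := x i ^ α with ht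
  have ht0 : 0 ≤ t := Real.rpow_nonneg (hx i) _
  have hscl : ∀ s : ℝ, 0 ≤ s → ∀ v, 0 ≤ scl x i s v := by
    intro s hs v
    unfold scl; split_ifs
    · exact mul_nonneg hs (hx v)
    · exact hx v
  have hfo : 5 * (x i * tau A x i) = 5 * T * t := by
    refine first_order T t _ (5 / α) α hα0 (by field_simp) fun s hs => ?_
    have h1 := homog_max A hA htri α hα T hmax (scl x i s) (hscl s hs)
    rwa [TT_scl A hA hirr htri, scl_sum x hx i s α hs, hx1] at h1
  -- remove vertex i
  have hz := TT_scl A hA hirr htri x i 0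
  have hfl := flag_ineqZ A hA htri (scl x i 0) (hscl 0 le_rfl)
  rw [hz, hfo] at hfl
  have hsum : ∑ v, scl x i 0 v = ∑ v ∈ Finset.univ.erase i, x v := by
    have : ∀ v, scl x i 0 v = if v ∈ Finset.univ.erase i then x v else 0 := by
      intro v; unfold scl
      by_cases h : v = i <;> simp [h]
    simp only [this]
    rw [Finset.sum_ite_mem, Finset.univ_inter]
  have hsumt : ∑ v ∈ Finset.univ.erase i, x v ^ α = 1 - t := by
    rw [← hx1, ← Finset.add_sum_erase Finset.univ _ (Finset.mem_univ i)]; ring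
  have ht1 : t ≤ 1 := by
    have : 0 ≤ ∑ v ∈ Finset.univ.erase i, x v ^ α :=
      Finset.sum_nonneg fun v _ => Real.rpow_nonneg (hx v) _
    linarith
  have hhol := holder_sum (Finset.univ.erase i) x hx α hα
  rw [hsumt, Finset.card_erase_of_mem (Finset.mem_univ i), Finset.card_univ, ← hsum,
    Nat.cast_sub (Fintype.card_pos_iff.2 ⟨i⟩), ← hn, ← hθ, Nat.cast_one] at hhol
  have hs0 : 0 ≤ ∑ v, scl x i 0 v := Finset.sum_nonneg fun v _ => hscl 0 le_rfl v
  have h1n : 0 ≤ 1 - 1 / n := by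
    have : 1 / n ≤ 1 := by rw [div_le_one hn0]; exact hn1
    linarith
  have hpow5 : ((n - 1) ^ θ * (1 - t) ^ (1 / α)) ^ 5 =
      N ^ 5 * ((1 - 1 / n) ^ (5 * θ) * (1 - t) ^ (5 * (1 - θ))) := by
    have e1 : n - 1 = n * (1 - 1 / n) := by field_simp
    have e2 : 1 / α = 1 - θ := by rw [hθ]; ring
    rw [e1, e2, Real.mul_rpow hn0.le h1n, mul_pow, mul_pow, ← hN]
    rw [← Real.rpow_natCast ((1 - 1 / n) ^ θ), ← Real.rpow_natCast ((1 - t) ^ (1 - θ)),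
      ← Real.rpow_mul h1n, ← Real.rpow_mul (by linarith)]
    push_cast
    rw [mul_comm θ 5, mul_comm (1 - θ) 5]
    ring
  set X := (1 - 1 / n) ^ (5 * θ) * (1 - t) ^ (5 * (1 - θ)) with hX
  have hX0 : 0 ≤ X := mul_nonneg (Real.rpow_nonneg h1n _) (Real.rpow_nonneg (by linarith) _)
  have hup : (1 - 5 * t) * T ≤ 2 / 625 * (N ^ 5 * X) := by
    have := pow_le_pow_left₀ hs0 hhol 5
    rw [hpow5] at this
    linarith
  have hmain : (1 - 5 * t) * (1 - C / n ^ 2) ≤ X := by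
    have hc1 : 0 ≤ 1 - C / n ^ 2 := by
      have : (1:ℝ) / 10 ^ 11 ≤ 1 := by norm_num
      linarith
    by_cases h5 : 1 - 5 * t ≤ 0
    · exact (mul_nonpos_of_nonpos_of_nonneg h5 hc1).trans hX0
    · push Not at h5
      have h6 : (1 - 5 * t) * (2 / 625 * N ^ 5 * (1 - C / n ^ 2)) ≤ 2 / 625 * (N ^ 5 * X) :=
        (mul_le_mul_of_nonneg_left hT h5.le).trans hup
      have h7 : 0 < 2 / 625 * N ^ 5 := by positivity
      refine le_of_mul_le_mul_left ?_ h7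
      linarith
  have hlow := t_lower t θ C n hn1 hθ0 hθ1 hC ht0 ht1 (hb.trans (by norm_num)) hmain
  set K := (C + 10) / (5 * θ) / n with hK
  have hlow' : 1 / n * (1 - K) ≤ t := by
    have : (C + 10) / (5 * θ) / n ^ 2 = 1 / n * K := by rw [hK]; ring
    rw [this] at hlow
    linarith
  have hK0 : 0 ≤ K := by positivity
  have hK1 : 0 < 1 - K := by
    have : (1:ℝ) / 10 ^ 11 < 1 := by norm_num
    linarith
  have htpos : 0 < t := lt_of_lt_of_le (by positivity) hlow'
  have hxi : 0 < x i := by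
    rcases (hx i).eq_or_lt with h | h
    · rw [ht, ← h, Real.zero_rpow hα0.ne'] at htpos; exact absurd htpos (lt_irrefl _)
    · exact h
  have htau : tau A x i = T * t ^ θ := by
    have e1 : x i * t ^ θ = t := by
      rw [ht, ← Real.rpow_mul hxi.le, show α * θ = α - 1 by rw [hθ]; field_simp]
      rw [Real.rpow_sub_one hxi.ne']; field_simp
    have e2 : x i * tau A x i = x i * (T * t ^ θ) := by
      calc x i * tau A x i = T * t := by linarith
        _ = T * (x i * t ^ θ) := by rw [e1]
        _ = _ := by ring
    exact mul_left_cancel₀ hxi.ne' e2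
  have htθ : N⁻¹ * (1 - K) ≤ t ^ θ := by
    have h1 := Real.rpow_le_rpow (by positivity) hlow' hθ0.le
    rw [Real.mul_rpow (by positivity) hK1.le, one_div, Real.inv_rpow hn0.le, ← hN] at h1
    refine le_trans ?_ h1
    have : 1 - K ≤ (1 - K) ^ θ := Real.self_le_rpow_of_le_one hK1.le (by linarith) hθ1.le
    gcongr
  rw [htau]
  have hc1 : 0 ≤ 1 - C / n ^ 2 := by
    have : (1:ℝ) / 10 ^ 11 ≤ 1 := by norm_num
    linarith
  calc (2 / 625 - 1 / 10 ^ 12) * N ^ 4 ≤ (2 / 625 * ((1 - C / n ^ 2) * (1 - K))) * N ^ 4 := by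
        gcongr
        have hCn : 0 ≤ C / n ^ 2 := by positivity
        have : 1 - C / n ^ 2 - K ≤ (1 - C / n ^ 2) * (1 - K) := by nlinarith
        norm_num at hb hb' ⊢
        linarith
    _ = (2 / 625 * N ^ 5 * (1 - C / n ^ 2)) * (N⁻¹ * (1 - K)) := by field_simp
    _ ≤ T * t ^ θ := by
        apply mul_le_mul hT htθ (by positivity) hTn

theorem analytic_main (α : ℝ) (hα : 1 < α) : ∃ N0 : ℕ, 1 ≤ N0 ∧ ∀ n : ℕ, N0 ≤ n →
    ∀ (A : Fin n → Fin n → Bool), (∀ a b, A a b = A b a) → (∀ a, A a a = false) →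
    (∀ a b c, (A a b && A a c && A b c) = false) → ∀ x : Fin n → ℝ, (∀ v, 0 ≤ x v) →
    ∑ v, x v ^ α = 1 →
    (∀ y : Fin n → ℝ, (∀ v, 0 ≤ y v) → ∑ v, y v ^ α = 1 → TT A y ≤ TT A x) →
    2 / 625 * ((n : ℝ) ^ (1 - 1 / α)) ^ 5 * (1 - 100 / (n : ℝ) ^ 2) ≤ TT A x →
    ∃ col : Fin n → Fin 5, ∀ u u', A u u' = true → col u' - col u = 1 ∨ col u' - col u = 4 := by
  set K := (100 + 10) / (5 * (1 - 1 / α)) with hK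
  have hα0 : 0 < α := by linarith
  have hθ0 : 0 < 1 - 1 / α := by
    have : 1 / α < 1 := by rw [div_lt_one hα0]; exact hα
    linarith
  have hK0 : 0 ≤ K := by positivity
  obtain ⟨N0, hN0⟩ := exists_nat_ge (10 ^ 11 * (100 + K))
  refine ⟨N0 + 1, by omega, ?_⟩
  intro n hn A hA hirr htri x hx hx1 hmax hT
  have hn' : (N0 : ℝ) + 1 ≤ n := by exact_mod_cast hn
  have hN0' : (0:ℝ) ≤ N0 := Nat.cast_nonneg _
  have hn1 : (1 : ℝ) ≤ n := by linarith
  have hn0 : (0 : ℝ) < n := by linarith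
  have hb : 100 / (n : ℝ) ^ 2 ≤ 1 / 10 ^ 11 := by
    rw [div_le_div_iff₀ (by positivity) (by positivity)]
    nlinarith
  have hb' : K / n ≤ 1 / 10 ^ 11 := by
    rw [div_le_div_iff₀ (by positivity) (by positivity)]
    nlinarith
  have hτ := tau_lower A hA hirr htri α hα x hx hx1 hmax n (by simp) hn1 100 (by norm_num) hT hb hb'
  set S := ∑ v, x v with hS
  have hS0 : 0 ≤ S := Finset.sum_nonneg fun v _ => hx v
  have hSN : S ≤ (n : ℝ) ^ (1 - 1 / α) := by
    have := holder_sum Finset.univ x hx α hα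
    rw [hx1, Real.one_rpow, mul_one] at this
    simpa using this
  have hSpos : 0 < S := by
    rcases hS0.eq_or_lt with h | h
    · have hz : ∀ v, x v = 0 := fun v =>
        (Finset.sum_eq_zero_iff_of_nonneg (fun v _ => hx v)).1 h.symm v (Finset.mem_univ v)
      simp [hz, Real.zero_rpow hα0.ne'] at hx1
    · exact h
  refine stability A hA htri (fun v => S⁻¹ * x v) (fun v => mul_nonneg (by positivity) (hx v)) ?_ ?_
  · rw [← Finset.mul_sum, ← hS, inv_mul_cancel₀ hSpos.ne']
  · intro v
    rw [tau_smul]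
    have h1 : (2 / 625 - 1 / 10 ^ 12) * S ^ 4 ≤ tau A x v := by
      refine le_trans ?_ (hτ v)
      gcongr
    calc (2:ℝ) / 625 - 1 / 10 ^ 12 = S⁻¹ ^ 4 * ((2 / 625 - 1 / 10 ^ 12) * S ^ 4) := by
          field_simp
      _ ≤ _ := by gcongr

end spec


section final

/-- Boolean adjacency of a 2-graph -/
noncomputable def adjB {n : ℕ} (G : RGraph 2 n) (a b : Fin n) : Bool := decide ({a, b} ∈ G.edges)

theorem adjB_iff {n : ℕ} (G : RGraph 2 n) (a b : Fin n) :
    adjB G a b = true ↔ ({a, b} : Finset (Fin n)) ∈ G.edges := by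
  unfold adjB; simp

theorem adjB_symm {n : ℕ} (G : RGraph 2 n) (a b : Fin n) : adjB G a b = adjB G b a := by
  unfold adjB; rw [Finset.pair_comm]

theorem adjB_irr {n : ℕ} (G : RGraph 2 n) (a : Fin n) : adjB G a a = false := by
  by_contra h
  have h1 : adjB G a a = true := by simpa using h
  rw [adjB_iff] at h1
  have := G.card_eq _ h1
  simp at this

theorem adjB_tri {n : ℕ} (G : RGraph 2 n) (hG : Inj K3 G = ∅) (a b c : Fin n) :
    (adjB G a b && adjB G a c && adjB G b c) = false := by
  by_contra h
  have h1 : (adjB G a b && adjB G a c && adjB G b c) = true := Bool.eq_true_of_not_eq_false h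
  simp only [Bool.and_eq_true] at h1
  obtain ⟨⟨hab, hac⟩, hbc⟩ := h1
  have ne : ∀ u v, adjB G u v = true → u ≠ v := by
    rintro u v huv rfl
    rw [adjB_irr] at huv; cases huv
  have n1 := ne _ _ hab
  have n2 := ne _ _ hac
  have n3 := ne _ _ hbc
  rw [adjB_iff] at hab hac hbc
  have : ![a, b, c] ∈ Inj K3 G := by
    unfold Inj
    refine Finset.mem_filter.2 ⟨Finset.mem_univ _, ?_, ?_⟩
    · intro i j hij
      fin_cases i <;> fin_cases j <;>
        first
        | rfl
        | exact absurd hij (by assumption)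
        | exact absurd hij.symm (by assumption)
    · intro e he
      simp only [K3, Finset.mem_insert, Finset.mem_singleton] at he
      rcases he with rfl | rfl | rfl <;> simpa [Finset.image_insert]
  rw [hG] at this
  simp at this

theorem mem_Inj_C5 {n : ℕ} (G : RGraph 2 n) (hG : Inj K3 G = ∅) (t : Fin 5 → Fin n) :
    t ∈ Inj C5 G ↔ (adjB G (t 0) (t 1) = true ∧ adjB G (t 1) (t 2) = true ∧
      adjB G (t 2) (t 3) = true ∧ adjB G (t 3) (t 4) = true ∧ adjB G (t 4) (t 0) = true) := by
  unfold Inj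
  simp only [Finset.mem_filter, Finset.mem_univ, true_and, adjB_iff]
  constructor
  · rintro ⟨-, h⟩
    refine ⟨?_, ?_, ?_, ?_, ?_⟩
    · simpa [Finset.image_insert] using h {0, 1} (by decide)
    · simpa [Finset.image_insert] using h {1, 2} (by decide)
    · simpa [Finset.image_insert] using h {2, 3} (by decide)
    · simpa [Finset.image_insert] using h {3, 4} (by decide)
    · simpa [Finset.image_insert] using h {4, 0} (by decide)
  · intro h
    have h' := h
    simp only [← adjB_iff] at h'
    obtain ⟨⟨d1, d2, d3, d4⟩, ⟨d5, d6, d7⟩, ⟨d8, d9⟩, d10⟩ :=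
      cy_distinct (adjB G) (adjB_symm G) (adjB_irr G) (adjB_tri G hG) h'
    obtain ⟨h1, h2, h3, h4, h5⟩ := h
    constructor
    · intro i j hij
      fin_cases i <;> fin_cases j <;>
        first
        | rfl
        | exact absurd hij (by assumption)
        | exact absurd hij.symm (by assumption)
    · intro e he
      simp only [C5, Finset.mem_insert, Finset.mem_singleton] at he
      rcases he with rfl | rfl | rfl | rfl | rfl <;> simpa [Finset.image_insert]

theorem lagPoly_eq {n : ℕ} (G : RGraph 2 n) (hG : Inj K3 G = ∅) (x : Fin n → ℝ) :
    lagPoly C5 G x = TT (adjB G) x := by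
  unfold lagPoly TT
  rw [S5_fun]
  have h1 : ∀ t : Fin 5 → Fin n, (∏ i, x (t i)) *
      ((cyF (adjB G) (t 0) (t 1) (t 2) (t 3) (t 4) : ℤ) : ℝ) =
      if t ∈ Inj C5 G then ∏ i, x (t i) else 0 := by
    intro t
    rw [cyF_eq]
    simp only [mem_Inj_C5 G hG]
    split_ifs <;> simp
  rw [Finset.sum_congr rfl (fun t _ => h1 t), ← Finset.sum_filter,
    Finset.filter_mem_eq_inter, Finset.univ_inter]
  refine Finset.sum_congr rfl fun φ hφ => ?_
  have hinj : Function.Injective φ := by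
    unfold Inj at hφ; exact (Finset.mem_filter.1 hφ).2.1
  rw [Finset.prod_image (fun a _ b _ h => hinj h)]

theorem col_trifree {n : ℕ} (H : RGraph 2 n) (hH : C5Colorable H) : Inj K3 H = ∅ := by
  obtain ⟨f, hf⟩ := hH
  by_contra hne
  obtain ⟨φ, hφ⟩ := Finset.nonempty_iff_ne_empty.2 hne
  unfold Inj at hφ
  obtain ⟨-, -, h⟩ := Finset.mem_filter.1 hφ
  have h1 := hf _ (h {0, 1} (by decide))
  have h2 := hf _ (h {1, 2} (by decide))
  have h3 := hf _ (h {0, 2} (by decide))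
  simp only [Finset.image_insert, Finset.image_singleton] at h1 h2 h3
  generalize f (φ 0) = a at *
  generalize f (φ 1) = b at *
  generalize f (φ 2) = c at *
  clear hφ h φ hf f hne
  revert a b c
  decide

theorem pair_C5 : ∀ a b : Fin 5, (b - a = 1 ∨ b - a = 4) → ({a, b} : Finset (Fin 5)) ∈ C5.edges := by
  decide

theorem C5_pair : ∀ a b : Fin 5, ({a, b} : Finset (Fin 5)) ∈ C5.edges → (b - a = 1 ∨ b - a = 4) := by
  decide

theorem simplex_compact (α : ℝ) (hα : 1 < α) (n : ℕ) : IsCompact (simplex α n) := by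
  have hsub : simplex α n ⊆ Set.pi Set.univ (fun _ : Fin n => Set.Icc (-1 : ℝ) 1) := by
    intro x hx i _
    have h1 : |x i| ^ α ≤ 1 := by
      have hx' : ∑ i, |x i| ^ α = 1 := hx
      rw [← hx']
      exact Finset.single_le_sum (f := fun i => |x i| ^ α)
        (fun j _ => Real.rpow_nonneg (abs_nonneg _) _) (Finset.mem_univ i)
    have h2 : |x i| ≤ 1 := by
      by_contra hh
      push Not at hh
      exact absurd h1 (not_le.2 (Real.one_lt_rpow hh (by linarith)))
    exact abs_le.1 h2
  refine IsCompact.of_isClosed_subset (isCompact_univ_pi fun _ => isCompact_Icc) ?_ hsub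
  refine isClosed_eq ?_ continuous_const
  refine continuous_finsetSum _ fun i _ => ?_
  exact (continuous_abs.comp (continuous_apply i)).rpow_const (fun _ => Or.inr (by linarith))

theorem lagPoly_cont {n : ℕ} (G : RGraph 2 n) : Continuous (lagPoly C5 G) := by
  unfold lagPoly
  fun_prop

theorem specRad_ge (α : ℝ) (hα : 1 < α) {n : ℕ} (G : RGraph 2 n) (x : Fin n → ℝ)
    (hx : x ∈ simplex α n) : lagPoly C5 G x ≤ specRad α C5 G :=
  le_csSup ((simplex_compact α hα n).image (lagPoly_cont G)).bddAbove ⟨x, hx, rfl⟩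

theorem const_simplex (α : ℝ) (hα : 1 < α) (n : ℕ) (hn : 1 ≤ n) :
    (fun _ : Fin n => (n : ℝ) ^ (-(1 / α))) ∈ simplex α n := by
  have hn0 : (0 : ℝ) < n := by exact_mod_cast hn
  show ∑ i : Fin n, |(n : ℝ) ^ (-(1 / α))| ^ α = 1
  rw [abs_of_nonneg (Real.rpow_nonneg hn0.le _), ← Real.rpow_mul hn0.le]
  have : -(1 / α) * α = -1 := by
    have : α ≠ 0 := by linarith
    field_simp
  rw [this, Real.rpow_neg_one]
  simp
  field_simp

theorem specRad_attained (α : ℝ) (hα : 1 < α) {n : ℕ} (hn : 1 ≤ n) (G : RGraph 2 n)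
    (hG : Inj K3 G = ∅) : ∃ x : Fin n → ℝ, (∀ v, 0 ≤ x v) ∧ ∑ v, x v ^ α = 1 ∧
      TT (adjB G) x = specRad α C5 G ∧
      ∀ y : Fin n → ℝ, (∀ v, 0 ≤ y v) → ∑ v, y v ^ α = 1 → TT (adjB G) y ≤ TT (adjB G) x := by
  obtain ⟨x, hx, hmax⟩ := (simplex_compact α hα n).exists_isMaxOn
    ⟨_, const_simplex α hα n hn⟩ (lagPoly_cont G).continuousOn
  have hmax' : ∀ y ∈ simplex α n, lagPoly C5 G y ≤ lagPoly C5 G x := fun y hy => hmax hy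
  have hs : specRad α C5 G ≤ lagPoly C5 G x := by
    refine csSup_le ⟨_, x, hx, rfl⟩ ?_
    rintro _ ⟨y, hy, rfl⟩
    exact hmax' y hy
  have habs : (fun v => |x v|) ∈ simplex α n := by
    show ∑ i, |(|x i|)| ^ α = 1
    simp only [abs_abs]; exact hx
  have hle : lagPoly C5 G x ≤ lagPoly C5 G (fun v => |x v|) := by
    unfold lagPoly
    refine Finset.sum_le_sum fun φ _ => ?_
    rw [← Finset.abs_prod]
    exact le_abs_self _
  have hge := specRad_ge α hα G _ habs
  refine ⟨fun v => |x v|, fun v => abs_nonneg _, hx, ?_, ?_⟩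
  · rw [← lagPoly_eq G hG]; linarith
  · intro y hy0 hy
    rw [← lagPoly_eq G hG, ← lagPoly_eq G hG]
    have : y ∈ simplex α n := by
      show ∑ i, |y i| ^ α = 1
      rw [← hy]
      exact Finset.sum_congr rfl fun i _ => by rw [abs_of_nonneg (hy0 i)]
    linarith [hmax' y this]

theorem specs_bdd (α : ℝ) (n : ℕ) :
    BddAbove {y | ∃ H : RGraph 2 n, C5Colorable H ∧ y = specRad α C5 H} := by
  have : Finite (RGraph 2 n) := by
    refine Finite.of_injective (fun G : RGraph 2 n => G.edges) ?_
    rintro ⟨e, he⟩ ⟨e', he'⟩ h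
    simp only at h
    subst h; rfl
  refine ((Set.finite_range (fun H : RGraph 2 n => specRad α C5 H)).subset ?_).bddAbove
  rintro y ⟨H, -, rfl⟩
  exact ⟨H, rfl⟩


/-- residue colouring -/
def colm (n : ℕ) (i : Fin n) : Fin 5 := Fin.ofNat 5 i.val

/-- balanced blow-up of the pentagon -/
noncomputable def blow (n : ℕ) : RGraph 2 n where
  edges := Finset.univ.filter fun e => e.card = 2 ∧ e.image (colm n) ∈ C5.edges
  card_eq := by
    intro e he
    exact (Finset.mem_filter.1 he).2.1

theorem blow_col (n : ℕ) : C5Colorable (blow n) :=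
  ⟨colm n, fun _ he => (Finset.mem_filter.1 he).2.2⟩

theorem blow_adj (n : ℕ) (a b : Fin n) (h : colm n b - colm n a = 1 ∨ colm n b - colm n a = 4) :
    adjB (blow n) a b = true := by
  rw [adjB_iff]
  refine Finset.mem_filter.2 ⟨Finset.mem_univ _, ?_, ?_⟩
  · refine Finset.card_pair ?_
    rintro rfl
    rw [sub_self] at h
    revert h; decide
  · rw [Finset.image_insert, Finset.image_singleton]
    exact pair_C5 _ _ h

/-- the ten closed tours of the pentagon -/
def tour (p : Fin 5 × Bool) (i : Fin 5) : Fin 5 := if p.2 then p.1 + i else p.1 - i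

theorem tour_inj : Function.Injective tour := by
  intro p q h
  have h0 := congrFun h 0
  have h1 := congrFun h 1
  clear h
  revert p q
  decide

theorem tour_bij : ∀ p, Function.Injective (tour p) := by
  unfold Function.Injective; decide

theorem tour_adj : ∀ p i, tour p (i + 1) - tour p i = 1 ∨ tour p (i + 1) - tour p i = 4 := by
  decide

/-- class sizes -/
noncomputable def Wc (n : ℕ) (j : Fin 5) : ℝ := ∑ i : Fin n, if colm n i = j then (1 : ℝ) else 0

theorem blow_TT_one (n : ℕ) : 10 * ∏ j, Wc n j ≤ TT (adjB (blow n)) (fun _ => 1) := by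
  unfold TT
  rw [S5_fun]
  have key : ∀ p : Fin 5 × Bool, ∏ j, Wc n j =
      ∑ t : Fin 5 → Fin n, ∏ i, (if colm n (t i) = tour p i then (1 : ℝ) else 0) := by
    intro p
    have hb : Function.Bijective (tour p) := Finite.injective_iff_bijective.1 (tour_bij p)
    rw [← hb.prod_comp]
    unfold Wc
    rw [Finset.prod_univ_sum, Fintype.piFinset_univ]
  have h10 : 10 * ∏ j, Wc n j = ∑ p : Fin 5 × Bool, ∏ j, Wc n j := by
    rw [Finset.sum_const]; simp
  rw [h10, Finset.sum_congr rfl (fun p _ => key p), Finset.sum_comm]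
  refine Finset.sum_le_sum fun t _ => ?_
  simp only [Finset.prod_const_one, one_mul]
  have hprod : ∀ p : Fin 5 × Bool, ∏ i, (if colm n (t i) = tour p i then (1 : ℝ) else 0) =
      if (fun i => colm n (t i)) = tour p then 1 else 0 := by
    intro p
    split_ifs with h
    · exact Finset.prod_eq_one fun i _ => by rw [if_pos (congrFun h i)]
    · have : ∃ i, colm n (t i) ≠ tour p i := by
        by_contra hh
        push Not at hh
        exact h (funext hh)
      obtain ⟨i, hi⟩ := this
      exact Finset.prod_eq_zero (Finset.mem_univ i) (if_neg hi)
  rw [Finset.sum_congr rfl (fun p _ => hprod p)]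
  by_cases hp : ∃ p, (fun i => colm n (t i)) = tour p
  · obtain ⟨p, hp⟩ := hp
    have h1 : ∀ q ∈ (Finset.univ : Finset (Fin 5 × Bool)), q ≠ p →
        (if (fun i => colm n (t i)) = tour q then (1 : ℝ) else 0) = 0 := by
      intro q _ hq
      rw [if_neg]
      intro h
      exact hq (tour_inj (h.symm.trans hp))
    rw [Finset.sum_eq_single p h1 (by simp), if_pos hp, cyF_eq, if_pos]
    have hc : ∀ i, adjB (blow n) (t i) (t (i + 1)) = true := by
      intro i
      apply blow_adj
      have e1 : colm n (t i) = tour p i := congrFun hp i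
      have e2 : colm n (t (i + 1)) = tour p (i + 1) := congrFun hp (i + 1)
      rw [e1, e2]; exact tour_adj p i
    exact ⟨hc 0, hc 1, hc 2, hc 3, hc 4⟩
  · push Not at hp
    rw [Finset.sum_eq_zero fun p _ => if_neg (hp p)]
    exact cyF_nonneg _ _ _ _ _ _

theorem Wc_eq (n : ℕ) (j : Fin 5) :
    Wc n j = ((n / 5 + if (j : ℕ) < n % 5 then 1 else 0 : ℕ) : ℝ) := by
  unfold Wc
  have h1 := Nat.count_modEq_card n (r := 5) (by norm_num) (j : ℕ)
  rw [Nat.mod_eq_of_lt j.isLt] at h1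
  rw [← h1, Nat.count_eq_card_filter_range, Finset.card_filter, Nat.cast_sum,
    ← Fin.sum_univ_eq_sum_range (fun k => (((if k ≡ (j : ℕ) [MOD 5] then 1 else 0 : ℕ)) : ℝ))]
  refine Finset.sum_congr rfl fun i _ => ?_
  have : colm n i = j ↔ (i : ℕ) ≡ (j : ℕ) [MOD 5] := by
    unfold colm Nat.ModEq
    rw [Fin.ext_iff, Fin.val_ofNat, Nat.mod_eq_of_lt j.isLt]
  simp only [this]
  split_ifs <;> simp

theorem prod_Wc (n : ℕ) : (n : ℝ) ^ 5 - 100 * (n : ℝ) ^ 3 ≤ 3125 * ∏ j, Wc n j := by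
  simp only [Wc_eq, Fin.prod_univ_five]
  obtain ⟨q, r, hr, hn⟩ : ∃ q r, r < 5 ∧ n = 5 * q + r := ⟨n / 5, n % 5, by omega, by omega⟩
  have h1 : n / 5 = q := by omega
  have h2 : n % 5 = r := by omega
  rw [h1, h2]
  have hq : (0 : ℝ) ≤ q := Nat.cast_nonneg q
  have hq2 : (0 : ℝ) ≤ (q : ℝ) ^ 2 := by positivity
  have hq3 : (0 : ℝ) ≤ (q : ℝ) ^ 3 := by positivity
  have hq4 : (0 : ℝ) ≤ (q : ℝ) ^ 4 := by positivity
  subst hn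
  interval_cases r <;> simp <;> ring_nf <;> nlinarith

theorem blow_lower (α : ℝ) (hα : 1 < α) (n : ℕ) (hn : 1 ≤ n) :
    2 / 625 * ((n : ℝ) ^ (1 - 1 / α)) ^ 5 * (1 - 100 / (n : ℝ) ^ 2) ≤ specRad α C5 (blow n) := by
  have hn0 : (0 : ℝ) < n := by exact_mod_cast hn
  refine le_trans ?_ (specRad_ge α hα (blow n) _ (const_simplex α hα n hn))
  rw [lagPoly_eq _ (col_trifree _ (blow_col n))]
  set c := (n : ℝ) ^ (-(1 / α)) with hc
  have hc0 : 0 ≤ c := Real.rpow_nonneg hn0.le _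
  have h1 : TT (adjB (blow n)) (fun _ => c) = c ^ 5 * TT (adjB (blow n)) (fun _ => 1) := by
    have := TT_smul (adjB (blow n)) (fun _ => (1 : ℝ)) c
    simpa using this
  have h2 : (n : ℝ) ^ (1 - 1 / α) = n * c := by
    rw [hc, sub_eq_add_neg, Real.rpow_add hn0, Real.rpow_one]
  rw [h1, h2]
  have h3 := blow_TT_one n
  have h4 := prod_Wc n
  have h5 : 2 / 625 * ((n : ℝ) * c) ^ 5 * (1 - 100 / (n : ℝ) ^ 2) =
      c ^ 5 * (2 / 625 * ((n : ℝ) ^ 5 - 100 * (n : ℝ) ^ 3)) := by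
    field_simp
  rw [h5]
  refine mul_le_mul_of_nonneg_left ?_ (by positivity)
  linarith

theorem main_claim {α : ℝ} (hα : 1 < α) : ∃ N0 : ℕ, ∀ n : ℕ, N0 ≤ n → ∀ G : RGraph 2 n,
    Inj K3 G = ∅ → sSup {y | ∃ H : RGraph 2 n, C5Colorable H ∧ y = specRad α C5 H} ≤
      specRad α C5 G → C5Colorable G := by
  obtain ⟨N0, hN1, hN⟩ := analytic_main α hα
  refine ⟨N0, fun n hn G hG hle => ?_⟩
  have hn1 : 1 ≤ n := hN1.trans hn
  obtain ⟨x, hx0, hx1, hxs, hxm⟩ := specRad_attained α hα hn1 G hG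
  have hlow : 2 / 625 * ((n : ℝ) ^ (1 - 1 / α)) ^ 5 * (1 - 100 / (n : ℝ) ^ 2) ≤
      TT (adjB G) x := by
    rw [hxs]
    refine (blow_lower α hα n hn1).trans (le_trans ?_ hle)
    exact le_csSup (specs_bdd α n) ⟨blow n, blow_col n, rfl⟩
  obtain ⟨col, hcol⟩ := hN n hn (adjB G) (adjB_symm G) (adjB_irr G) (adjB_tri G hG) x hx0 hx1
    hxm hlow
  refine ⟨col, fun e he => ?_⟩
  obtain ⟨a, b, -, rfl⟩ := Finset.card_eq_two.1 (G.card_eq e he)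
  rw [Finset.image_insert, Finset.image_singleton]
  exact pair_C5 _ _ (hcol a b ((adjB_iff G a b).2 he))

end final


/-- **Theorem (spectral Erdős pentagon theorem).** -/
theorem spectral_Erdos_pentagon {α : ℝ} (hα : 1 < α) :
    ∃ N0 : ℕ, ∀ n : ℕ, N0 ≤ n → ∀ G : RGraph 2 n, Inj K3 G = ∅ →
      specRad α C5 G ≤
        sSup {y | ∃ H : RGraph 2 n, C5Colorable H ∧ y = specRad α C5 H} ∧
      (specRad α C5 G =
          sSup {y | ∃ H : RGraph 2 n, C5Colorable H ∧ y = specRad α C5 H} →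
        C5Colorable G) := by
  obtain ⟨N0, hN⟩ := main_claim hα
  refine ⟨N0, fun n hn G hG => ⟨?_, fun h => hN n hn G hG h.ge⟩⟩
  by_contra hlt
  push Not at hlt
  exact absurd (le_csSup (specs_bdd α n) ⟨G, hN n hn G hG hlt.le, rfl⟩) (not_le.2 hlt)
end

section
/- Let $q \ge r \ge 2$ be integers, $\alpha > 1$ a real number, $Q$ an $r$-graph on $q$ vertices, $\mathcal{F}$ a family of $r$-graphs with $\hat{\pi} := \hat{\pi}(Q,\mathcal{F}) > 0$, and $\mathfrak{H}$ a hereditary family of $\mathcal{F}$-free $r$-graphs that is $(\alpha, \delta_0, N_0, Q, \mathcal{F})$-balanced in spectral for some $\delta_0 > 0$ and integer $N_0$. Let $\varepsilon \in [0,1]$. Then there exists $N_1 = N_1(\varepsilon)$ such that the following holds for every $n \ge N_1$: if $\mathcal{H}$ is an $\mathcal{F}$-free $r$-graph on vertex set $[n]$ with $\lambda_{\alpha,Q}(\mathcal{H}) \ge \lambda_{\alpha,Q}(n,\mathfrak{H})$ and $\delta_Q(\mathcal{H}) \le (1-\varepsilon) q \hat{\pi}\, n^{q-1}$, and $\mathbf{x}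 = (x_1,\ldots,x_n)$ is a nonnegative vector in $\mathrm{OPT}_{\alpha,Q}(\mathcal{H})$, then there exists a coordinate $i \in [n]$ such that $x_i \le \big(1 - \frac{\hat{\pi}\varepsilon}{(q-1)\alpha}\big) n^{-1/\alpha}$. -/
open scoped Classical
open Finset Filter Real

/-- A family of `r`-graphs: for each number of vertices, a set of `r`-graphs. -/
def Family (r : ℕ) : Type := ∀ n : ℕ, Set (RGraph r n)

/-- `H` is `F`-free: it contains no member of `F` as a subgraph. -/
def FFree {r n : ℕ} (F : Family r) (H : RGraph r n) : Prop :=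
  ∀ m : ℕ, ∀ G ∈ F m, Inj G H = ∅

/-- `inj(n,Q,F)`: the maximum of `inj(Q,H)` over `F`-free `H` on `n` vertices. -/
noncomputable def injNum {r q : ℕ} (Q : RGraph r q) (F : Family r) (n : ℕ) : ℕ :=
  sSup {k | ∃ H : RGraph r n, FFree F H ∧ k = (Inj Q H).card}

/-- `spex_α(n,Q,F)`: the maximum `(α,Q)`-spectral radius of an `F`-free `r`-graph on
`n` vertices. -/
noncomputable def spex (α : ℝ) {r q : ℕ} (Q : RGraph r q) (F : Family r) (n : ℕ) : ℝ :=
  sSup {y | ∃ H : RGraph r n, FFree F H ∧ y = specRad α Q H}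

/-- A family is hereditary if it is closed under taking subgraphs (any `r`-graph which
embeds into a member is a member). -/
def Hereditary {r : ℕ} (HH : Family r) : Prop :=
  ∀ (n m : ℕ) (H : RGraph r n) (G : RGraph r m),
    H ∈ HH n → (Inj G H).Nonempty → G ∈ HH m

/-- `λ_{α,Q}(n, 𝔥)`. -/
noncomputable def famSpec (α : ℝ) {r q : ℕ} (Q : RGraph r q) (HH : Family r) (n : ℕ) : ℝ :=
  sSup {y | ∃ H ∈ HH n, y = specRad α Q H}

/-- The `Q`-degree of a vertex. -/
noncomputable def qDeg {r q n : ℕ} (Q : RGraph r q) (H : RGraph r n) (v : Fin n) : ℕ :=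
  ((Inj Q H).filter fun φ => ∃ u, φ u = v).card

/-- The minimum `Q`-degree. -/
noncomputable def minQDeg {r q n : ℕ} (Q : RGraph r q) (H : RGraph r n) : ℕ :=
  sInf (Set.range (qDeg Q H))

/-- `F` is `(δ, N, Q)`-smooth (relative to a given value `hatpi` of `π̂(Q,F)`). -/
def SmoothFam {r q : ℕ} (Q : RGraph r q) (F : Family r) (hatpi δ : ℝ) (N : ℕ) : Prop :=
  ∀ n : ℕ, N ≤ n →
    |(injNum Q F n : ℝ) - (injNum Q F (n - 1) : ℝ) - q * hatpi * (n : ℝ) ^ (q - 1)|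
      ≤ δ * (n : ℝ) ^ (q - 1)

/-- `F` is `(δ, N, Q)`-degree stable with respect to `HH`. -/
def DegStable {r q : ℕ} (Q : RGraph r q) (F HH : Family r) (hatpi δ : ℝ) (N : ℕ) : Prop :=
  ∀ n : ℕ, N ≤ n → ∀ H : RGraph r n, FFree F H →
    (1 - δ) * q * hatpi * (n : ℝ) ^ (q - 1) ≤ (minQDeg Q H : ℝ) → H ∈ HH n

/-- `HH` is `(α, δ, N, Q, F)`-balanced in spectral. -/
def BalancedSpec (α : ℝ) {r q : ℕ} (Q : RGraph r q) (F HH : Family r) (δ : ℝ) (N : ℕ) :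
    Prop :=
  ∀ n : ℕ, N ≤ n →
    |famSpec α Q HH n - (injNum Q F n : ℝ) / (n : ℝ) ^ ((q : ℝ) / α)|
      ≤ δ * (n : ℝ) ^ ((q : ℝ) - q / α - 1)


lemma inj_bdd {r q n : ℕ} (α : ℝ) (hα : 1 < α) (Q : RGraph r q) (H : RGraph r n) :
    BddAbove (lagPoly Q H '' simplex α n) := by
  refine ⟨(Inj Q H).card, ?_⟩
  rintro _ ⟨x, hx, rfl⟩
  have hx1 : ∀ i, |x i| ≤ 1 := by
    intro i
    by_contra h
    push Not at h
    have h1 : 1 < |x i| ^ α := Real.one_lt_rpow h (by linarith)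
    have h2 : |x i| ^ α ≤ ∑ i, |x i| ^ α :=
      Finset.single_le_sum (f := fun i => |x i| ^ α)
        (fun j _ => Real.rpow_nonneg (abs_nonneg _) _) (Finset.mem_univ i)
    have h3 : ∑ i, |x i| ^ α = 1 := hx
    linarith
  unfold lagPoly
  calc _ ≤ ∑ φ ∈ Inj Q H, (1 : ℝ) := by
        refine Finset.sum_le_sum fun φ _ => ?_
        refine (le_abs_self _).trans ?_
        rw [Finset.abs_prod]
        exact Finset.prod_le_one (fun _ _ => abs_nonneg _) (fun i _ => hx1 i)
    _ = _ := by simp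

lemma prod_image_inj {r q n : ℕ} (Q : RGraph r q) (H : RGraph r n) (x : Fin n → ℝ)
    {φ : Fin q → Fin n} (hφ : φ ∈ Inj Q H) :
    ∏ i ∈ Finset.univ.image φ, x i = ∏ j, x (φ j) := by
  have h : Function.Injective φ := (Finset.mem_filter.1 hφ).2.1
  rw [Finset.prod_image (fun a _ b _ hab => h hab)]

lemma lag_smul {r q n : ℕ} (Q : RGraph r q) (H : RGraph r n) (x : Fin n → ℝ) (s : ℝ) :
    lagPoly Q H (fun i => s * x i) = s ^ q * lagPoly Q H x := by
  unfold lagPoly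
  rw [Finset.mul_sum]
  refine Finset.sum_congr rfl fun φ hφ => ?_
  rw [prod_image_inj Q H _ hφ, prod_image_inj Q H _ hφ, Finset.prod_mul_distrib]
  simp

lemma lag_le {r q n : ℕ} (α : ℝ) (hα : 1 < α) (Q : RGraph r q) (H : RGraph r n)
    (y : Fin n → ℝ) (hy : ∀ i, 0 ≤ y i) (hN : 0 < ∑ i, y i ^ α) :
    lagPoly Q H y ≤ specRad α Q H * (∑ i, y i ^ α) ^ ((q : ℝ) / α) := by
  set N := ∑ i, y i ^ α with hNdef
  have hs : 0 < N ^ (-(1 / α)) := Real.rpow_pos_of_pos hN _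
  have hmem : (fun i => N ^ (-(1 / α)) * y i) ∈ simplex α n := by
    show ∑ i, |N ^ (-(1 / α)) * y i| ^ α = 1
    have : ∀ i, |N ^ (-(1 / α)) * y i| ^ α = N⁻¹ * y i ^ α := by
      intro i
      rw [abs_of_nonneg (mul_nonneg hs.le (hy i)), Real.mul_rpow hs.le (hy i),
        ← Real.rpow_mul hN.le]
      congr 1
      rw [show -(1 / α) * α = -1 by field_simp, Real.rpow_neg_one]
    simp_rw [this]
    rw [← Finset.mul_sum]
    exact inv_mul_cancel₀ hN.ne'
  have h1 : lagPoly Q H (fun i => N ^ (-(1 / α)) * y i) ≤ specRad α Q H :=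
    le_csSup (inj_bdd α hα Q H) ⟨_, hmem, rfl⟩
  rw [lag_smul] at h1
  have h2 : (N ^ (-(1 / α))) ^ q * N ^ ((q : ℝ) / α) = 1 := by
    rw [← Real.rpow_natCast, ← Real.rpow_mul hN.le, ← Real.rpow_add hN]
    rw [show -(1 / α) * (q : ℝ) + q / α = 0 by ring, Real.rpow_zero]
  have h3 := mul_le_mul_of_nonneg_right h1 (Real.rpow_pos_of_pos hN ((q : ℝ) / α)).le
  calc _ = (N ^ (-(1 / α))) ^ q * N ^ ((q : ℝ) / α) * lagPoly Q H y := by rw [h2, one_mul]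
    _ = _ := by ring
    _ ≤ _ := h3

lemma lag_update {r q n : ℕ} (Q : RGraph r q) (H : RGraph r n)
    (x : Fin n → ℝ) (v : Fin n) (u : ℝ) :
    lagPoly Q H (Function.update x v (u * x v)) = lagPoly Q H x -
      (1 - u) * ∑ φ ∈ (Inj Q H).filter (fun φ => ∃ j, φ j = v), ∏ j, x (φ j) := by
  unfold lagPoly
  rw [Finset.sum_filter, Finset.mul_sum, ← Finset.sum_sub_distrib]
  refine Finset.sum_congr rfl fun φ hφ => ?_
  have hinj : Function.Injective φ := (Finset.mem_filter.1 hφ).2.1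
  rw [prod_image_inj Q H _ hφ, prod_image_inj Q H _ hφ]
  split_ifs with h
  · obtain ⟨j, rfl⟩ := h
    rw [← Finset.mul_prod_erase _ _ (Finset.mem_univ j),
      ← Finset.mul_prod_erase _ (fun j => x (φ j)) (Finset.mem_univ j)]
    have : ∏ a ∈ Finset.univ.erase j, Function.update x (φ j) (u * x (φ j)) (φ a)
        = ∏ a ∈ Finset.univ.erase j, x (φ a) := by
      refine Finset.prod_congr rfl fun a ha => ?_
      rw [Function.update_of_ne]
      exact fun hh => (Finset.ne_of_mem_erase ha) (hinj hh)
    rw [this, Function.update_self]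
    ring
  · push Not at h
    have : ∀ j, Function.update x v (u * x v) (φ j) = x (φ j) := fun j =>
      Function.update_of_ne (h j) _ _
    simp [this]

lemma lagrange {r q n : ℕ} (α : ℝ) (hα : 1 < α) (Q : RGraph r q) (H : RGraph r n)
    (x : Fin n → ℝ) (hx : x ∈ OPT α Q H) (h0 : ∀ i, 0 ≤ x i) (v : Fin n) :
    ∑ φ ∈ (Inj Q H).filter (fun φ => ∃ j, φ j = v), ∏ j, x (φ j)
      = q * specRad α Q H * x v ^ α := by
  set D := ∑ φ ∈ (Inj Q H).filter (fun φ => ∃ j, φ j = v), ∏ j, x (φ j) with hD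
  obtain ⟨hx1, hx2⟩ := hx
  have hsum : ∑ i, x i ^ α = 1 := by
    have : ∑ i, |x i| ^ α = 1 := hx1
    simpa [abs_of_nonneg (h0 _)] using this
  set lam := specRad α Q H
  set w := x v ^ α with hw
  let h : ℝ → ℝ := fun u => lam * (1 - w + u ^ α * w) ^ ((q : ℝ) / α) - (lam - (1 - u) * D)
  have hsumu : ∀ u : ℝ, 0 ≤ u →
      ∑ i, (Function.update x v (u * x v)) i ^ α = 1 - w + u ^ α * w := by
    intro u hu
    rw [← Finset.add_sum_erase _ _ (Finset.mem_univ v)]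
    rw [← Finset.add_sum_erase _ _ (Finset.mem_univ v)] at hsum
    have : ∑ i ∈ Finset.univ.erase v, (Function.update x v (u * x v)) i ^ α
        = ∑ i ∈ Finset.univ.erase v, x i ^ α :=
      Finset.sum_congr rfl fun i hi => by
        rw [Function.update_of_ne (Finset.ne_of_mem_erase hi)]
    rw [this, Function.update_self, Real.mul_rpow hu (h0 v)]
    linarith
  have hcont : Tendsto (fun u : ℝ => 1 - w + u ^ α * w) (nhds 1) (nhds (1 - w + 1 ^ α * w)) := by
    apply Tendsto.add tendsto_const_nhds
    apply Tendsto.mul_const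
    exact (Real.continuousAt_rpow_const 1 α (Or.inl one_ne_zero))
  rw [Real.one_rpow, one_mul, sub_add_cancel] at hcont
  have hmin : IsLocalMin h 1 := by
    have e1 := hcont.eventually (lt_mem_nhds (zero_lt_one))
    have e2 : ∀ᶠ u : ℝ in nhds 1, 0 < u := lt_mem_nhds zero_lt_one
    filter_upwards [e1, e2] with u hu1 hu2
    have : h 1 = 0 := by simp [h]
    rw [this]
    have := lag_le α hα Q H (Function.update x v (u * x v)) (by
      intro i
      by_cases hi : i = v
      · subst hi; simpa using mul_nonneg hu2.le (h0 i)
      · rw [Function.update_of_ne hi]; exact h0 i) (by rw [hsumu u hu2.le]; exact hu1)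
    rw [hsumu u hu2.le, lag_update, hx2] at this
    simp only [h]
    linarith
  have hder : HasDerivAt h (lam * (α * w * ((q : ℝ) / α)) - (- (-1 * D))) 1 := by
    have d1 : HasDerivAt (fun u : ℝ => 1 - w + u ^ α * w) (α * w) 1 := by
      have := ((Real.hasDerivAt_rpow_const (x := 1) (p := α) (Or.inl one_ne_zero)).mul_const
        w).const_add (1 - w)
      simpa using this
    have d2 := (d1.rpow_const (p := (q : ℝ) / α) (Or.inl (by simp))).const_mul lam
    have d3 : HasDerivAt (fun u : ℝ => lam - (1 - u) * D) (- (-1 * D)) 1 :=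
      ((((hasDerivAt_id (1 : ℝ)).const_sub 1).mul_const D).const_sub lam)
    have d4 : HasDerivAt h _ 1 := d2.sub d3
    convert d4 using 1
    simp
  have := hmin.hasDerivAt_eq_zero hder
  have e : α * w * ((q : ℝ) / α) = q * w := by field_simp
  rw [e] at this
  linarith

/-- pairs `(u, ψ)` whose extension by `u ↦ v` is an injective homomorphism. -/
noncomputable def pairSet {r k n : ℕ} (Q : RGraph r (k + 1)) (H : RGraph r n) (v : Fin n) :
    Finset (Fin (k + 1) × (Fin k → Fin n)) :=
  Finset.univ.filter fun p => (p.1.insertNth v p.2 : Fin (k + 1) → Fin n) ∈ Inj Q H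

lemma pair_injOn {r k n : ℕ} (Q : RGraph r (k + 1)) (H : RGraph r n) (v : Fin n) :
    Set.InjOn (fun p : Fin (k + 1) × (Fin k → Fin n) =>
      (p.1.insertNth v p.2 : Fin (k + 1) → Fin n)) (pairSet Q H v) := by
  rintro ⟨u, ψ⟩ h1 ⟨u', ψ'⟩ h2 h
  have hm := (Finset.mem_filter.1 (Finset.mem_coe.1 h1)).2
  have hinj : Function.Injective (u.insertNth v ψ : Fin (k + 1) → Fin n) :=
    (Finset.mem_filter.1 hm).2.1
  simp only at h
  have hu : u = u' := by
    apply hinj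
    rw [Fin.insertNth_apply_same, h, Fin.insertNth_apply_same]
  subst hu
  have : ψ = ψ' := by
    funext j
    have := congrFun h (u.succAbove j)
    simpa using this
  rw [this]

lemma pair_image {r k n : ℕ} (Q : RGraph r (k + 1)) (H : RGraph r n) (v : Fin n) :
    (pairSet Q H v).image (fun p : Fin (k + 1) × (Fin k → Fin n) =>
      (p.1.insertNth v p.2 : Fin (k + 1) → Fin n))
      = (Inj Q H).filter (fun φ => ∃ j, φ j = v) := by
  ext φ
  simp only [Finset.mem_image, Finset.mem_filter, pairSet, Finset.mem_univ, true_and]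
  constructor
  · rintro ⟨⟨u, ψ⟩, h, rfl⟩
    exact ⟨h, u, by simp⟩
  · rintro ⟨h, u, hu⟩
    have e : (u.insertNth v (fun j => φ (u.succAbove j)) : Fin (k + 1) → Fin n) = φ := by
      subst hu
      exact Fin.insertNth_self_removeNth u φ
    exact ⟨⟨u, fun j => φ (u.succAbove j)⟩, by simpa only [e] using h, e⟩

lemma pair_card {r k n : ℕ} (Q : RGraph r (k + 1)) (H : RGraph r n) (v : Fin n) :
    (pairSet Q H v).card = qDeg Q H v := by
  unfold qDeg
  rw [← pair_image, Finset.card_image_of_injOn (pair_injOn Q H v)]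

lemma pair_sum {r k n : ℕ} (Q : RGraph r (k + 1)) (H : RGraph r n) (v : Fin n)
    (x : Fin n → ℝ) :
    ∑ φ ∈ (Inj Q H).filter (fun φ => ∃ j, φ j = v), ∏ j, x (φ j)
      = x v * ∑ p ∈ pairSet Q H v, ∏ j, x (p.2 j) := by
  rw [← pair_image, Finset.sum_image (pair_injOn Q H v), Finset.mul_sum]
  refine Finset.sum_congr rfl fun p _ => ?_
  rw [Fin.prod_univ_succAbove _ p.1]
  simp

lemma pair_bound {k n : ℕ} (A : Finset (Fin (k + 1) × (Fin k → Fin n)))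
    (y : Fin n → ℝ) (hy : ∑ i, y i = 1) (m : ℝ) (hm : 0 ≤ m) (hym : ∀ i, m ≤ y i) :
    ∑ p ∈ A, ∏ j, y (p.2 j) ≤
      ((k : ℝ) + 1) - (((k : ℝ) + 1) * (n : ℝ) ^ k - A.card) * m ^ k := by
  have htot : ∑ p : Fin (k + 1) × (Fin k → Fin n), ∏ j, y (p.2 j) = (k : ℝ) + 1 := by
    rw [Fintype.sum_prod_type]
    simp only
    rw [← Fintype.sum_pow, hy]
    simp
  have hc : ((Aᶜ).card : ℝ) = ((k : ℝ) + 1) * (n : ℝ) ^ k - A.card := by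
    have := Finset.card_add_card_compl A
    have h2 : ((A.card + (Aᶜ).card : ℕ) : ℝ) = ((k : ℝ) + 1) * (n : ℝ) ^ k := by
      rw [this]; simp
    push_cast at h2
    linarith
  have hlow : (Aᶜ).card * m ^ k ≤ ∑ p ∈ Aᶜ, ∏ j, y (p.2 j) := by
    rw [← nsmul_eq_mul]
    apply Finset.card_nsmul_le_sum
    intro p _
    calc m ^ k = ∏ j : Fin k, m := by simp
      _ ≤ _ := Finset.prod_le_prod (fun _ _ => hm) (fun j _ => hym _)
  have := Finset.sum_add_sum_compl A (fun p => ∏ j, y (p.2 j))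
  rw [hc] at hlow
  linarith

lemma injNum_le {r q : ℕ} (Q : RGraph r q) (F : Family r) (n : ℕ) : injNum Q F n ≤ n ^ q := by
  unfold injNum
  apply csSup_le'
  rintro k ⟨H, -, rfl⟩
  calc _ ≤ (Finset.univ : Finset (Fin q → Fin n)).card := Finset.card_le_card (Finset.subset_univ _)
    _ = _ := by simp

/-- The strict inequality between constants. -/
lemma const_ineq {k : ℕ} (hk : 1 ≤ k) {α : ℝ} (hα : 1 < α) {P ε : ℝ} (hP : 0 < P) (hP1 : P ≤ 1)
    (he : 0 < ε) (he1 : ε ≤ 1) :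
    0 < 1 - P * ε / (k * α) ∧ 1 - P * ε ≤ ((1 - P * ε / (k * α)) ^ α) ^ k ∧
    ((1 - ε) * P) ^ (α - 1) * (P * (1 - (1 - ε) * P * ε)) <
      P ^ α * (1 - P * ε / (k * α)) ^ (α * (α - 1)) := by
  have hk' : (1 : ℝ) ≤ k := by exact_mod_cast hk
  have hka : 1 < k * α := by nlinarith
  have hPe : P * ε ≤ 1 := by nlinarith
  have hPe0 : 0 < P * ε := by positivity
  set c := P * ε / (k * α) with hc
  have hc1 : c < 1 := by rw [hc, div_lt_one (by linarith)]; linarith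
  have hc0 : 0 < c := by rw [hc]; positivity
  have h1 : 0 < 1 - c := by linarith
  have h2 : 1 - P * ε ≤ ((1 - c) ^ α) ^ k := by
    rw [← Real.rpow_natCast, ← Real.rpow_mul h1.le]
    have := one_add_mul_self_le_rpow_one_add (s := -c) (by linarith) (p := α * k) (by linarith)
    have e : 1 + α * k * -c = 1 - P * ε := by rw [hc]; field_simp; ring
    rw [e] at this
    simpa [sub_eq_add_neg] using this
  refine ⟨h1, h2, ?_⟩
  rcases eq_or_lt_of_le he1 with rfl | he1
  · rw [sub_self, zero_mul, Real.zero_rpow (by linarith), zero_mul]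
    positivity
  · have hb : 0 < (1 - ε) * P := mul_pos (by linarith) hP
    have h3 : 1 - ε ≤ (1 - c) ^ α := by
      have h4 : ((1 - c) ^ α) ^ k ≤ ((1 - c) ^ α) ^ 1 :=
        pow_le_pow_of_le_one (by positivity)
          (Real.rpow_le_one h1.le (by linarith) (by linarith)) hk
      rw [pow_one] at h4
      nlinarith
    have h5 : (1 - ε) ^ (α - 1) ≤ (1 - c) ^ (α * (α - 1)) := by
      rw [Real.rpow_mul h1.le]
      exact Real.rpow_le_rpow (by linarith) h3 (by linarith)
    have h6 : P ^ α = P ^ (α - 1) * P := by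
      rw [← Real.rpow_add_one hP.ne']; simp
    have hb2 : 0 < (1 - ε) ^ (α - 1) := Real.rpow_pos_of_pos (by linarith) _
    have hP2 : 0 < P ^ (α - 1) := Real.rpow_pos_of_pos hP _
    rw [h6, Real.mul_rpow (by linarith) hP.le]
    calc _ < (1 - ε) ^ (α - 1) * P ^ (α - 1) * (P * 1) := by
          apply mul_lt_mul_of_pos_left _ (by positivity)
          apply mul_lt_mul_of_pos_left _ hP
          have := mul_pos hb he
          linarith
      _ = P ^ (α - 1) * P * (1 - ε) ^ (α - 1) := by ring
      _ ≤ _ := mul_le_mul_of_nonneg_left h5 (by positivity)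

/-- **Lemma (minimum degree and small weight):** if an `F`-free `H` has spectral radius
at least `λ_{α,Q}(n,𝔥)` but small minimum `Q`-degree, then any nonnegative optimal
vector has a small coordinate. -/
theorem min_degree_small_weight {r q : ℕ} (hr : 2 ≤ r) (hrq : r ≤ q)
    {α : ℝ} (hα : 1 < α)
    (Q : RGraph r q) (F HH : Family r) (hatpi : ℝ)
    (hlim : Tendsto (fun n : ℕ => (injNum Q F n : ℝ) / (n : ℝ) ^ q) atTop (nhds hatpi))
    (hpi : 0 < hatpi)
    (hfree : ∀ n : ℕ, ∀ H ∈ HH n, FFree F H)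
    (hher : Hereditary HH)
    (δ0 : ℝ) (hδ0 : 0 < δ0) (N0 : ℕ) (hbal : BalancedSpec α Q F HH δ0 N0)
    (ε : ℝ) (hε : ε ∈ Set.Icc (0 : ℝ) 1) :
    ∃ N1 : ℕ, ∀ n : ℕ, N1 ≤ n → ∀ H : RGraph r n, FFree F H →
      famSpec α Q HH n ≤ specRad α Q H →
      (minQDeg Q H : ℝ) ≤ (1 - ε) * q * hatpi * (n : ℝ) ^ (q - 1) →
      ∀ x ∈ OPT α Q H, (∀ i, 0 ≤ x i) →
        ∃ i : Fin n,
          x i ≤ (1 - hatpi * ε / (((q : ℝ) - 1) * α)) * (n : ℝ) ^ (-(1 : ℝ) / α) := by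
  obtain ⟨k, rfl⟩ : ∃ k, q = k + 1 := ⟨q - 1, by omega⟩
  have hk : 1 ≤ k := by omega
  have hα0 : 0 < α := by linarith
  have hP1 : hatpi ≤ 1 := by
    refine le_of_tendsto' hlim fun n => ?_
    apply div_le_one_of_le₀ _ (by positivity)
    exact_mod_cast injNum_le Q F n
  obtain ⟨he0, he1⟩ := hε
  have hkc : (((k + 1 : ℕ) : ℝ) - 1) = k := by push_cast; ring
  simp only [hkc, Nat.add_sub_cancel]
  rcases eq_or_lt_of_le he0 with rfl | he0
  · refine ⟨1, fun n hn H _ _ _ x hx hx0 => ?_⟩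
    by_contra hcon
    push Not at hcon
    have hn0 : (0 : ℝ) < n := by exact_mod_cast hn
    have hsum : ∑ i, |x i| ^ α = 1 := hx.1
    have hlt : ∀ i, (n : ℝ)⁻¹ < |x i| ^ α := by
      intro i
      have h1 := hcon i
      simp only [mul_zero, zero_div, sub_zero, one_mul] at h1
      rw [abs_of_nonneg (hx0 i)]
      have h2 := Real.rpow_lt_rpow (by positivity) h1 hα0
      rwa [← Real.rpow_mul hn0.le, show -1 / α * α = -1 by field_simp, Real.rpow_neg_one] at h2
    have : ∑ i : Fin n, (n : ℝ)⁻¹ < ∑ i, |x i| ^ α :=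
      Finset.sum_lt_sum_of_nonempty ⟨⟨0, hn⟩, Finset.mem_univ _⟩ (fun i _ => hlt i)
    rw [hsum] at this
    simp [hn0.ne'] at this
  obtain ⟨hc0, hck, hconst⟩ := const_ineq hk hα hpi hP1 he0 he1
  set c := hatpi * ε / (k * α) with hc
  have hL : Tendsto (fun n : ℕ => (injNum Q F n : ℝ) / (n : ℝ) ^ (k + 1) - δ0 * (n : ℝ)⁻¹) atTop
      (nhds hatpi) := by
    have := hlim.sub (tendsto_inv_atTop_nhds_zero_nat.const_mul δ0)
    simpa using this
  have hL2 : Tendsto (fun n : ℕ => ((injNum Q F n : ℝ) / (n : ℝ) ^ (k + 1) - δ0 * (n : ℝ)⁻¹) ^ α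
      * (1 - c) ^ (α * (α - 1))) atTop
      (nhds (hatpi ^ α * (1 - c) ^ (α * (α - 1)))) :=
    (hL.rpow_const (Or.inl hpi.ne')).mul_const _
  have ev := ((hL.eventually (lt_mem_nhds hpi)).and
    (hL2.eventually (lt_mem_nhds hconst))).and ((eventually_ge_atTop N0).and
      (eventually_ge_atTop 1))
  obtain ⟨N1, hN1⟩ := eventually_atTop.1 ev
  refine ⟨N1, fun n hn H _ hfam hdeg x hx hx0 => ?_⟩
  obtain ⟨⟨hLpos, hLc⟩, hnN0, hn1⟩ := hN1 n hn
  have hn0 : (0 : ℝ) < n := by exact_mod_cast hn1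
  set L := (injNum Q F n : ℝ) / (n : ℝ) ^ (k + 1) - δ0 * (n : ℝ)⁻¹ with hLdef
  set lam := specRad α Q H with hlam
  -- lower bound on the spectral radius
  have hlow : L * (n : ℝ) ^ (((k + 1 : ℕ) : ℝ) - ((k + 1 : ℕ) : ℝ) / α) ≤ lam := by
    have h1 := (abs_le.1 (hbal n hnN0)).1
    refine le_trans ?_ hfam
    have h2 : L * (n : ℝ) ^ (((k + 1 : ℕ) : ℝ) - ((k + 1 : ℕ) : ℝ) / α)
        = (injNum Q F n : ℝ) / (n : ℝ) ^ (((k + 1 : ℕ) : ℝ) / α)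
          - δ0 * (n : ℝ) ^ (((k + 1 : ℕ) : ℝ) - ((k + 1 : ℕ) : ℝ) / α - 1) := by
      rw [Real.rpow_sub_one hn0.ne', Real.rpow_sub hn0, Real.rpow_natCast, hLdef]
      have := (Real.rpow_pos_of_pos hn0 (((k + 1 : ℕ) : ℝ) / α)).ne'
      field_simp
    linarith
  have hlampos : 0 < lam := lt_of_lt_of_le (by positivity) hlow
  by_contra hcon
  push Not at hcon
  have hs0 : 0 < (1 - c) * (n : ℝ) ^ (-1 / α) := by positivity
  have hxpos : ∀ i, 0 < x i := fun i => hs0.trans (hcon i)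
  have hsum : ∑ i, x i ^ α = 1 := by
    have : ∑ i, |x i| ^ α = 1 := hx.1
    simpa [abs_of_nonneg (hx0 _)] using this
  -- the vertex of minimum degree
  obtain ⟨v, hv⟩ : minQDeg Q H ∈ Set.range (qDeg Q H) :=
    Nat.sInf_mem ⟨_, ⟨⟨0, hn1⟩, rfl⟩⟩
  rw [← hv, ← pair_card] at hdeg
  set A := pairSet Q H v with hA
  set S := ∑ p ∈ A, ∏ j, x (p.2 j) with hS
  have hSeq : S = ((k : ℝ) + 1) * lam * x v ^ (α - 1) := by
    have h1 := lagrange α hα Q H x hx hx0 v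
    rw [pair_sum] at h1
    apply mul_left_cancel₀ (hxpos v).ne'
    rw [hS, hA, h1, Real.rpow_sub_one (hxpos v).ne']
    have := (hxpos v).ne'
    push_cast
    field_simp
    rw [hlam, mul_comm]
  set β := (1 - ε) * hatpi with hβ
  have hβ0 : 0 ≤ β := mul_nonneg (by linarith) hpi.le
  have hAcard : (A.card : ℝ) ≤ ((k : ℝ) + 1) * β * (n : ℝ) ^ k := by
    refine hdeg.trans (le_of_eq ?_)
    rw [hβ]; push_cast; ring
  -- Hoelder
  have hHol : S ^ α ≤ (A.card : ℝ) ^ (α - 1) * ∑ p ∈ A, ∏ j, x (p.2 j) ^ α := by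
    have := Real.rpow_sum_le_const_mul_sum_rpow_of_nonneg A (f := fun p => ∏ j, x (p.2 j))
      hα.le (fun p _ => Finset.prod_nonneg fun j _ => hx0 _)
    refine this.trans (le_of_eq ?_)
    congr 1
    refine Finset.sum_congr rfl fun p _ => ?_
    rw [← Real.finsetProd_rpow _ _ (fun j _ => hx0 _)]
  have hm : ∀ i, (1 - c) ^ α * (n : ℝ)⁻¹ ≤ x i ^ α := by
    intro i
    have h2 := Real.rpow_le_rpow hs0.le (hcon i).le hα0.le
    rwa [Real.mul_rpow hc0.le (by positivity), ← Real.rpow_mul hn0.le,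
      show -1 / α * α = -1 by field_simp, Real.rpow_neg_one] at h2
  have hT : ∑ p ∈ A, ∏ j, x (p.2 j) ^ α ≤ ((k : ℝ) + 1) * (hatpi * (1 - β * ε)) := by
    have h1 := pair_bound A (fun i => x i ^ α) hsum _ (by positivity) hm
    refine h1.trans ?_
    have hβ1 : β ≤ 1 := by nlinarith
    have hnk : (0 : ℝ) < (n : ℝ) ^ k := by positivity
    have h3 : ((1 - c) ^ α * (n : ℝ)⁻¹) ^ k * (n : ℝ) ^ k = ((1 - c) ^ α) ^ k := by
      rw [mul_pow, mul_assoc, ← mul_pow, inv_mul_cancel₀ hn0.ne', one_pow, mul_one]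
    have h4 : ((k : ℝ) + 1) * (1 - β) * (n : ℝ) ^ k
        ≤ ((k : ℝ) + 1) * (n : ℝ) ^ k - A.card := by
      have : ((k : ℝ) + 1) * (1 - β) * (n : ℝ) ^ k
        = ((k : ℝ) + 1) * (n : ℝ) ^ k - ((k : ℝ) + 1) * β * (n : ℝ) ^ k := by ring
      linarith
    have h5 := mul_le_mul_of_nonneg_right h4
      (show 0 ≤ ((1 - c) ^ α * (n : ℝ)⁻¹) ^ k by positivity)
    have h6 : ((k : ℝ) + 1) * (1 - β) * (n : ℝ) ^ k * ((1 - c) ^ α * (n : ℝ)⁻¹) ^ k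
        = ((k : ℝ) + 1) * (1 - β) * ((1 - c) ^ α) ^ k := by rw [← h3]; ring
    have h7 : ((k : ℝ) + 1) * (1 - β) * (1 - hatpi * ε)
        ≤ ((k : ℝ) + 1) * (1 - β) * ((1 - c) ^ α) ^ k :=
      mul_le_mul_of_nonneg_left hck (mul_nonneg (by positivity) (by linarith))
    have h8 : ((k : ℝ) + 1) * (hatpi * (1 - β * ε))
        = ((k : ℝ) + 1) - ((k : ℝ) + 1) * (1 - β) * (1 - hatpi * ε) := by
      rw [hβ]; ring
    linarith
  have hone : 0 ≤ 1 - β * ε := by nlinarith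
  have hup : S ^ α ≤ (((k : ℝ) + 1) * β * (n : ℝ) ^ k) ^ (α - 1)
      * (((k : ℝ) + 1) * (hatpi * (1 - β * ε))) := by
    refine hHol.trans ?_
    apply mul_le_mul _ hT
    · exact Finset.sum_nonneg fun p _ => Finset.prod_nonneg fun j _ => Real.rpow_nonneg (hx0 _) _
    · positivity
    · exact Real.rpow_le_rpow (by positivity) hAcard (by linarith)
  have hlow2 : ((k : ℝ) + 1) * (L * (n : ℝ) ^ (((k + 1 : ℕ) : ℝ) - ((k + 1 : ℕ) : ℝ) / α))
      * ((1 - c) * (n : ℝ) ^ (-1 / α)) ^ (α - 1) ≤ S := by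
    rw [hSeq]
    apply mul_le_mul
    · exact mul_le_mul_of_nonneg_left hlow (by positivity)
    · exact Real.rpow_le_rpow hs0.le (hcon v).le (by linarith)
    · positivity
    · positivity
  have hlow3 := (Real.rpow_le_rpow (by positivity) hlow2 hα0.le).trans hup
  have hK : (0 : ℝ) < (k : ℝ) + 1 := by positivity
  have hK1 : ((k : ℝ) + 1) ^ α = ((k : ℝ) + 1) ^ (α - 1) * ((k : ℝ) + 1) := by
    rw [← Real.rpow_add_one hK.ne']; simp
  have eL : (((k : ℝ) + 1) * (L * (n : ℝ) ^ (((k + 1 : ℕ) : ℝ) - ((k + 1 : ℕ) : ℝ) / α))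
      * ((1 - c) * (n : ℝ) ^ (-1 / α)) ^ (α - 1)) ^ α
      = ((k : ℝ) + 1) ^ α * (n : ℝ) ^ ((k : ℝ) * (α - 1)) * (L ^ α * (1 - c) ^ (α * (α - 1))) := by
    have hp : (0 : ℝ) ≤ (n : ℝ) ^ (((k + 1 : ℕ) : ℝ) - ((k + 1 : ℕ) : ℝ) / α) := by positivity
    have hp2 : (0 : ℝ) ≤ (n : ℝ) ^ (-1 / α) := by positivity
    rw [Real.mul_rpow (by positivity) (by positivity), Real.mul_rpow hK.le (by positivity),
      Real.mul_rpow hLpos.le hp, ← Real.rpow_mul hs0.le, Real.mul_rpow hc0.le hp2,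
      ← Real.rpow_mul hn0.le, ← Real.rpow_mul hn0.le]
    have : (n : ℝ) ^ ((k : ℝ) * (α - 1)) =
        (n : ℝ) ^ ((((k + 1 : ℕ) : ℝ) - ((k + 1 : ℕ) : ℝ) / α) * α)
          * (n : ℝ) ^ (-1 / α * ((α - 1) * α)) := by
      rw [← Real.rpow_add hn0]
      congr 1
      push_cast
      field_simp
      ring
    rw [this, mul_comm (α - 1) α]
    ring
  have eR : (((k : ℝ) + 1) * β * (n : ℝ) ^ k) ^ (α - 1)
      * (((k : ℝ) + 1) * (hatpi * (1 - β * ε)))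
      = ((k : ℝ) + 1) ^ α * (n : ℝ) ^ ((k : ℝ) * (α - 1))
        * (β ^ (α - 1) * (hatpi * (1 - β * ε))) := by
    rw [Real.mul_rpow (by positivity) (by positivity), Real.mul_rpow hK.le hβ0,
      ← Real.rpow_natCast, ← Real.rpow_mul hn0.le, hK1]
    ring
  rw [eL, eR] at hlow3
  have := le_of_mul_le_mul_left hlow3 (by positivity)
  linarith
end

section
/- Let $q \ge r \ge 2$ be integers, $\alpha > 1$ a real number, $Q$ an $r$-graph on $q$ vertices, $\mathcal{F}$ a family of $r$-graphs with $\hat{\pi} := \hat{\pi}(Q,\mathcal{F}) > 0$, and $\mathfrak{H}$ a hereditary family of $\mathcal{F}$-free $r$-graphs. Let $\delta \in (0,1)$, let $N$ be an integer, and let $\xi$ be a constant with $0 < \xi < \frac{q(\alpha-1)\hat{\pi}\delta}{4\alpha}$. Suppose $\mathcal{F}$ is $(\xi/5, N, Q)$-smooth and $\mathfrak{H}$ is $(\alpha, \xi/5, N, Q, \mathcal{F})$-balanced in spectral. Then there exists $N_1 = N_1(\delta, N)$ such that for every $n \ge N_1$ the following holds: if $\mathcal{H}$ is an $\mathcal{F}$-free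 $r$-graph on vertex set $[n]$ with $\lambda_{\alpha,Q}(\mathcal{H}) \ge \lambda_{\alpha,Q}(n,\mathfrak{H})$, and $\mathbf{x} = (x_1,\ldots,x_n)$ is a nonnegative vector in $\mathrm{OPT}_{\alpha,Q}(\mathcal{H})$ with some coordinate $x_i \le (1-\delta)n^{-1/\alpha}$, then $\lambda_{\alpha,Q}(\mathcal{H} - i) > \lambda_{\alpha,Q}(n-1, \mathfrak{H})$. -/
open scoped Classical
open Finset Filter Real

/-- The induced subgraph `H - i` obtained by deleting the vertex `i`, with the remaining
vertices relabelled by the order-preserving bijection `Fin.succAbove i`. -/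
def delVertex {r n : ℕ} (H : RGraph r (n + 1)) (i : Fin (n + 1)) : RGraph r n where
  edges := Finset.univ.filter fun e : Finset (Fin n) => e.image i.succAbove ∈ H.edges
  card_eq := by
    intro e he
    rw [Finset.mem_filter] at he
    have h := H.card_eq _ he.2
    rwa [Finset.card_image_of_injective _ Fin.succAbove_right_injective] at h

lemma aux_prod {r q n : ℕ} (Q : RGraph r q) (H : RGraph r n) (x : Fin n → ℝ) :
    lagPoly Q H x = ∑ φ ∈ Inj Q H, ∏ u, x (φ u) := by
  unfold lagPoly
  refine Finset.sum_congr rfl fun φ hφ => ?_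
  have h : Function.Injective φ := by
    simp only [Inj, Finset.mem_filter] at hφ
    exact hφ.2.1
  rw [Finset.prod_image (fun a _ b _ hab => h hab)]

lemma aux_smul {r q n : ℕ} (Q : RGraph r q) (H : RGraph r n) (x : Fin n → ℝ) (c : ℝ) :
    lagPoly Q H (fun i => c * x i) = c ^ q * lagPoly Q H x := by
  rw [aux_prod, aux_prod, Finset.mul_sum]
  refine Finset.sum_congr rfl fun φ _ => ?_
  rw [Finset.prod_mul_distrib]
  simp

lemma aux_bdd {r q n : ℕ} {α : ℝ} (hα : 0 < α) (Q : RGraph r q) (H : RGraph r n) :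
    BddAbove (lagPoly Q H '' simplex α n) := by
  refine ⟨(Inj Q H).card, ?_⟩
  rintro _ ⟨x, hx, rfl⟩
  have hle : ∀ i, |x i| ≤ 1 := by
    intro i
    by_contra hcon
    push Not at hcon
    have h1 := Real.one_lt_rpow hcon hα
    have h2 : |x i| ^ α ≤ ∑ i, |x i| ^ α :=
      Finset.single_le_sum (f := fun i => |x i| ^ α) (fun j _ => by positivity)
        (Finset.mem_univ i)
    have h3 : ∑ i, |x i| ^ α = 1 := hx
    linarith
  rw [aux_prod]
  calc ∑ φ ∈ Inj Q H, ∏ u, x (φ u) ≤ ∑ φ ∈ Inj Q H, (1 : ℝ) := by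
        refine Finset.sum_le_sum fun φ _ => ?_
        refine (le_abs_self _).trans ?_
        rw [Finset.abs_prod]
        exact Finset.prod_le_one (fun _ _ => abs_nonneg _) (fun u _ => hle _)
    _ = _ := by simp

lemma aux_le {r q n : ℕ} {α : ℝ} (hα : 0 < α) (Q : RGraph r q) (H : RGraph r n)
    (z : Fin n → ℝ) (hz : ∀ j, 0 ≤ z j) (hS : 0 < ∑ j, z j ^ α) :
    lagPoly Q H z ≤ specRad α Q H * (∑ j, z j ^ α) ^ ((q : ℝ) / α) := by
  set S := ∑ j, z j ^ α with hSdef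
  set c : ℝ := S ^ (1 / α) with hc
  have hcpos : 0 < c := Real.rpow_pos_of_pos hS _
  have hcα : c ^ α = S := by
    rw [hc, ← Real.rpow_mul hS.le, one_div_mul_cancel hα.ne', Real.rpow_one]
  have hcq : c ^ q = S ^ ((q : ℝ) / α) := by
    rw [hc, ← Real.rpow_natCast, ← Real.rpow_mul hS.le]
    congr 1
    ring
  have hmem : (fun j => c⁻¹ * z j) ∈ simplex α n := by
    show ∑ j, |c⁻¹ * z j| ^ α = 1
    have : ∀ j, |c⁻¹ * z j| ^ α = S⁻¹ * z j ^ α := by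
      intro j
      rw [abs_of_nonneg (mul_nonneg (inv_nonneg.2 hcpos.le) (hz j)),
        Real.mul_rpow (inv_nonneg.2 hcpos.le) (hz j), Real.inv_rpow hcpos.le, hcα]
    simp_rw [this]
    rw [← Finset.mul_sum, ← hSdef, inv_mul_cancel₀ hS.ne']
  have h1 : lagPoly Q H (fun j => c⁻¹ * z j) ≤ specRad α Q H :=
    le_csSup (aux_bdd hα Q H) ⟨_, hmem, rfl⟩
  rw [aux_smul, inv_pow, hcq] at h1
  have hp : 0 < S ^ ((q : ℝ) / α) := Real.rpow_pos_of_pos hS _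
  rwa [inv_mul_le_iff₀ hp, mul_comm] at h1

lemma aux_del {r q n : ℕ} (Q : RGraph r q) (H : RGraph r (n + 1)) (i : Fin (n + 1))
    (x : Fin (n + 1) → ℝ) :
    lagPoly Q (delVertex H i) (fun j => x (i.succAbove j)) =
      ∑ φ ∈ (Inj Q H).filter (fun φ => ¬ ∃ u, φ u = i), ∏ u, x (φ u) := by
  rw [aux_prod]
  have himg : (Inj Q H).filter (fun φ => ¬ ∃ u, φ u = i) =
      (Inj Q (delVertex H i)).image (fun φ u => i.succAbove (φ u)) := by
    ext φ
    simp only [Inj, delVertex, Finset.mem_filter, Finset.mem_univ, true_and, Finset.mem_image,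
      Finset.image_image]
    constructor
    · rintro ⟨⟨hinj, hed⟩, hne⟩
      push Not at hne
      choose ψ hψ using fun u => Fin.exists_succAbove_eq (hne u)
      have hfe : φ = i.succAbove ∘ ψ := by
        funext u
        exact (hψ u).symm
      refine ⟨ψ, ⟨?_, ?_⟩, hfe.symm⟩
      · intro a b hab
        apply hinj
        rw [← hψ a, ← hψ b, hab]
      · intro e he
        rw [← hfe]
        exact hed e he
    · rintro ⟨ψ, ⟨hinj, hed⟩, rfl⟩
      refine ⟨⟨?_, ?_⟩, ?_⟩
      · intro a b hab
        exact hinj (Fin.succAbove_right_injective hab)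
      · intro e he
        exact hed e he
      · rintro ⟨u, hu⟩
        exact Fin.succAbove_ne i _ hu
  rw [himg, Finset.sum_image]
  intro a _ b _ hab
  funext u
  exact Fin.succAbove_right_injective (congrFun hab u)

/-- Splitting the polynomial after scaling one coordinate. -/
lemma aux_split {r q n : ℕ} (Q : RGraph r q) (H : RGraph r (n + 1)) (i : Fin (n + 1))
    (x : Fin (n + 1) → ℝ) (s : ℝ) :
    lagPoly Q H (Function.update x i (s * x i)) =
      lagPoly Q (delVertex H i) (fun j => x (i.succAbove j)) +
      s * ∑ φ ∈ (Inj Q H).filter (fun φ => ∃ u, φ u = i), ∏ u, x (φ u) := by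
  rw [aux_del, aux_prod, ← Finset.sum_filter_add_sum_filter_not _ (fun φ => ∃ u, φ u = i),
    add_comm, Finset.mul_sum]
  congr 1
  · refine Finset.sum_congr rfl fun φ hφ => Finset.prod_congr rfl fun u _ => ?_
    have hne := (Finset.mem_filter.1 hφ).2
    push Not at hne
    rw [Function.update_of_ne (hne u)]
  · refine Finset.sum_congr rfl fun φ hφ => ?_
    obtain ⟨hφ1, u, hu⟩ := Finset.mem_filter.1 hφ
    have hinj : Function.Injective φ := by
      simp only [Inj, Finset.mem_filter] at hφ1
      exact hφ1.2.1
    rw [← Finset.mul_prod_erase _ _ (Finset.mem_univ u),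
      ← Finset.mul_prod_erase _ (fun u => x (φ u)) (Finset.mem_univ u), hu,
      Function.update_self, mul_assoc]
    congr 2
    refine Finset.prod_congr rfl fun v hv => ?_
    rw [Function.update_of_ne]
    intro h
    exact (Finset.ne_of_mem_erase hv) (hinj (h.trans hu.symm))

lemma aux_kkt {r q n : ℕ} {α : ℝ} (hα : 1 < α) (Q : RGraph r q) (H : RGraph r (n + 1))
    (i : Fin (n + 1)) (x : Fin (n + 1) → ℝ) (hx : x ∈ OPT α Q H) (hx0 : ∀ j, 0 ≤ x j) :
    lagPoly Q (delVertex H i) (fun j => x (i.succAbove j)) =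
      specRad α Q H * (1 - q * x i ^ α) := by
  obtain ⟨hxs, hxo⟩ := hx
  have hα0 : 0 < α := by linarith
  set A := lagPoly Q (delVertex H i) (fun j => x (i.succAbove j)) with hA
  set B := ∑ φ ∈ (Inj Q H).filter (fun φ => ∃ u, φ u = i), ∏ u, x (φ u) with hB
  set l := specRad α Q H with hl
  set t := x i ^ α with ht
  have ht0 : 0 ≤ t := Real.rpow_nonneg (hx0 i) _
  have hsum : t + ∑ j, x (i.succAbove j) ^ α = 1 := by
    have h : ∑ j, |x j| ^ α = 1 := hxs
    simp_rw [fun j => abs_of_nonneg (hx0 j)] at h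
    rwa [Fin.sum_univ_succAbove _ i] at h
  have hrest : 0 ≤ ∑ j, x (i.succAbove j) ^ α :=
    Finset.sum_nonneg fun j _ => Real.rpow_nonneg (hx0 _) _
  have hAB : A + B = l := by
    have h := aux_split Q H i x 1
    rw [one_mul, Function.update_eq_self, one_mul, hxo] at h
    exact h.symm
  have hkey : ∀ s : ℝ, 0 < s → A + s * B ≤ l * (1 - t + s ^ α * t) ^ ((q : ℝ) / α) := by
    intro s hs
    have hSe : ∑ j, (Function.update x i (s * x i)) j ^ α = 1 - t + s ^ α * t := by
      rw [Fin.sum_univ_succAbove _ i, Function.update_self, Real.mul_rpow hs.le (hx0 i)]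
      simp only [Function.update_of_ne (Fin.succAbove_ne i _)]
      linarith
    have hSp : 0 < 1 - t + s ^ α * t := by
      have hsp : 0 < s ^ α := Real.rpow_pos_of_pos hs _
      rcases ht0.eq_or_lt with h | h
      · rw [← h]; norm_num
      · have := mul_pos hsp h
        linarith
    have h := aux_le hα0 Q H (Function.update x i (s * x i)) (by
      intro j
      by_cases hj : j = i
      · subst hj
        rw [Function.update_self]
        exact mul_nonneg hs.le (hx0 _)
      · rw [Function.update_of_ne hj]
        exact hx0 j) (by rw [hSe]; exact hSp)
    rw [hSe, aux_split] at h
    exact h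
  have hmin : IsLocalMin
      (fun s : ℝ => l * (1 - t + s ^ α * t) ^ ((q : ℝ) / α) - (A + s * B)) 1 := by
    have : ∀ᶠ s : ℝ in nhds 1, 0 < s := lt_mem_nhds one_pos
    filter_upwards [this] with s hs
    have := hkey s hs
    have e : l * (1 - t + (1 : ℝ) ^ α * t) ^ ((q : ℝ) / α) - (A + 1 * B) = 0 := by
      rw [Real.one_rpow, one_mul, sub_add_cancel, Real.one_rpow]
      linarith
    show l * (1 - t + (1 : ℝ) ^ α * t) ^ ((q : ℝ) / α) - (A + 1 * B) ≤
      l * (1 - t + s ^ α * t) ^ ((q : ℝ) / α) - (A + s * B)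
    rw [e]
    linarith
  have hd : HasDerivAt
      (fun s : ℝ => l * (1 - t + s ^ α * t) ^ ((q : ℝ) / α) - (A + s * B))
      (l * ((α * t) * ((q : ℝ) / α)) - B) 1 := by
    have h1 : HasDerivAt (fun s : ℝ => s ^ α) α 1 := by
      have := Real.hasDerivAt_rpow_const (x := 1) (p := α) (Or.inl one_ne_zero)
      simpa using this
    have h2 : HasDerivAt (fun s : ℝ => 1 - t + s ^ α * t) (α * t) 1 :=
      (h1.mul_const t).const_add (1 - t)
    have h3 := h2.rpow_const (p := (q : ℝ) / α) (Or.inl (by simp))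
    have h4 : HasDerivAt (fun s : ℝ => A + s * B) B 1 := by
      simpa using ((hasDerivAt_id (1 : ℝ)).mul_const B).const_add A
    have h5 := (h3.const_mul l).sub h4
    have e : l * ((α * t) * ((q : ℝ) / α)) - B = l * (α * t * ((q : ℝ) / α) *
        (1 - t + (1 : ℝ) ^ α * t) ^ ((q : ℝ) / α - 1)) - B := by
      rw [Real.one_rpow, one_mul, sub_add_cancel, Real.one_rpow, mul_one]
    rw [e]
    exact h5
  have h0 := hmin.hasDerivAt_eq_zero hd
  have : l * ((α * t) * ((q : ℝ) / α)) = l * (q * t) := by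
    field_simp
  rw [this] at h0
  linarith

lemma aux_lower {r q n : ℕ} {α δ : ℝ} (hα : 1 < α) (hδ : δ ∈ Set.Ioo (0 : ℝ) 1)
    (Q : RGraph r q) (H : RGraph r (n + 1)) (hn : q ≤ n + 1)
    (i : Fin (n + 1)) (x : Fin (n + 1) → ℝ) (hx : x ∈ OPT α Q H) (hx0 : ∀ j, 0 ≤ x j)
    (hxi : x i ≤ (1 - δ) * ((n : ℝ) + 1) ^ (-(1 : ℝ) / α)) :
    specRad α Q H * (1 - q * (1 - 1 / α) * (1 - δ) / ((n : ℝ) + 1)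
      - (q : ℝ) ^ 2 / ((n : ℝ) + 1) ^ 2) ≤ specRad α Q (delVertex H i) := by
  have hα0 : 0 < α := by linarith
  obtain ⟨hδ0, hδ1⟩ := hδ
  have hm : (0 : ℝ) < (n : ℝ) + 1 := by positivity
  have hm1 : (1 : ℝ) ≤ (n : ℝ) + 1 := by
    have : (0 : ℝ) ≤ n := Nat.cast_nonneg n
    linarith
  have hqm : (q : ℝ) ≤ (n : ℝ) + 1 := by exact_mod_cast hn
  have hk := aux_kkt hα Q H i x hx hx0
  obtain ⟨hxs, hxo⟩ := hx
  set l := specRad α Q H with hl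
  have hl0 : 0 ≤ l := by
    rw [← hxo, aux_prod]
    exact Finset.sum_nonneg fun φ _ => Finset.prod_nonneg fun u _ => hx0 _
  set t := x i ^ α with ht
  have ht0 : 0 ≤ t := Real.rpow_nonneg (hx0 i) _
  have ht1 : t ≤ (1 - δ) / ((n : ℝ) + 1) := by
    calc t ≤ ((1 - δ) * ((n : ℝ) + 1) ^ (-(1 : ℝ) / α)) ^ α :=
          Real.rpow_le_rpow (hx0 i) hxi hα0.le
      _ = (1 - δ) ^ α * ((n : ℝ) + 1)⁻¹ := by
          rw [Real.mul_rpow (by linarith) (by positivity), ← Real.rpow_mul hm.le,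
            div_mul_cancel₀ _ hα0.ne', Real.rpow_neg_one]
      _ ≤ (1 - δ) * ((n : ℝ) + 1)⁻¹ := by
          gcongr
          calc (1 - δ) ^ α ≤ (1 - δ) ^ (1 : ℝ) :=
                Real.rpow_le_rpow_of_exponent_ge (by linarith) (by linarith) hα.le
            _ = 1 - δ := Real.rpow_one _
      _ = _ := by rw [div_eq_mul_inv]
  have ht1' : t * ((n : ℝ) + 1) ≤ 1 - δ := (le_div_iff₀ hm).1 ht1
  have htlt : t < 1 := by nlinarith
  have hsum : t + ∑ j, x (i.succAbove j) ^ α = 1 := by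
    have h : ∑ j, |x j| ^ α = 1 := hxs
    simp_rw [fun j => abs_of_nonneg (hx0 j)] at h
    rwa [Fin.sum_univ_succAbove _ i] at h
  have hSe : ∑ j, x (i.succAbove j) ^ α = 1 - t := by linarith
  have h := aux_le hα0 Q (delVertex H i) (fun j => x (i.succAbove j)) (fun j => hx0 _)
    (by rw [hSe]; linarith)
  rw [hSe, hk] at h
  set p := (q : ℝ) / α with hp
  have hp0 : 0 ≤ p := by positivity
  have hw : 0 < (1 - t) ^ p := Real.rpow_pos_of_pos (by linarith) _
  have hwb : (1 - t) ^ p * (1 + p * t) ≤ 1 := by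
    have h1 : (1 - t) ^ p ≤ Real.exp (-(p * t)) := by
      calc (1 - t) ^ p ≤ (Real.exp (-t)) ^ p :=
            Real.rpow_le_rpow (by linarith) (Real.one_sub_le_exp_neg t) hp0
        _ = _ := by rw [← Real.exp_mul]; congr 1; ring
    have h2 : 1 + p * t ≤ Real.exp (p * t) := by
      have := Real.add_one_le_exp (p * t)
      linarith
    calc (1 - t) ^ p * (1 + p * t) ≤ Real.exp (-(p * t)) * Real.exp (p * t) := by
          gcongr
      _ = 1 := by rw [← Real.exp_add]; simp
  have hqt : q * t ≤ 1 := by nlinarith [mul_le_mul_of_nonneg_right hqm ht0]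
  have hstep : l * ((1 - q * t) * (1 + p * t)) ≤ specRad α Q (delVertex H i) := by
    have h3 : l * (1 - q * t) * ((1 - t) ^ p)⁻¹ ≤ specRad α Q (delVertex H i) := by
      rw [← div_eq_mul_inv, div_le_iff₀ hw]; exact h
    have h4 : 1 + p * t ≤ ((1 - t) ^ p)⁻¹ := by
      rw [← one_div, le_div_iff₀ hw]; linarith
    have h5 : 0 ≤ l * (1 - q * t) := mul_nonneg hl0 (by linarith)
    have := mul_le_mul_of_nonneg_left h4 h5
    linarith
  refine le_trans (mul_le_mul_of_nonneg_left ?_ hl0) hstep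
  have hpq : p ≤ q := div_le_self (Nat.cast_nonneg q) hα.le
  have hkap : 0 ≤ q * (1 - 1 / α) := by
    have : 1 / α ≤ 1 := by rw [div_le_one hα0]; exact hα.le
    exact mul_nonneg (Nat.cast_nonneg q) (by linarith)
  have e1 : q * (1 - 1 / α) * t ≤ q * (1 - 1 / α) * (1 - δ) / ((n : ℝ) + 1) := by
    rw [mul_div_assoc]
    exact mul_le_mul_of_nonneg_left ht1 hkap
  have ht2 : t ≤ 1 / ((n : ℝ) + 1) := by
    rw [le_div_iff₀ hm]; linarith
  have e2 : (q : ℝ) * t * (p * t) ≤ (q : ℝ) ^ 2 / ((n : ℝ) + 1) ^ 2 := by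
    calc (q : ℝ) * t * (p * t) ≤ (q : ℝ) * (1 / ((n : ℝ) + 1)) * (q * (1 / ((n : ℝ) + 1))) := by
          gcongr
      _ = _ := by field_simp
  have e3 : q * (1 - 1 / α) * t = q * t - p * t := by
    rw [hp]; ring
  nlinarith

lemma aux_lim (p : ℝ) : Tendsto (fun n : ℕ => ((n : ℝ) + 1) *
    ((1 - ((n : ℝ) + 1)⁻¹) ^ (-p) - 1)) atTop (nhds p) := by
  have hd : HasDerivAt (fun h : ℝ => (1 - h) ^ (-p)) p 0 := by
    have h1 : HasDerivAt (fun h : ℝ => 1 - h) (-1) 0 := by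
      simpa using (hasDerivAt_id (0 : ℝ)).const_sub 1
    have h2 := h1.rpow_const (p := -p) (Or.inl (by simp))
    convert h2 using 1
    simp
  rw [hasDerivAt_iff_tendsto_slope_zero] at hd
  have ht : Tendsto (fun n : ℕ => ((n : ℝ) + 1)⁻¹) atTop (nhdsWithin 0 {0}ᶜ) := by
    rw [tendsto_nhdsWithin_iff]
    constructor
    · simpa [one_div] using tendsto_one_div_add_atTop_nhds_zero_nat (𝕜 := ℝ)
    · refine Eventually.of_forall fun n => ?_
      have : (0 : ℝ) < ((n : ℝ) + 1)⁻¹ := by positivity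
      exact this.ne'
  have := hd.comp ht
  refine this.congr fun n => ?_
  simp

/-- **Lemma (deleting a light vertex, second part):** under smoothness and spectral
balancedness, deleting a light vertex of an `F`-free graph with spectral radius at least
`μ_n` yields a graph with spectral radius exceeding `μ_{n-1}`. (The `n` of the paper is
the `n + 1` here.) -/
theorem delete_light_vertex_beats_mu {r q : ℕ} (hr : 2 ≤ r) (hrq : r ≤ q)
    {α δ : ℝ} (hα : 1 < α) (hδ : δ ∈ Set.Ioo (0 : ℝ) 1)
    (Q : RGraph r q) (F HH : Family r) (hatpi : ℝ)
    (hlim : Tendsto (fun n : ℕ => (injNum Q F n : ℝ) / (n : ℝ) ^ q) atTop (nhds hatpi))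
    (hpi : 0 < hatpi)
    (hfree : ∀ n : ℕ, ∀ H ∈ HH n, FFree F H)
    (hher : Hereditary HH)
    (N : ℕ) (ξ : ℝ) (hξ : 0 < ξ) (hξ2 : ξ < q * (α - 1) * hatpi * δ / (4 * α))
    (hsm : SmoothFam Q F hatpi (ξ / 5) N) (hbal : BalancedSpec α Q F HH (ξ / 5) N) :
    ∃ N1 : ℕ, ∀ n : ℕ, N1 ≤ n + 1 → ∀ H : RGraph r (n + 1), FFree F H →
      famSpec α Q HH (n + 1) ≤ specRad α Q H →
      ∀ x ∈ OPT α Q H, (∀ j, 0 ≤ x j) →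
      ∀ i : Fin (n + 1), x i ≤ (1 - δ) * ((n : ℝ) + 1) ^ (-(1 : ℝ) / α) →
        famSpec α Q HH n < specRad α Q (delVertex H i) := by
  have hα0 : 0 < α := by linarith
  set p : ℝ := (q : ℝ) / α with hp
  set K : ℝ := q * (1 - 1 / α) * (1 - δ) with hK
  have hinv : Tendsto (fun n : ℕ => ((n : ℝ) + 1)⁻¹) atTop (nhds 0) := by
    simpa [one_div] using tendsto_one_div_add_atTop_nhds_zero_nat (𝕜 := ℝ)
  have ha : Tendsto (fun n : ℕ => (injNum Q F (n + 1) : ℝ) / ((n : ℝ) + 1) ^ q) atTop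
      (nhds hatpi) := by
    have := hlim.comp (tendsto_add_atTop_nat 1)
    refine this.congr fun n => ?_
    simp
  have hbase : Tendsto (fun n : ℕ => 1 - ((n : ℝ) + 1)⁻¹) atTop (nhds 1) := by
    simpa using hinv.const_sub 1
  have hpow : ∀ e : ℝ, Tendsto (fun n : ℕ => (1 - ((n : ℝ) + 1)⁻¹) ^ e) atTop (nhds 1) := by
    intro e
    simpa using hbase.rpow_const (p := e) (Or.inl one_ne_zero)
  have hfac : Tendsto (fun n : ℕ => 1 - K * ((n : ℝ) + 1)⁻¹ - (q : ℝ) ^ 2 * ((n : ℝ) + 1)⁻¹ ^ 2)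
      atTop (nhds 1) := by
    simpa using ((hinv.const_mul K).const_sub 1).sub ((hinv.pow 2).const_mul ((q : ℝ) ^ 2))
  have hG : Tendsto (fun n : ℕ =>
      -((injNum Q F (n + 1) : ℝ) / ((n : ℝ) + 1) ^ q) * (K + (q : ℝ) ^ 2 * ((n : ℝ) + 1)⁻¹)
      - ξ / 5 * (1 - K * ((n : ℝ) + 1)⁻¹ - (q : ℝ) ^ 2 * ((n : ℝ) + 1)⁻¹ ^ 2)
      - ((injNum Q F (n + 1) : ℝ) / ((n : ℝ) + 1) ^ q) *
        (((n : ℝ) + 1) * ((1 - ((n : ℝ) + 1)⁻¹) ^ (-p) - 1))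
      + (q * hatpi - ξ / 5) * (1 - ((n : ℝ) + 1)⁻¹) ^ (-p)
      - ξ / 5 * (1 - ((n : ℝ) + 1)⁻¹) ^ ((q : ℝ) - p - 1)) atTop
      (nhds (-hatpi * (K + (q : ℝ) ^ 2 * 0) - ξ / 5 * 1 - hatpi * p
        + (q * hatpi - ξ / 5) * 1 - ξ / 5 * 1)) :=
    ((((ha.neg.mul ((hinv.const_mul _).const_add K)).sub (hfac.const_mul _)).sub
      (ha.mul (aux_lim p))).add ((hpow _).const_mul _)).sub ((hpow _).const_mul _)
  have hpos : 0 < -hatpi * (K + (q : ℝ) ^ 2 * 0) - ξ / 5 * 1 - hatpi * p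
        + (q * hatpi - ξ / 5) * 1 - ξ / 5 * 1 := by
    have h1 : q * (α - 1) * hatpi * δ / (4 * α) = (q * (1 - 1 / α) * hatpi * δ) / 4 := by
      field_simp
    have h2 : -hatpi * (K + (q : ℝ) ^ 2 * 0) - ξ / 5 * 1 - hatpi * p
        + (q * hatpi - ξ / 5) * 1 - ξ / 5 * 1 = q * (1 - 1 / α) * hatpi * δ - 3 * ξ / 5 := by
      rw [hK, hp]; ring
    rw [h2]
    rw [h1] at hξ2
    linarith
  have hev := (hG.eventually (lt_mem_nhds hpos)).and
    ((hfac.eventually (lt_mem_nhds one_pos)).and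
      ((eventually_ge_atTop N).and ((eventually_ge_atTop q).and (eventually_ge_atTop 1))))
  obtain ⟨M, hM⟩ := eventually_atTop.1 hev
  refine ⟨M + 1, fun n hn H hH hfs x hx hx0 i hxi => ?_⟩
  obtain ⟨g1, g2, hnN, hnq, hn1⟩ := hM n (by omega)
  have hlow := aux_lower hα hδ Q H (by omega) i x hx hx0 hxi
  rw [← hK] at hlow
  refine lt_of_lt_of_le ?_ hlow
  have b1 := (abs_le.1 (hbal (n + 1) (by omega))).1
  have b2 := (abs_le.1 (hbal n hnN)).2
  have s1 := (abs_le.1 (hsm (n + 1) (by omega))).1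
  simp only [Nat.add_sub_cancel, Nat.cast_add, Nat.cast_one] at b1 b2 s1
  rw [← hp] at b1 b2
  have hm : (0 : ℝ) < (n : ℝ) + 1 := by positivity
  have hn0 : (0 : ℝ) < n := by exact_mod_cast hn1
  set m : ℝ := (n : ℝ) + 1 with hmdef
  have hnm : (n : ℝ) = m * (1 - m⁻¹) := by
    rw [mul_sub, mul_inv_cancel₀ hm.ne', hmdef]; ring
  set c : ℝ := 1 - m⁻¹ with hc
  have hc0 : 0 < c := by
    rw [hnm] at hn0
    exact (mul_pos_iff_of_pos_left hm).1 hn0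
  set I : ℝ := (injNum Q F (n + 1) : ℝ) with hI
  set J : ℝ := (injNum Q F n : ℝ) with hJ
  set a : ℝ := I / m ^ q with had
  have hIa : I = a * m ^ q := by
    rw [had, div_mul_cancel₀ _ (by positivity)]
  set R : ℝ := m ^ ((q : ℝ) - p) with hR
  have hR0 : 0 < R := Real.rpow_pos_of_pos hm _
  have r1 : m ^ q * m ^ (-p) = R := by
    rw [hR, sub_eq_add_neg, Real.rpow_add hm, Real.rpow_natCast]
  have r2 : m ^ ((q : ℝ) - p - 1) = R * m⁻¹ := by
    rw [Real.rpow_sub_one hm.ne', div_eq_mul_inv]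
  have r3 : m ^ (q - 1) * m ^ (-p) = R * m⁻¹ := by
    rw [← r1]
    have : m ^ q = m ^ (q - 1) * m := by
      rw [← pow_succ]; congr 1; omega
    rw [this]
    field_simp
  have d1 : I / m ^ p = a * R := by
    rw [div_eq_mul_inv, ← Real.rpow_neg hm.le, hIa, mul_assoc, r1]
  rw [d1, r2] at b1
  -- lower side
  have low : (a * R - ξ / 5 * (R * m⁻¹)) * (1 - K * m⁻¹ - (q : ℝ) ^ 2 * m⁻¹ ^ 2) ≤
      specRad α Q H * (1 - K / m - (q : ℝ) ^ 2 / m ^ 2) := by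
    have : 1 - K / m - (q : ℝ) ^ 2 / m ^ 2 = 1 - K * m⁻¹ - (q : ℝ) ^ 2 * m⁻¹ ^ 2 := by
      rw [div_eq_mul_inv, div_eq_mul_inv, inv_pow]
    rw [this]
    exact mul_le_mul_of_nonneg_right (by linarith) g2.le
  refine lt_of_lt_of_le ?_ low
  -- upper side
  have hW : 0 < c ^ (-p) := Real.rpow_pos_of_pos hc0 _
  have d2 : J / (n : ℝ) ^ p ≤ (a * R - (q * hatpi - ξ / 5) * (R * m⁻¹)) * c ^ (-p) := by
    rw [div_eq_mul_inv, ← Real.rpow_neg hn0.le, hnm, Real.mul_rpow hm.le hc0.le, ← mul_assoc]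
    refine mul_le_mul_of_nonneg_right ?_ hW.le
    have hJle : J ≤ a * m ^ q - (q * hatpi - ξ / 5) * m ^ (q - 1) := by
      rw [← hIa]; linarith
    have := mul_le_mul_of_nonneg_right hJle (Real.rpow_pos_of_pos hm (-p)).le
    calc J * m ^ (-p) ≤ _ := this
      _ = a * (m ^ q * m ^ (-p)) - (q * hatpi - ξ / 5) * (m ^ (q - 1) * m ^ (-p)) := by ring
      _ = _ := by rw [r1, r3]
  have d3 : (n : ℝ) ^ ((q : ℝ) - p - 1) = R * m⁻¹ * c ^ ((q : ℝ) - p - 1) := by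
    rw [hnm, Real.mul_rpow hm.le hc0.le, r2]
  rw [d3] at b2
  have fin : 0 < (R * m⁻¹) * (-a * (K + (q : ℝ) ^ 2 * m⁻¹)
      - ξ / 5 * (1 - K * m⁻¹ - (q : ℝ) ^ 2 * m⁻¹ ^ 2)
      - a * (m * (c ^ (-p) - 1)) + (q * hatpi - ξ / 5) * c ^ (-p)
      - ξ / 5 * c ^ ((q : ℝ) - p - 1)) := mul_pos (by positivity) g1
  have fin2 : (R * m⁻¹) * (-a * (K + (q : ℝ) ^ 2 * m⁻¹)
      - ξ / 5 * (1 - K * m⁻¹ - (q : ℝ) ^ 2 * m⁻¹ ^ 2)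
      - a * (m * (c ^ (-p) - 1)) + (q * hatpi - ξ / 5) * c ^ (-p)
      - ξ / 5 * c ^ ((q : ℝ) - p - 1)) =
      (a * R - ξ / 5 * (R * m⁻¹)) * (1 - K * m⁻¹ - (q : ℝ) ^ 2 * m⁻¹ ^ 2) -
      ((a * R - (q * hatpi - ξ / 5) * (R * m⁻¹)) * c ^ (-p) +
        ξ / 5 * (R * m⁻¹ * c ^ ((q : ℝ) - p - 1))) := by
    generalize c ^ (-p) = W
    generalize c ^ ((q : ℝ) - p - 1) = V
    have hmm : m⁻¹ * m = 1 := inv_mul_cancel₀ hm.ne'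
    linear_combination (-R * a * (W - 1)) * hmm
  linarith
end
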